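/- (Davie) Let A be a unital commutative complex Banach algebra. For every n ≥ 1, the continuous map GL_n(A) → GL_n(C(X_A)) induced by the Gelfand transform is a homotopy equivalence of topological spaces. -/

import Mathlib

/-- `GL_n(A)`: the group of invertible `n × n` matrices over `A`, topologized as a
subspace of `M_n(A)`. -/
abbrev GLn (A : Type*) [Ring A] [TopologicalSpace A] (n : ℕ) : Type _ :=
  {M : Matrix (Fin n) (Fin n) A // IsUnit M}

/-- The map `GL_n(A) → GL_n(B)` induced by a ring morphism `A → B` (applied entrywise). -/
def glMap {A B : Type*} [Ring A] [Ring B] [TopologicalSpace A] [TopologicalSpace B]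
    (φ : A →+* B) (n : ℕ) : GLn A n → GLn B n :=
  fun M => ⟨M.1.map φ, φ.mapMatrix.isUnit_map M.2⟩

lemma continuous_glMap {A B : Type*} [Ring A] [Ring B] [TopologicalSpace A] [TopologicalSpace B]
    (φ : A →+* B) (n : ℕ) (hφ : Continuous φ) : Continuous (glMap φ n) :=
  (continuous_subtype_val.matrix_map hφ).subtype_mk _

lemma gelfandTransform_continuous (A : Type*) [NormedCommRing A] [NormedAlgebra ℂ A]
    [CompleteSpace A] : Continuous (WeakDual.gelfandTransform ℂ A) := by
  refine AddMonoidHomClass.continuous_of_bound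
    (WeakDual.gelfandTransform ℂ A).toLinearMap ‖(1 : A)‖ ?_
  intro a
  rw [mul_comm]
  refine (ContinuousMap.norm_le _ (by positivity)).2 fun χ => ?_
  exact AlgHom.norm_apply_le_self_mul_norm_one χ a

set_option linter.unusedVariables false
set_option linter.unusedSectionVars false

/-! ### ell-one convolution algebras -/


section EllOne

universe u

/-- Finitely supported functions `M → A` with the ell-one norm and convolution product. -/
def PreEll (A : Type u) [NormedCommRing A] (M : Type) [AddCommMonoid M] : Type u :=
  AddMonoidAlgebra A M

namespace PreEll

variable {A : Type u} [NormedCommRing A] [NormedAlgebra ℂ A] {M : Type} [AddCommMonoid M]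

noncomputable instance : CommRing (PreEll A M) :=
  inferInstanceAs (CommRing (AddMonoidAlgebra A M))

noncomputable instance : Algebra ℂ (PreEll A M) :=
  inferInstanceAs (Algebra ℂ (AddMonoidAlgebra A M))

/-- monomials -/
noncomputable def mono (m : M) (a : A) : PreEll A M := AddMonoidAlgebra.single m a

/-- underlying coefficient function -/
def cf (f : PreEll A M) : M →₀ A := AddMonoidAlgebra.coeff f

lemma cf_add (f g : PreEll A M) : cf (f + g) = cf f + cf g := rfl
lemma cf_zero : cf (0 : PreEll A M) = 0 := rfl
lemma cf_neg (f : PreEll A M) : cf (-f) = - cf f := rfl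
lemma cf_smul (c : ℂ) (f : PreEll A M) : cf (c • f) = c • cf f := rfl
lemma cf_mono (m : M) (a : A) : cf (mono m a) = Finsupp.single m a := rfl
lemma mono_mul (m k : M) (a b : A) : mono m a * mono k b = mono (m + k) (a * b) :=
  AddMonoidAlgebra.single_mul_single ..
lemma mono_add (m : M) (a b : A) : mono m (a + b) = mono m a + mono m b :=
  AddMonoidAlgebra.single_add ..
lemma mono_smul (m : M) (c : ℂ) (a : A) : mono m (c • a) = c • mono m a :=
  (AddMonoidAlgebra.smul_single ..).symm
lemma one_eq : (1 : PreEll A M) = mono 0 1 := AddMonoidAlgebra.one_def ..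

lemma ind {p : PreEll A M → Prop} (h0 : p 0) (hm : ∀ m a, p (mono m a))
    (ha : ∀ f g, p f → p g → p (f + g)) (f : PreEll A M) : p f := by
  have : f = AddMonoidAlgebra.ofCoeff (cf f) := rfl
  rw [this]
  induction cf f using Finsupp.induction_linear with
  | zero => exact h0
  | add f g hf hg => exact ha _ _ hf hg
  | single m a => exact hm m a

/-- the ell-one norm -/
noncomputable def nrm (f : PreEll A M) : ℝ := (cf f).sum fun _ a => ‖a‖

lemma nrm_eq (f : PreEll A M) {s : Finset M} (hs : (cf f).support ⊆ s) :
    nrm f = ∑ m ∈ s, ‖cf f m‖ :=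
  Finsupp.sum_of_support_subset _ hs _ (by simp)

lemma nrm_add (f g : PreEll A M) : nrm (f + g) ≤ nrm f + nrm g := by
  classical
  rw [nrm_eq f Finset.subset_union_left, nrm_eq g Finset.subset_union_right,
    nrm_eq (f + g) (s := (cf f).support ∪ (cf g).support) Finsupp.support_add,
    ← Finset.sum_add_distrib]
  exact Finset.sum_le_sum fun m _ => norm_add_le _ _

lemma nrm_mono (m : M) (a : A) : nrm (mono m a) = ‖a‖ := by
  simp [nrm, cf_mono]

lemma nrm_nonneg (f : PreEll A M) : 0 ≤ nrm f := Finset.sum_nonneg fun _ _ => norm_nonneg _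

lemma eq_sum (f : PreEll A M) : f = ∑ m ∈ (cf f).support, mono m (cf f m) := by
  have := (AddMonoidAlgebra.sum_coeff_single (f : AddMonoidAlgebra A M))
  exact this.symm

lemma nrm_sum {ι : Type*} (s : Finset ι) (f : ι → PreEll A M) :
    nrm (∑ i ∈ s, f i) ≤ ∑ i ∈ s, nrm (f i) := by
  classical
  induction s using Finset.induction_on with
  | empty => simp [nrm, cf_zero]
  | insert i s hi ih =>
    rw [Finset.sum_insert hi, Finset.sum_insert hi]
    exact (nrm_add _ _).trans (by gcongr)

lemma nrm_mul (f g : PreEll A M) : nrm (f * g) ≤ nrm f * nrm g := by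
  conv_lhs => rw [eq_sum f, eq_sum g, Finset.sum_mul_sum]
  refine (nrm_sum _ _).trans ?_
  rw [nrm, nrm, Finsupp.sum, Finsupp.sum, Finset.sum_mul_sum]
  refine Finset.sum_le_sum fun i _ => (nrm_sum _ _).trans (Finset.sum_le_sum fun j _ => ?_)
  rw [mono_mul, nrm_mono]
  exact norm_mul_le _ _

noncomputable instance : NormedCommRing (PreEll A M) :=
  { (inferInstance : CommRing (PreEll A M)),
    AddGroupNorm.toNormedAddCommGroup
    ({ toFun := nrm
       map_zero' := by simp [nrm, cf_zero]
       add_le' := nrm_add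
       neg' := fun f => by
        rw [nrm_eq (-f) (s := (cf f).support) (by rw [cf_neg, Finsupp.support_neg]),
          nrm_eq f subset_rfl]
        simp [cf_neg]
       eq_zero_of_map_eq_zero' := fun f hf => by
        rw [eq_sum f]
        refine Finset.sum_eq_zero fun m hm => ?_
        have := (Finset.sum_eq_zero_iff_of_nonneg (fun _ _ => norm_nonneg _)).1 hf m hm
        rw [norm_eq_zero.1 this]
        exact AddMonoidAlgebra.single_zero _ } : AddGroupNorm (PreEll A M)) with
    norm_mul_le := nrm_mul }

lemma norm_def (f : PreEll A M) : ‖f‖ = nrm f := rfl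

noncomputable instance : NormedAlgebra ℂ (PreEll A M) where
  norm_smul_le c f := by
    rw [norm_def, norm_def, nrm_eq (c • f) (s := (cf f).support)
      (by rw [cf_smul]; exact Finsupp.support_smul), nrm, Finsupp.sum, Finset.mul_sum]
    exact Finset.sum_le_sum fun m _ => by rw [cf_smul]; exact norm_smul_le _ _

end PreEll

/-- The ell-one convolution algebra. -/
abbrev Ell (A : Type u) [NormedCommRing A] [NormedAlgebra ℂ A] (M : Type) [AddCommMonoid M] :
    Type u :=
  UniformSpace.Completion (PreEll A M)

namespace Ell

variable {A : Type u} [NormedCommRing A] [NormedAlgebra ℂ A] {M : Type} [AddCommMonoid M]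

noncomputable example : NormedCommRing (Ell A M) := inferInstance
noncomputable example : NormedAlgebra ℂ (Ell A M) := inferInstance
noncomputable example : CompleteSpace (Ell A M) := inferInstance

/-- monomials in the ell-one algebra -/
noncomputable def mono (m : M) (a : A) : Ell A M := ((PreEll.mono m a : PreEll A M) : Ell A M)

lemma norm_mono (m : M) (a : A) : ‖(mono m a : Ell A M)‖ = ‖a‖ := by
  rw [mono, UniformSpace.Completion.norm_coe, PreEll.norm_def, PreEll.nrm_mono]

lemma mono_mul (m k : M) (a b : A) : (mono m a : Ell A M) * mono k b = mono (m + k) (a * b) := by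
  rw [mono, mono, ← UniformSpace.Completion.coe_mul, PreEll.mono_mul]; rfl

lemma mono_add (m : M) (a b : A) : (mono m (a + b) : Ell A M) = mono m a + mono m b := by
  rw [mono, PreEll.mono_add, UniformSpace.Completion.coe_add]; rfl

lemma mono_smul (m : M) (c : ℂ) (a : A) : (mono m (c • a) : Ell A M) = c • mono m a := by
  rw [mono, PreEll.mono_smul, UniformSpace.Completion.coe_smul]; rfl

lemma one_eq : (1 : Ell A M) = mono 0 1 := by
  rw [← UniformSpace.Completion.coe_one, PreEll.one_eq]; rfl

/-- constants -/
noncomputable def const : A →ₐ[ℂ] Ell A M :=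
  AlgHom.ofLinearMap
    { toFun := mono 0
      map_add' := mono_add 0
      map_smul' := mono_smul 0 } one_eq.symm (fun a b => by
        change (mono 0 (a * b) : Ell A M) = mono 0 a * mono 0 b
        rw [mono_mul, add_zero])

lemma const_apply (a : A) : (const a : Ell A M) = mono 0 a := rfl

lemma continuous_const' : Continuous (const : A →ₐ[ℂ] Ell A M) :=
  AddMonoidHomClass.continuous_of_bound (const : A →ₐ[ℂ] Ell A M) 1
    fun a => by rw [const_apply, norm_mono, one_mul]

/-- the basic unitary elements -/
noncomputable def zt (m : M) : Ell A M := mono m 1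

lemma zt_zero : (zt 0 : Ell A M) = 1 := one_eq.symm

lemma zt_add (m k : M) : (zt (m + k) : Ell A M) = zt m * zt k := by
  rw [zt, zt, zt, mono_mul, one_mul]

lemma norm_zt (m : M) : ‖(zt m : Ell A M)‖ = ‖(1 : A)‖ := norm_mono _ _

lemma mono_eq (m : M) (a : A) : (mono m a : Ell A M) = const a * zt m := by
  rw [const_apply, zt, mono_mul, mul_one, zero_add]

lemma ind {p : Ell A M → Prop} (hc : IsClosed {f | p f})
    (hm : ∀ m a, p (mono m a))
    (ha : ∀ f g, p f → p g → p (f + g)) (f : Ell A M) : p f := by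
  induction f using UniformSpace.Completion.induction_on with
  | hp => exact hc
  | ih f =>
    induction f using PreEll.ind with
    | h0 =>
      have := hm (0 : M) 0
      rwa [← const_apply, map_zero] at this
    | hm m a => exact hm m a
    | ha f g hf hg => rw [UniformSpace.Completion.coe_add]; exact ha _ _ hf hg

lemma exists_lift {D : Type*} [NormedCommRing D] [NormedAlgebra ℂ D] [CompleteSpace D]
    (g : A →ₐ[ℂ] D) (hg : Continuous g) (e : M → D) (C : ℝ) (he : ∀ m, ‖e m‖ ≤ C) :
    ∃ L : Ell A M →L[ℂ] D, ∀ m a, L (mono m a) = g a * e m := by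
  let g' : A →L[ℂ] D := ⟨g.toLinearMap, hg⟩
  have hC : 0 ≤ C := (norm_nonneg _).trans (he 0)
  let l0 : PreEll A M →ₗ[ℂ] D :=
    { toFun := fun f => (PreEll.cf f).sum fun m a => g a * e m
      map_add' := fun f f' => by
        rw [PreEll.cf_add]
        exact Finsupp.sum_add_index' (by simp) (by intros; rw [map_add, add_mul])
      map_smul' := fun c f => by
        rw [PreEll.cf_smul, Finsupp.sum_smul_index' (by simp)]
        simp [Finsupp.smul_sum] }
  have hb : ∀ f, ‖l0 f‖ ≤ (‖g'‖ * C) * ‖f‖ := fun f => by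
    change ‖∑ m ∈ (PreEll.cf f).support, _‖ ≤ _
    refine (norm_sum_le _ _).trans ?_
    rw [PreEll.norm_def, PreEll.nrm, Finsupp.sum, Finset.mul_sum]
    refine Finset.sum_le_sum fun m _ => (norm_mul_le _ _).trans ?_
    have h1 : ‖g (PreEll.cf f m)‖ ≤ ‖g'‖ * ‖PreEll.cf f m‖ := g'.le_opNorm _
    calc _ ≤ (‖g'‖ * ‖PreEll.cf f m‖) * C := by
            gcongr
            exact he m
      _ = _ := by ring
  let l1 : PreEll A M →L[ℂ] D := l0.mkContinuous _ hb
  refine ⟨l1.extend (UniformSpace.Completion.toComplL (𝕜 := ℂ) (E := PreEll A M)), fun m a => ?_⟩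
  have := ContinuousLinearMap.extend_eq l1 (e := UniformSpace.Completion.toComplL (𝕜 := ℂ) (E := PreEll A M))
    (UniformSpace.Completion.denseRange_coe) (UniformSpace.Completion.isUniformInducing_coe _) (PreEll.mono m a)
  refine this.trans ?_
  change (PreEll.cf (PreEll.mono m a)).sum (fun m a => g a * e m) = _
  rw [PreEll.cf_mono, Finsupp.sum_single_index (by simp)]

/-- The linear map determined by images of monomials. -/
noncomputable def lift {D : Type*} [NormedCommRing D] [NormedAlgebra ℂ D] [CompleteSpace D]
    (g : A →ₐ[ℂ] D) (hg : Continuous g) (e : M → D) (C : ℝ) (he : ∀ m, ‖e m‖ ≤ C) :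
    Ell A M →L[ℂ] D := (exists_lift g hg e C he).choose

lemma lift_mono {D : Type*} [NormedCommRing D] [NormedAlgebra ℂ D] [CompleteSpace D]
    (g : A →ₐ[ℂ] D) (hg : Continuous g) (e : M → D) (C : ℝ) (he : ∀ m, ‖e m‖ ≤ C) (m : M) (a : A) :
    lift g hg e C he (mono m a) = g a * e m := (exists_lift g hg e C he).choose_spec m a

/-- The algebra morphism determined by images of monomials. -/
noncomputable def liftHom {D : Type*} [NormedCommRing D] [NormedAlgebra ℂ D] [CompleteSpace D]
    (g : A →ₐ[ℂ] D) (hg : Continuous g) (e : M → D) (C : ℝ) (he : ∀ m, ‖e m‖ ≤ C)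
    (h0 : e 0 = 1) (ha : ∀ m k, e (m + k) = e m * e k) : Ell A M →ₐ[ℂ] D :=
  AlgHom.ofLinearMap (lift g hg e C he).toLinearMap
    (by
      change lift g hg e C he 1 = 1
      rw [one_eq, lift_mono, map_one, one_mul, h0])
    (fun x y => by
      change lift g hg e C he (x * y) = lift g hg e C he x * lift g hg e C he y
      induction x using ind with
      | hc =>
        exact isClosed_eq (by fun_prop) (by fun_prop)
      | hm m a =>
        induction y using ind with
        | hc => exact isClosed_eq (by fun_prop) (by fun_prop)
        | hm k b => rw [mono_mul, lift_mono, lift_mono, lift_mono, map_mul, ha]; ring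
        | ha f f' hf hf' => rw [mul_add, map_add, hf, hf', map_add, mul_add]
      | ha f f' hf hf' => rw [add_mul, map_add, hf, hf', map_add, add_mul])

section
variable {D : Type*} [NormedCommRing D] [NormedAlgebra ℂ D] [CompleteSpace D]
    (g : A →ₐ[ℂ] D) (hg : Continuous g) (e : M → D) (C : ℝ) (he : ∀ m, ‖e m‖ ≤ C)
    (h0 : e 0 = 1) (ha : ∀ m k, e (m + k) = e m * e k)

lemma liftHom_mono (m : M) (a : A) :
    liftHom g hg e C he h0 ha (mono m a) = g a * e m := lift_mono g hg e C he m a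

lemma continuous_liftHom : Continuous (liftHom g hg e C he h0 ha) :=
  (lift g hg e C he).continuous

lemma liftHom_const (a : A) : liftHom g hg e C he h0 ha (const a) = g a := by
  rw [const_apply, liftHom_mono, h0, mul_one]

lemma liftHom_zt (m : M) : liftHom g hg e C he h0 ha (zt m) = e m := by
  rw [zt, liftHom_mono, map_one, one_mul]

end

end Ell
end EllOne

section Chars

universe u

open Topology

noncomputable instance AlgHom.chTop (A : Type u) [NormedCommRing A] [NormedAlgebra ℂ A] :
    TopologicalSpace (A →ₐ[ℂ] ℂ) :=
  TopologicalSpace.induced (fun χ a => χ a) inferInstance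

variable {A : Type u} [NormedCommRing A] [NormedAlgebra ℂ A]

lemma ch_continuous_eval (a : A) : Continuous fun χ : A →ₐ[ℂ] ℂ => χ a :=
  (continuous_apply a).comp continuous_induced_dom

lemma ch_continuous_of {T : Type*} [TopologicalSpace T] {f : T → (A →ₐ[ℂ] ℂ)}
    (h : ∀ a, Continuous fun t => f t a) : Continuous f :=
  continuous_induced_rng.2 (continuous_pi h)

lemma ch_continuous [CompleteSpace A] (χ : A →ₐ[ℂ] ℂ) : Continuous χ :=
  AddMonoidHomClass.continuous_of_bound χ ‖(1 : A)‖ fun a => by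
    rw [mul_comm]; exact AlgHom.norm_apply_le_self_mul_norm_one χ a

instance ch_t2 : T2Space (A →ₐ[ℂ] ℂ) :=
  T2Space.of_injective_continuous (f := fun (χ : A →ₐ[ℂ] ℂ) a => χ a)
    (fun x y h => AlgHom.ext fun a => congrFun h a) continuous_induced_dom

instance ch_compact [CompleteSpace A] : CompactSpace (A →ₐ[ℂ] ℂ) := by
  have h : Continuous (WeakDual.CharacterSpace.equivAlgHom (𝕜 := ℂ) (A := A)) := by
    refine ch_continuous_of fun a => ?_
    exact (WeakDual.eval_continuous a).comp continuous_subtype_val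
  exact (WeakDual.CharacterSpace.equivAlgHom (𝕜 := ℂ) (A := A)).surjective.compactSpace h

lemma exists_ch_of_ne_top [CompleteSpace A] (I : Ideal A) (hI : I ≠ ⊤) :
    ∃ χ : A →ₐ[ℂ] ℂ, ∀ x ∈ I, χ x = 0 := by
  obtain ⟨J, hJ, hIJ⟩ := I.exists_le_maximal hI
  exact ⟨WeakDual.CharacterSpace.equivAlgHom J.toCharacterSpace, fun x hx =>
    J.toCharacterSpace_apply_eq_zero_of_mem (hIJ hx)⟩

lemma isUnit_of_ch [CompleteSpace A] {a : A} (h : ∀ χ : A →ₐ[ℂ] ℂ, χ a ≠ 0) : IsUnit a := by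
  by_contra hu
  obtain ⟨χ, hχ⟩ := exists_ch_of_ne_top (Ideal.span {a}) (by rwa [Ne, Ideal.span_singleton_eq_top])
  exact h χ (hχ a (Ideal.mem_span_singleton_self a))

lemma ch_ne_zero {a : A} (h : IsUnit a) (χ : A →ₐ[ℂ] ℂ) : χ a ≠ 0 := (h.map χ).ne_zero

lemma mat_isUnit_of_ch [CompleteSpace A] {n : ℕ} {M : Matrix (Fin n) (Fin n) A}
    (h : ∀ χ : A →ₐ[ℂ] ℂ, (M.map χ).det ≠ 0) : IsUnit M := by
  rw [Matrix.isUnit_iff_isUnit_det]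
  refine isUnit_of_ch fun χ => ?_
  have := AlgHom.map_det χ M
  rw [this]; exact h χ

lemma mat_ch_ne_zero {n : ℕ} {M : Matrix (Fin n) (Fin n) A}
    (h : IsUnit M) (χ : A →ₐ[ℂ] ℂ) : (M.map χ).det ≠ 0 := by
  rw [Matrix.isUnit_iff_isUnit_det] at h
  have := AlgHom.map_det χ M
  rw [AlgHom.mapMatrix_apply] at this
  rw [← this]; exact ch_ne_zero h χ

lemma mat_isUnit_iff_ch [CompleteSpace A] {n : ℕ} {M : Matrix (Fin n) (Fin n) A} :
    IsUnit M ↔ ∀ χ : A →ₐ[ℂ] ℂ, (M.map χ).det ≠ 0 := ⟨mat_ch_ne_zero, mat_isUnit_of_ch⟩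

lemma norm_le_one_of_pow_bounded [CompleteSpace A] (χ : A →ₐ[ℂ] ℂ) (z : A) (C : ℝ)
    (h : ∀ k : ℕ, ‖z ^ k‖ ≤ C) : ‖χ z‖ ≤ 1 := by
  by_contra hlt
  push Not at hlt
  obtain ⟨k, hk⟩ := pow_unbounded_of_one_lt (C * ‖(1 : A)‖) hlt
  have h1 := AlgHom.norm_apply_le_self_mul_norm_one χ (z ^ k)
  rw [map_pow, norm_pow] at h1
  have h2 := mul_le_mul_of_nonneg_right (h k) (norm_nonneg (1 : A))
  linarith

attribute [local instance] Matrix.normedAddCommGroup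

/-- Uniform invertibility over a compact set. -/
lemma unif_inv {X : Type*} [TopologicalSpace X] {n : ℕ} {K : Set X} (hK : IsCompact K)
    (f : X → Matrix (Fin n) (Fin n) ℂ) (hf : ContinuousOn f K) (hd : ∀ x ∈ K, (f x).det ≠ 0) :
    ∃ ε > 0, ∀ x ∈ K, ∀ m : Matrix (Fin n) (Fin n) ℂ,
      (∀ i j, ‖m i j - f x i j‖ < ε) → m.det ≠ 0 := by
  have hop : IsOpen {m : Matrix (Fin n) (Fin n) ℂ | m.det ≠ 0} :=
    isOpen_ne_fun (Continuous.matrix_det continuous_id) continuous_const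
  obtain ⟨ε, hε, h⟩ := (hK.image_of_continuousOn hf).exists_thickening_subset_open hop
    (by rintro _ ⟨x, hx, rfl⟩; exact hd x hx)
  refine ⟨ε, hε, fun x hx m hm => h ?_⟩
  rw [Metric.mem_thickening_iff]
  refine ⟨f x, ⟨x, hx, rfl⟩, ?_⟩
  rw [dist_eq_norm, Matrix.norm_lt_iff hε]
  exact hm

lemma continuous_mat_ch {n : ℕ} (M : Matrix (Fin n) (Fin n) A) :
    Continuous fun χ : A →ₐ[ℂ] ℂ => M.map χ :=
  continuous_matrix fun i j => ch_continuous_eval (M i j)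

lemma unif_inv_ch [CompleteSpace A] {n : ℕ} {K : Set (A →ₐ[ℂ] ℂ)} (hK : IsClosed K)
    (M : Matrix (Fin n) (Fin n) A) (hd : ∀ χ ∈ K, (M.map χ).det ≠ 0) :
    ∃ ε > 0, ∀ χ ∈ K, ∀ m : Matrix (Fin n) (Fin n) ℂ,
      (∀ i j, ‖m i j - χ (M i j)‖ < ε) → m.det ≠ 0 :=
  unif_inv hK.isCompact _ (continuous_mat_ch M).continuousOn hd

end Chars

section AbstractExp

open NormedSpace Topology Filter

variable {R : Type*} [NormedRing R] [NormedAlgebra ℂ R] [CompleteSpace R]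

lemma exp_hasSum (x : R) : HasSum (fun n : ℕ => ((n.factorial : ℂ))⁻¹ • x ^ n) (exp x) :=
  NormedSpace.exp_series_hasSum_exp' x

lemma exp_mul_neg_self (x : R) : exp x * exp (-x) = 1 := by
  let _ : NormedAlgebra ℚ R := NormedAlgebra.restrictScalars ℚ ℂ R
  rw [← NormedSpace.exp_add_of_commute (Commute.neg_right (Commute.refl x)), add_neg_cancel,
    NormedSpace.exp_zero]

lemma exp_neg_mul_self (x : R) : exp (-x) * exp x = 1 := by
  have := exp_mul_neg_self (-x)
  rwa [neg_neg] at this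

lemma continuous_exp' : Continuous (exp : R → R) := by
  let _ : NormedAlgebra ℚ R := NormedAlgebra.restrictScalars ℚ ℂ R
  exact NormedSpace.exp_continuous

lemma exp_sub_one_mem (V : Submodule ℂ R) (hc : IsClosed (V : Set R))
    (hl : ∀ r, ∀ v ∈ V, r * v ∈ V) {x : R} (hx : x ∈ V) : exp x - 1 ∈ V := by
  have h := (hasSum_nat_add_iff' 1).2 (exp_hasSum x)
  simp only [Finset.range_one, Finset.sum_singleton, Nat.factorial_zero, Nat.cast_one, inv_one,
    pow_zero, one_smul] at h
  refine hc.mem_of_tendsto h (Eventually.of_forall fun s => ?_)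
  refine Submodule.sum_mem _ fun i _ => Submodule.smul_mem _ _ ?_
  rw [pow_succ]
  exact hl _ _ hx

/-- `exp (l + ω h) - exp l` is a multiple of the central element `ω`. -/
lemma exp_sub_exp_dvd (ω h l : R) (hω : ∀ r, Commute ω r) :
    ∃ k, exp (l + ω * h) = exp l + ω * k := by
  set x := l + ω * h with hx
  let t : ℕ → R := fun n => Nat.rec 0 (fun n tn => x * tn + h * l ^ n) n
  have ht0 : t 0 = 0 := rfl
  have hts : ∀ n, t (n + 1) = x * t n + h * l ^ n := fun n => rfl
  have hxt : ∀ n, x ^ n = l ^ n + ω * t n := by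
    intro n
    induction n with
    | zero => simp [ht0]
    | succ n ih =>
      rw [hts, pow_succ' x, ih, mul_add, mul_add, ← mul_assoc x ω, ← (hω x).eq,
        mul_assoc ω x]
      have : x * l ^ n = l ^ (n + 1) + ω * (h * l ^ n) := by
        rw [hx, add_mul, pow_succ' l, mul_assoc]
      rw [this]; abel
  set ρ : ℝ := ‖x‖ + ‖l‖ + ‖h‖ + 1 + ‖(1 : R)‖
  have hρ1 : 1 ≤ ρ := by
    have := norm_nonneg x; have := norm_nonneg l; have := norm_nonneg h
    have := norm_nonneg (1 : R)
    simp only [ρ]; linarith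
  have hlp : ∀ n : ℕ, ‖l ^ n‖ ≤ ρ ^ (n + 1) := by
    intro n
    induction n with
    | zero =>
      have := norm_nonneg x; have := norm_nonneg l; have := norm_nonneg h
      simp only [pow_zero, zero_add, pow_one, ρ]; linarith
    | succ n ih =>
      rw [pow_succ' l, pow_succ' ρ]
      refine (norm_mul_le _ _).trans ?_
      have : ‖l‖ ≤ ρ := by
        have := norm_nonneg x; have := norm_nonneg (1 : R); have := norm_nonneg h
        simp only [ρ]; linarith
      gcongr
  have hxρ : ‖x‖ ≤ ρ := by
    have := norm_nonneg l; have := norm_nonneg (1 : R); have := norm_nonneg h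
    simp only [ρ]; linarith
  have hhρ : ‖h‖ ≤ ρ := by
    have := norm_nonneg l; have := norm_nonneg (1 : R); have := norm_nonneg x
    simp only [ρ]; linarith
  have hb : ∀ n : ℕ, ‖t n‖ ≤ ρ * (2 * ρ) ^ n := by
    intro n
    induction n with
    | zero => rw [ht0, norm_zero]; positivity
    | succ n ih =>
      rw [hts]
      refine (norm_add_le _ _).trans ?_
      have h1 : ‖x * t n‖ ≤ ρ * (ρ * (2 * ρ) ^ n) :=
        (norm_mul_le _ _).trans (by gcongr)
      have h2 : ‖h * l ^ n‖ ≤ ρ * ρ ^ (n + 1) :=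
        (norm_mul_le _ _).trans (by gcongr; exact hlp n)
      have h3 : ρ * ρ ^ (n + 1) ≤ ρ * (ρ * (2 * ρ) ^ n) := by
        rw [pow_succ' ρ]
        gcongr
        linarith
      have h4 : ρ * (2 * ρ) ^ (n + 1) = ρ * (ρ * (2 * ρ) ^ n) + ρ * (ρ * (2 * ρ) ^ n) := by ring
      linarith
  have hs : Summable fun n : ℕ => ((n.factorial : ℂ))⁻¹ • t n := by
    refine Summable.of_norm_bounded (g := fun n => ρ * ((2 * ρ) ^ n / n.factorial))
      ((Real.summable_pow_div_factorial (2 * ρ)).mul_left ρ) fun n => ?_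
    rw [norm_smul, norm_inv, Complex.norm_natCast]
    calc _ ≤ ((n.factorial : ℝ))⁻¹ * (ρ * (2 * ρ) ^ n) := by gcongr; exact hb n
      _ = _ := by ring
  obtain ⟨k, hk⟩ := hs
  refine ⟨k, (exp_hasSum x).unique ?_⟩
  have := (exp_hasSum l).add (hk.mul_left ω)
  convert this using 2 with n
  rw [hxt, smul_add, mul_smul_comm]

/-- Factorization of elements near `1`. -/
lemma near_one_factor (V : Submodule ℂ R) (hc : IsClosed (V : Set R))
    (hl : ∀ r, ∀ v ∈ V, r * v ∈ V) (hr : ∀ r, ∀ v ∈ V, v * r ∈ V)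
    (E : R →L[ℂ] R) (hE : ∀ v ∈ V, E v ∈ V) :
    ∀ᶠ m in 𝓝 (0 : R), m ∈ V → ∃ m' ∈ V, 1 + m = exp (m' - E m') * exp (E m') := by
  have : CompleteSpace V := hc.completeSpace_coe
  have hmem : ∀ v : V, exp ((v : R) - E v) * exp (E v) - 1 ∈ V := by
    intro v
    have h1 := exp_sub_one_mem V hc hl (V.sub_mem v.2 (hE v v.2))
    have h2 := exp_sub_one_mem V hc hl (hE v v.2)
    have : exp ((v : R) - E v) * exp (E v) - 1
      = (exp ((v : R) - E v) - 1) * exp (E v) + (exp (E v) - 1) := by noncomm_ring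
    rw [this]
    exact V.add_mem (hr _ _ h1) h2
  let F : V → V := fun v => ⟨_, hmem v⟩
  have hF : HasStrictFDerivAt F (ContinuousLinearMap.id ℂ V) 0 := by
    have he := hasStrictFDerivAt_exp_zero (𝕂 := ℂ) (𝔸 := R)
    have h1 : HasStrictFDerivAt (fun v : V => exp ((v : R) - E v))
        ((1 : R →L[ℂ] R).comp (V.subtypeL - E.comp V.subtypeL)) 0 := by
      refine HasStrictFDerivAt.comp (0 : V) (f := fun v : V => (v : R) - E v) (by simpa using he) ?_
      exact (V.subtypeL - E.comp V.subtypeL).hasStrictFDerivAt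
    have h2 : HasStrictFDerivAt (fun v : V => exp (E (v : R)))
        ((1 : R →L[ℂ] R).comp (E.comp V.subtypeL)) 0 := by
      refine HasStrictFDerivAt.comp (0 : V) (f := fun v : V => E (v : R)) (by simpa using he) ?_
      exact (E.comp V.subtypeL).hasStrictFDerivAt
    have h3 := (h1.mul' h2).sub_const 1
    have h4 : HasStrictFDerivAt (fun v : V => ((F v : V) : R)) V.subtypeL 0 := by
      refine h3.congr_fderiv ?_
      ext v
      simp [NormedSpace.exp_zero]
    rw [hasStrictFDerivAt_iff_isLittleO] at h4 ⊢
    rw [← Asymptotics.isLittleO_norm_left] at h4 ⊢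
    exact h4
  have hm := hF.map_nhds_eq_of_surj (by simp)
  have hF0 : F 0 = 0 := by
    apply Subtype.ext; simp [F, NormedSpace.exp_zero]
  rw [hF0] at hm
  have hr : Set.range F ∈ 𝓝 (0 : V) := by rw [← hm]; exact Filter.range_mem_map
  rw [nhds_subtype_eq_comap] at hr
  obtain ⟨U, hU, hUF⟩ := hr
  filter_upwards [hU] with m hmU hmV
  obtain ⟨v, hv⟩ := hUF (show (⟨m, hmV⟩ : V) ∈ _ from hmU)
  refine ⟨v, v.2, ?_⟩
  have := congrArg Subtype.val hv
  simp only [F] at this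
  rw [← this]; abel

end AbstractExp

section Cartan

universe u

open NormedSpace Topology Filter

namespace Ell

variable {A : Type u} [NormedCommRing A] [NormedAlgebra ℂ A]

/-- inclusion of the nonnegative part -/
noncomputable def jp : Ell A ℕ →ₐ[ℂ] Ell A ℤ :=
  liftHom const continuous_const' (fun k => zt (k : ℤ)) ‖(1 : A)‖ (fun k => (norm_zt _).le)
    (by simp [zt_zero]) (fun m k => by push_cast; exact zt_add _ _)

/-- inclusion of the nonpositive part -/
noncomputable def jm : Ell A ℕ →ₐ[ℂ] Ell A ℤ :=
  liftHom const continuous_const' (fun k => zt (-(k : ℤ))) ‖(1 : A)‖ (fun k => (norm_zt _).le)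
    (by simp [zt_zero]) (fun m k => by push_cast; rw [neg_add]; exact zt_add _ _)

lemma norm_ite_zt (p : Prop) [Decidable p] {M : Type} [AddCommMonoid M] (m : M) :
    ‖(if p then zt m else 0 : Ell A M)‖ ≤ ‖(1 : A)‖ := by
  split_ifs
  · exact (norm_zt _).le
  · rw [norm_zero]; exact norm_nonneg _

/-- projection to the nonnegative part -/
noncomputable def Pp : Ell A ℤ →L[ℂ] Ell A ℕ :=
  lift const continuous_const' (fun m => if 0 ≤ m then zt m.toNat else 0) ‖(1 : A)‖
    (fun m => norm_ite_zt _ _)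

/-- projection to the negative part, shifted -/
noncomputable def Pn : Ell A ℤ →L[ℂ] Ell A ℕ :=
  lift const continuous_const' (fun m => if m < 0 then zt (-m - 1).toNat else 0) ‖(1 : A)‖
    (fun m => norm_ite_zt _ _)

/-- projection to the nonpositive part -/
noncomputable def Pm : Ell A ℤ →L[ℂ] Ell A ℕ :=
  lift const continuous_const' (fun m => if m ≤ 0 then zt (-m).toNat else 0) ‖(1 : A)‖
    (fun m => norm_ite_zt _ _)

lemma continuous_jp : Continuous (jp : Ell A ℕ →ₐ[ℂ] Ell A ℤ) := continuous_liftHom ..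
lemma continuous_jm : Continuous (jm : Ell A ℕ →ₐ[ℂ] Ell A ℤ) := continuous_liftHom ..

lemma jp_mono (k : ℕ) (a : A) : jp (mono k a) = mono (k : ℤ) a := by
  rw [jp, liftHom_mono, mono_eq]
lemma jm_mono (k : ℕ) (a : A) : jm (mono k a) = mono (-(k : ℤ)) a := by
  rw [jm, liftHom_mono, mono_eq]
lemma jp_const (a : A) : jp (const a) = const a := by rw [jp, liftHom_const]
lemma jm_const (a : A) : jm (const a) = const a := by rw [jm, liftHom_const]
lemma jp_zt (k : ℕ) : jp (zt k : Ell A ℕ) = zt (k : ℤ) := by rw [jp, liftHom_zt]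
lemma jm_zt (k : ℕ) : jm (zt k : Ell A ℕ) = zt (-(k : ℤ)) := by rw [jm, liftHom_zt]
lemma Pp_mono (m : ℤ) (a : A) : Pp (mono m a) = if 0 ≤ m then mono m.toNat a else 0 := by
  rw [Pp, lift_mono]; split_ifs <;> simp [mono_eq]
lemma Pn_mono (m : ℤ) (a : A) : Pn (mono m a) = if m < 0 then mono (-m - 1).toNat a else 0 := by
  rw [Pn, lift_mono]; split_ifs <;> simp [mono_eq]
lemma Pm_mono (m : ℤ) (a : A) : Pm (mono m a) = if m ≤ 0 then mono (-m).toNat a else 0 := by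
  rw [Pm, lift_mono]; split_ifs <;> simp [mono_eq]

lemma decomp (f : Ell A ℤ) : f = jp (Pp f) + zt (-1) * jm (Pn f) := by
  induction f using ind with
  | hc =>
    have h1 := continuous_jp (A := A); have h2 := continuous_jm (A := A)
    exact isClosed_eq (by fun_prop) (by fun_prop)
  | hm m a =>
    rw [Pp_mono, Pn_mono]
    by_cases h : 0 ≤ m
    · rw [if_pos h, if_neg (by omega), map_zero, mul_zero, add_zero, jp_mono, Int.toNat_of_nonneg h]
    · rw [if_neg h, if_pos (by omega), map_zero, zero_add, jm_mono, zt, mono_mul, one_mul,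
        Int.toNat_of_nonneg (by omega)]
      congr 1; omega
  | ha f g hf hg =>
    conv_lhs => rw [hf, hg]
    simp only [map_add, mul_add]; abel

lemma jp_eq_jm {f g : Ell A ℕ} [CompleteSpace A] (h : jp f = jm g) :
    ∃ a : A, f = const a ∧ g = const a := by
  obtain ⟨c0, hc0⟩ := exists_lift (M := ℕ) (AlgHom.id ℂ A) continuous_id
    (fun m => if m = 0 then 1 else 0) ‖(1 : A)‖ (fun m => by split_ifs <;> simp)
  have h1 : ∀ f : Ell A ℕ, Pp (jp f) = f := fun f => by
    induction f using ind with
    | hc => have h1 := continuous_jp (A := A); exact isClosed_eq (by fun_prop) (by fun_prop)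
    | hm m a => rw [jp_mono, Pp_mono, if_pos (by omega)]; simp
    | ha f g hf hg => rw [map_add, map_add, hf, hg]
  have h2 : ∀ f : Ell A ℕ, Pm (jm f) = f := fun f => by
    induction f using ind with
    | hc => have h1 := continuous_jm (A := A); exact isClosed_eq (by fun_prop) (by fun_prop)
    | hm m a => rw [jm_mono, Pm_mono, if_pos (by omega)]; simp
    | ha f g hf hg => rw [map_add, map_add, hf, hg]
  have h3 : ∀ g : Ell A ℕ, Pp (jm g) = const (c0 g) := fun g => by
    induction g using ind with
    | hc =>
      have h1 := continuous_jm (A := A)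
      have h2 := continuous_const' (A := A) (M := ℕ)
      exact isClosed_eq (by fun_prop) (by fun_prop)
    | hm m a =>
      rw [jm_mono, Pp_mono, hc0]
      by_cases hm : m = 0
      · subst hm; simp [const_apply]
      · rw [if_neg (by omega), if_neg hm]; simp
    | ha f g hf hg => simp only [map_add, hf, hg]
  have hf : f = const (c0 g) := by rw [← h1 f, h, h3]
  refine ⟨c0 g, hf, ?_⟩
  have h4 : jm g = jm (const (c0 g)) := by rw [← h, hf, jp_const, jm_const]
  have h5 := congrArg Pm h4
  rwa [h2, h2] at h5

/-- the closed ideal generated by `J` -/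
noncomputable def NJ (J : Ideal A) : Ideal (Ell A ℤ) := (Ideal.map (const (M := ℤ)) J).closure

lemma isClosed_NJ (J : Ideal A) : IsClosed (NJ J : Set (Ell A ℤ)) := isClosed_closure

lemma const_mem_NJ {J : Ideal A} {a : A} (ha : a ∈ J) : const a ∈ NJ J :=
  subset_closure (Ideal.mem_map_of_mem _ ha)

/-- the `J`-polynomials are dense -/
lemma NJ_subset (J : Ideal A) :
    (NJ J : Set (Ell A ℤ)) ⊆
      closure (AddSubgroup.closure {f | ∃ k : ℤ, ∃ a ∈ J, f = mono k a} : Set (Ell A ℤ)) := by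
  set S := AddSubgroup.closure {f : Ell A ℤ | ∃ k : ℤ, ∃ a ∈ J, f = mono k a}
  have hmul : ∀ x, ∀ s ∈ closure (S : Set (Ell A ℤ)), x * s ∈ closure (S : Set (Ell A ℤ)) := by
    intro x s hs
    induction x using ind with
    | hc => exact isClosed_closure.preimage (continuous_mul_const s)
    | hm m a =>
      refine map_mem_closure (continuous_const_mul (mono m a)) hs fun t ht => ?_
      induction ht using AddSubgroup.closure_induction with
      | mem t ht =>
        obtain ⟨k, a', ha', rfl⟩ := ht
        refine AddSubgroup.subset_closure ⟨m + k, a * a', J.mul_mem_left _ ha', mono_mul ..⟩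
      | zero => rw [mul_zero]; exact S.zero_mem
      | add x y _ _ hx hy => rw [mul_add]; exact S.add_mem hx hy
      | neg x _ hx => rw [mul_neg]; exact S.neg_mem hx
    | ha f g hf hg =>
      rw [add_mul]
      exact (S.topologicalClosure).add_mem hf hg
  let I : Ideal (Ell A ℤ) :=
    { S.topologicalClosure with
      smul_mem' := fun x s hs => hmul x s hs }
  have hI : Ideal.map (const (M := ℤ)) J ≤ I := by
    rw [Ideal.map_le_iff_le_comap]
    intro a ha
    exact subset_closure (AddSubgroup.subset_closure ⟨0, a, ha, rfl⟩)
  exact closure_minimal hI isClosed_closure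

lemma NJ_ind {J : Ideal A} {p : Ell A ℤ → Prop} (hc : IsClosed {f | p f})
    (hm : ∀ k, ∀ a ∈ J, p (mono k a)) (ha : ∀ f g, p f → p g → p (f + g)) (hn : ∀ f, p f → p (-f))
    {f : Ell A ℤ} (hf : f ∈ NJ J) : p f := by
  refine closure_minimal (fun t ht => ?_) hc (NJ_subset J hf)
  induction ht using AddSubgroup.closure_induction with
  | mem t ht => obtain ⟨k, a, ha, rfl⟩ := ht; exact hm k a ha
  | zero =>
    have := hm 0 0 J.zero_mem
    rw [← const_apply, map_zero] at this; exact this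
  | add x y _ _ hx hy => exact ha _ _ hx hy
  | neg x _ hx => exact hn _ hx

lemma mono_mem_NJ {J : Ideal A} {a : A} (ha : a ∈ J) (k : ℤ) : mono k a ∈ NJ J := by
  rw [mono_eq]; exact (NJ J).mul_mem_right _ (const_mem_NJ ha)

lemma jpPp_mem {J : Ideal A} {f : Ell A ℤ} (hf : f ∈ NJ J) : jp (Pp f) ∈ NJ J := by
  refine NJ_ind (p := fun f => jp (Pp f) ∈ NJ J) ?_ ?_ ?_ ?_ hf
  ·
    have h1 := continuous_jp (A := A)
    exact (isClosed_NJ J).preimage (f := fun f => jp (Pp f)) (by fun_prop)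
  · intro k a ha
    rw [Pp_mono]
    split_ifs
    · rw [jp_mono]; exact mono_mem_NJ ha _
    · rw [map_zero]; exact Ideal.zero_mem _
  · intro f g hf hg; rw [map_add, map_add]; exact Ideal.add_mem _ hf hg
  · intro f hf; rw [map_neg, map_neg]; exact (NJ J).neg_mem hf

/-- extension of a character of `A` to `Ell A ℕ` -/
noncomputable def ev [CompleteSpace A] (χ : A →ₐ[ℂ] ℂ) (z : ℂ) (hz : ‖z‖ ≤ 1) : Ell A ℕ →ₐ[ℂ] ℂ :=
  liftHom χ (ch_continuous χ) (fun k => z ^ k) 1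
    (fun k => by rw [norm_pow]; exact pow_le_one₀ (norm_nonneg _) hz)
    (pow_zero _) (fun m k => pow_add _ _ _)

section
variable [CompleteSpace A] (χ : A →ₐ[ℂ] ℂ) (z : ℂ) (hz : ‖z‖ ≤ 1)

lemma continuous_ev : Continuous (ev χ z hz) := continuous_liftHom ..
lemma ev_mono (k : ℕ) (a : A) : ev χ z hz (mono k a) = χ a * z ^ k := by rw [ev, liftHom_mono]
lemma ev_const (a : A) : ev χ z hz (const a) = χ a := by rw [ev, liftHom_const]
lemma ev_zt (k : ℕ) : ev χ z hz (zt k) = z ^ k := by rw [ev, liftHom_zt]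

lemma ev_Pp {J : Ideal A} (hJ : ∀ x ∈ J, χ x = 0) {f : Ell A ℤ} (hf : f ∈ NJ J) :
    ev χ z hz (Pp f) = 0 := by
  refine NJ_ind (p := fun f => ev χ z hz (Pp f) = 0) ?_ ?_ ?_ ?_ hf
  ·
    have h1 := continuous_ev χ z hz
    exact isClosed_eq (by fun_prop) (by fun_prop)
  · intro k a ha
    rw [Pp_mono]
    split_ifs
    · rw [ev_mono, hJ a ha, zero_mul]
    · rw [map_zero]
  · intro f g hf hg; rw [map_add, map_add, hf, hg, add_zero]
  · intro f hf; rw [map_neg, map_neg, hf, neg_zero]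

lemma ev_Pn {J : Ideal A} (hJ : ∀ x ∈ J, χ x = 0) {f : Ell A ℤ} (hf : f ∈ NJ J) :
    ev χ z hz (Pn f) = 0 := by
  refine NJ_ind (p := fun f => ev χ z hz (Pn f) = 0) ?_ ?_ ?_ ?_ hf
  ·
    have h1 := continuous_ev χ z hz
    exact isClosed_eq (by fun_prop) (by fun_prop)
  · intro k a ha
    rw [Pn_mono]
    split_ifs
    · rw [ev_mono, hJ a ha, zero_mul]
    · rw [map_zero]
  · intro f g hf hg; rw [map_add, map_add, hf, hg, add_zero]
  · intro f hf; rw [map_neg, map_neg, hf, neg_zero]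

end

/-- `zt k` is congruent to a constant modulo `z - b`. -/
lemma zt_cong {b b' : A} (hb : b * b' = 1) (k : ℤ) :
    ∃ a : A, ∃ h : Ell A ℤ, zt k = const a + (zt 1 - const b) * h := by
  have hbc : (const b * const b' : Ell A ℤ) = 1 := by rw [← map_mul, hb, map_one]
  have hz : (zt 1 * zt (-1) : Ell A ℤ) = 1 := by rw [← zt_add, add_neg_cancel, zt_zero]
  induction k using Int.induction_on with
  | zero => exact ⟨1, 0, by simp [zt_zero]⟩
  | succ k ih =>
    obtain ⟨a, h, hh⟩ := ih
    refine ⟨b * a, zt 1 * h + const a, ?_⟩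
    rw [zt_add, hh, map_mul]; ring
  | pred k ih =>
    obtain ⟨a, h, hh⟩ := ih
    refine ⟨b' * a, zt (-1) * h - zt (-1) * const b' * const a, ?_⟩
    rw [sub_eq_add_neg (-(k : ℤ)), zt_add, hh, map_mul]
    linear_combination (const b' * const a) * hz - (zt (-1) * const a) * hbc

/-- elements of the dense subgroup are congruent to elements of `J` -/
lemma poly_cong {b b' : A} (hb : b * b' = 1) {J : Ideal A} {f : Ell A ℤ}
    (hf : f ∈ AddSubgroup.closure {f : Ell A ℤ | ∃ k : ℤ, ∃ a ∈ J, f = mono k a}) :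
    ∃ a ∈ J, ∃ h : Ell A ℤ, f = const a + (zt 1 - const b) * h := by
  induction hf using AddSubgroup.closure_induction with
  | mem t ht =>
    obtain ⟨k, a, ha, rfl⟩ := ht
    obtain ⟨a', h, hh⟩ := zt_cong hb k
    refine ⟨a * a', J.mul_mem_right _ ha, const a * h, ?_⟩
    rw [mono_eq, hh, map_mul]; ring
  | zero => exact ⟨0, J.zero_mem, 0, by simp⟩
  | add x y _ _ hx hy =>
    obtain ⟨a, ha, h, rfl⟩ := hx
    obtain ⟨a', ha', h', rfl⟩ := hy
    exact ⟨a + a', J.add_mem ha ha', h + h', by rw [map_add]; ring⟩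
  | neg x _ hx =>
    obtain ⟨a, ha, h, rfl⟩ := hx
    exact ⟨-a, J.neg_mem ha, -h, by rw [map_neg]; ring⟩

/-- invertibility modulo `z - b` -/
lemma exists_inv_mod [CompleteSpace A] (b d : A) (h : ∀ χ : A →ₐ[ℂ] ℂ, ‖χ b‖ = 1 → χ d ≠ 0) :
    ∃ x y : Ell A ℤ, const d * x + (zt 1 - const b) * y = 1 := by
  by_contra hcon
  push Not at hcon
  obtain ⟨ψ, hψ⟩ := exists_ch_of_ne_top (Ideal.span {const d, zt 1 - const b} : Ideal (Ell A ℤ))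
    (by
      intro htop
      have := (Ideal.eq_top_iff_one _).1 htop
      obtain ⟨x, y, hxy⟩ := Ideal.mem_span_pair.1 this
      exact hcon x y (by rw [← hxy]; ring))
  have hd : ψ (const d) = 0 := hψ _ (Ideal.subset_span (by simp))
  have hw : ψ (zt 1 - const b) = 0 := hψ _ (Ideal.subset_span (by simp))
  rw [map_sub, sub_eq_zero] at hw
  have hpow : ∀ (m : ℤ) (k : ℕ), (zt m : Ell A ℤ) ^ k = zt (k * m) := fun m k => by
    induction k with
    | zero => simp [zt_zero]
    | succ k ih => rw [pow_succ, ih, ← zt_add]; congr 1; push_cast; ring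
  have h1 : ∀ m : ℤ, ‖ψ (zt m)‖ ≤ 1 := fun m =>
    norm_le_one_of_pow_bounded ψ _ ‖(1 : A)‖ fun k => by rw [hpow]; exact (norm_zt _).le
  have h2 : ψ (zt 1) * ψ (zt (-1)) = 1 := by
    rw [← map_mul, ← zt_add, add_neg_cancel, zt_zero, map_one]
  have h3 : ‖ψ (zt 1)‖ = 1 := by
    refine le_antisymm (h1 1) ?_
    have h4 : ‖ψ (zt 1)‖ * ‖ψ (zt (-1))‖ = 1 := by rw [← norm_mul, h2, norm_one]
    nlinarith [h1 1, h1 (-1), norm_nonneg (ψ (zt 1)), norm_nonneg (ψ (zt (-1)))]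
  exact h (ψ.comp const) (by rw [AlgHom.comp_apply, ← hw, h3]) hd

end Ell

end Cartan

section CartanMain

universe u

open NormedSpace Topology Filter

lemma mul_sub_one_eq {R : Type*} [Ring R] (x y : R) : x * y - 1 = (x - 1) * y + (y - 1) := by
  noncomm_ring

lemma adj_mod {n : ℕ} {L : Type*} [CommRing L] (M : Matrix (Fin n) (Fin n) L) (x y ω : L)
    (h : M.det * x + ω * y = 1) :
    M * (x • M.adjugate) = 1 - ω • (y • (1 : Matrix (Fin n) (Fin n) L)) := by
  have h3 : M.det * x = 1 - ω * y := by rw [← h]; ring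
  rw [Matrix.mul_smul, Matrix.mul_adjugate, smul_smul, mul_comm x, h3, sub_smul, one_smul,
    smul_smul]

lemma mod_step {n : ℕ} {L : Type*} [CommRing L] (X Y M' : Matrix (Fin n) (Fin n) L) (y ω : L)
    (h : X * M' = 1 - ω • (y • (1 : Matrix (Fin n) (Fin n) L))) :
    Y = X * (1 + M' * (Y - X)) + ω • (y • (Y - X)) := by
  rw [mul_add, mul_one, ← mul_assoc, h, sub_mul, one_mul]
  simp only [Matrix.smul_mul, one_mul]
  abel

lemma mod_trans {n : ℕ} {L : Type*} [CommRing L] {X Y Z e e' h h' : Matrix (Fin n) (Fin n) L} {ω : L}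
    (h1 : Y = X * e + ω • h) (h2 : Z = Y * e' + ω • h') :
    Z = X * (e * e') + ω • (h * e' + h') := by
  rw [h2, h1, add_mul, mul_assoc, Matrix.smul_mul, smul_add, add_assoc]

lemma mod_symm {n : ℕ} {L : Type*} [CommRing L] {X Y e e' h : Matrix (Fin n) (Fin n) L} {ω : L}
    (h1 : Y = X * e + ω • h) (h2 : e * e' = 1) :
    X = Y * e' + ω • (-(h * e')) := by
  rw [h1, add_mul, mul_assoc, h2, mul_one, Matrix.smul_mul, smul_neg]; abel

lemma mod_final {n : ℕ} {L : Type*} [CommRing L] {U V' Rr e h q k P P' N : Matrix (Fin n) (Fin n) L}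
    {ω : L} (h1 : V' = U * e + ω • h) (h2 : q = e * (N * P)) (h3 : P * P' = 1)
    (h4 : q = Rr + ω • k) :
    U * Rr * P' - V' * N = ω • (-(U * k * P') - h * N) := by
  have e1 : V' * N = U * q * P' + ω • (h * N) := by
    rw [h1, h2, add_mul, Matrix.smul_mul]
    congr 1
    simp only [mul_assoc]
    rw [h3, mul_one]
  rw [e1, h4, mul_add, add_mul, Matrix.mul_smul, Matrix.smul_mul, smul_sub, smul_neg]
  abel

lemma ring_step {R : Type*} [Ring R] {q e e' X : R} (h : e * e' = 1) (h2 : 1 + e' * (q - e) = X) :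
    q = e * X := by
  rw [← h2, mul_add, mul_one, ← mul_assoc, h, one_mul]; abel

lemma map_sub_smul {n : ℕ} {D E : Type*} [CommRing D] [CommRing E] (φ : D →+* E) (P Q X : Matrix (Fin n) (Fin n) D)
    (c : D) : (P * Q - c • X).map φ = P.map φ * Q.map φ - φ c • X.map φ := by
  rw [← Matrix.map_mul]; ext i j; simp only [Matrix.map_apply, Matrix.sub_apply, Matrix.smul_apply, smul_eq_mul, map_sub, map_mul]

lemma map_add_smul {n : ℕ} {D E : Type*} [CommRing D] [CommRing E] (φ : D →+* E) (P Q X : Matrix (Fin n) (Fin n) D)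
    (c : D) : (P * Q + c • X).map φ = P.map φ * Q.map φ + φ c • X.map φ := by
  rw [← Matrix.map_mul]; ext i j; simp only [Matrix.map_apply, Matrix.add_apply, Matrix.smul_apply, smul_eq_mul, map_add, map_mul]

attribute [local instance] Matrix.linftyOpNormedRing Matrix.linftyOpNormedAlgebra

lemma completeMat {n : ℕ} {D : Type*} [NormedCommRing D] [CompleteSpace D] :
    @CompleteSpace (Matrix (Fin n) (Fin n) D)
      (Matrix.linftyOpNormedRing (n := Fin n) (α := D)).toPseudoMetricSpace.toUniformSpace :=
  inferInstanceAs (CompleteSpace (Fin n → Fin n → D))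

attribute [local instance] completeMat

namespace Ell

variable {A : Type u} [NormedCommRing A] [NormedAlgebra ℂ A] {n : ℕ}

/-- matrices with entries in the closed ideal generated by `J` -/
noncomputable def VJ (n : ℕ) (J : Ideal A) : Submodule ℂ (Matrix (Fin n) (Fin n) (Ell A ℤ)) where
  carrier := {M | ∀ i j, M i j ∈ NJ J}
  add_mem' hx hy i j := Ideal.add_mem _ (hx i j) (hy i j)
  zero_mem' i j := Ideal.zero_mem _
  smul_mem' c x hx i j := by
    have : (c • x) i j = algebraMap ℂ (Ell A ℤ) c * x i j := by
      rw [Matrix.smul_apply, Algebra.smul_def]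
    rw [this]; exact Ideal.mul_mem_left _ _ (hx i j)

lemma mem_VJ {J : Ideal A} {M : Matrix (Fin n) (Fin n) (Ell A ℤ)} :
    M ∈ VJ n J ↔ ∀ i j, M i j ∈ NJ J := Iff.rfl

lemma isClosed_VJ (J : Ideal A) : IsClosed (VJ n J : Set (Matrix (Fin n) (Fin n) (Ell A ℤ))) := by
  have : (VJ n J : Set (Matrix (Fin n) (Fin n) (Ell A ℤ))) = ⋂ i, ⋂ j, {M | M i j ∈ NJ J} := by
    ext M; simp [mem_VJ]
  rw [this]
  refine isClosed_iInter fun i => isClosed_iInter fun j => ?_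
  exact (isClosed_NJ J).preimage (continuous_id.matrix_elem i j)

lemma VJ_mul_left (J : Ideal A) (r v : Matrix (Fin n) (Fin n) (Ell A ℤ)) (hv : v ∈ VJ n J) :
    r * v ∈ VJ n J := fun i j => by
  rw [Matrix.mul_apply]
  exact Ideal.sum_mem _ fun k _ => Ideal.mul_mem_left _ _ (hv k j)

lemma VJ_mul_right (J : Ideal A) (r v : Matrix (Fin n) (Fin n) (Ell A ℤ)) (hv : v ∈ VJ n J) :
    v * r ∈ VJ n J := fun i j => by
  rw [Matrix.mul_apply]
  exact Ideal.sum_mem _ fun k _ => Ideal.mul_mem_right _ _ (hv i k)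

/-- entrywise application of a continuous linear map -/
noncomputable def matL {D E : Type*} [NormedCommRing D] [NormedAlgebra ℂ D]
    [NormedCommRing E] [NormedAlgebra ℂ E] (n : ℕ) (L : D →L[ℂ] E) :
    Matrix (Fin n) (Fin n) D →L[ℂ] Matrix (Fin n) (Fin n) E :=
  ⟨L.toLinearMap.mapMatrix, continuous_id.matrix_map L.continuous⟩

lemma matL_apply {D E : Type*} [NormedCommRing D] [NormedAlgebra ℂ D]
    [NormedCommRing E] [NormedAlgebra ℂ E] (L : D →L[ℂ] E) (M : Matrix (Fin n) (Fin n) D) :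
    matL n L M = M.map L := rfl

lemma map_exp_mat {D E : Type*} [NormedCommRing D] [NormedAlgebra ℂ D] [CompleteSpace D]
    [NormedCommRing E] [NormedAlgebra ℂ E] [CompleteSpace E] (φ : D →ₐ[ℂ] E) (hφ : Continuous φ)
    (M : Matrix (Fin n) (Fin n) D) : (exp M).map φ = exp (M.map φ) := by
  let _ : NormedAlgebra ℚ (Matrix (Fin n) (Fin n) D) := NormedAlgebra.restrictScalars ℚ ℂ _
  let _ : NormedAlgebra ℚ (Matrix (Fin n) (Fin n) E) := NormedAlgebra.restrictScalars ℚ ℂ _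
  exact NormedSpace.map_exp φ.mapMatrix (continuous_id.matrix_map hφ) M

/-- the approximating monoid -/
noncomputable def TJ (n : ℕ) (J : Ideal A) (b : A) : Submonoid (Matrix (Fin n) (Fin n) (Ell A ℤ)) where
  carrier := {e | e - 1 ∈ VJ n J ∧ ∃ r : Matrix (Fin n) (Fin n) A, IsUnit r ∧
    (∀ χ : A →ₐ[ℂ] ℂ, (∀ x ∈ J, χ x = 0) → r.map χ = 1) ∧
    ∃ h : Matrix (Fin n) (Fin n) (Ell A ℤ), e = r.map const + (zt 1 - const b : Ell A ℤ) • h}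
  one_mem' := ⟨by simp, 1, isUnit_one, fun χ _ => by simp, 0, by simp⟩
  mul_mem' := by
    rintro e e' ⟨he, r, hr, hχ, h, hh⟩ ⟨he', r', hr', hχ', h', hh'⟩
    refine ⟨?_, r * r', hr.mul hr', fun χ hJ => ?_, r.map const * h' + h * e', ?_⟩
    · rw [mul_sub_one_eq]
      exact (VJ n J).add_mem (VJ_mul_right _ _ _ he) he'
    · rw [Matrix.map_mul, hχ χ hJ, hχ' χ hJ, one_mul]
    · rw [Matrix.map_mul]
      conv_lhs => rw [hh, add_mul]
      conv_lhs =>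
        enter [1]
        rw [hh', mul_add]
      rw [smul_add, Matrix.mul_smul, Matrix.smul_mul, add_assoc]

lemma exp_mem_closure_TJ [CompleteSpace A] (J : Ideal A) {b b' : A} (hb : b * b' = 1)
    {l : Matrix (Fin n) (Fin n) (Ell A ℤ)} (hl : l ∈ VJ n J) :
    exp l ∈ (TJ n J b).topologicalClosure := by
  set S := (AddSubgroup.closure {f : Ell A ℤ | ∃ k : ℤ, ∃ a ∈ J, f = mono k a} : Set (Ell A ℤ))
  have hSN : S ⊆ NJ J := by
    intro f hf
    induction hf using AddSubgroup.closure_induction with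
    | mem t ht => obtain ⟨k, a, ha, rfl⟩ := ht; exact mono_mem_NJ ha k
    | zero => exact Ideal.zero_mem _
    | add x y _ _ hx hy => exact Ideal.add_mem _ hx hy
    | neg x _ hx => exact (NJ J).neg_mem hx
  have hmem : l ∈ closure {q : Matrix (Fin n) (Fin n) (Ell A ℤ) | ∀ i j, q i j ∈ S} := by
    have h1 : {q : Matrix (Fin n) (Fin n) (Ell A ℤ) | ∀ i j, q i j ∈ S} =
      Set.pi Set.univ fun i => Set.pi Set.univ fun j => S := by
        ext q; exact ⟨fun h i _ j _ => h i j, fun h i j => h i trivial j trivial⟩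
    rw [h1]
    have h2 : closure (Set.pi Set.univ fun i : Fin n => Set.pi Set.univ fun j : Fin n => S) =
      Set.pi Set.univ fun i : Fin n => Set.pi Set.univ fun j : Fin n => closure S := by
      rw [closure_pi_set]
      congr 1; funext i
      rw [closure_pi_set]
    have h3 : l ∈ Set.pi Set.univ fun i : Fin n => Set.pi Set.univ fun j : Fin n => closure S :=
      fun i _ j _ => NJ_subset J (hl i j)
    rw [← h2] at h3
    exact h3
  refine map_mem_closure continuous_exp' hmem fun q hq => ?_
  refine ⟨exp_sub_one_mem _ (isClosed_VJ J) (VJ_mul_left J) (fun i j => hSN (hq i j)), ?_⟩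
  choose a ha h hh using fun i j => poly_cong hb (hq i j)
  have hqe : q = (Matrix.of a).map const +
      (algebraMap (Ell A ℤ) (Matrix (Fin n) (Fin n) (Ell A ℤ)) (zt 1 - const b)) * Matrix.of h := by
    rw [← Algebra.smul_def]
    ext i j
    simpa using hh i j
  obtain ⟨k, hk⟩ := exp_sub_exp_dvd
    (algebraMap (Ell A ℤ) (Matrix (Fin n) (Fin n) (Ell A ℤ)) (zt 1 - const b)) (Matrix.of h)
    ((Matrix.of a).map const) (fun r => Algebra.commutes _ _)
  rw [← hqe, ← Algebra.smul_def] at hk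
  replace hk := hk.trans (congrArg (fun X => X + (zt 1 - const b : Ell A ℤ) • k)
    (map_exp_mat _ continuous_const' (Matrix.of a)).symm)
  refine ⟨exp (Matrix.of a), ?_, fun χ hχ => ?_, k, hk⟩
  · exact ⟨⟨_, exp (-(Matrix.of a)), exp_mul_neg_self _, exp_neg_mul_self _⟩, rfl⟩
  · rw [map_exp_mat _ (ch_continuous χ)]
    have : (Matrix.of a).map χ = 0 := by
      ext i j; exact hχ _ (ha i j)
    rw [this, NormedSpace.exp_zero]

set_option maxHeartbeats 1000000 in
/-- A Cartan type gluing lemma. -/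
theorem cartan [CompleteSpace A] (b : A) (hb : IsUnit b) (J : Ideal A)
    (u v : Matrix (Fin n) (Fin n) A)
    (huv : JoinedIn {M : Matrix (Fin n) (Fin n) A | (∀ i j, M i j - u i j ∈ J) ∧
      ∀ χ : A →ₐ[ℂ] ℂ, ‖χ b‖ = 1 → (M.map χ).det ≠ 0} u v)
    (hu : ∀ χ : A →ₐ[ℂ] ℂ, ‖χ b‖ ≤ 1 → (u.map χ).det ≠ 0)
    (hv : ∀ χ : A →ₐ[ℂ] ℂ, 1 ≤ ‖χ b‖ → (v.map χ).det ≠ 0) :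
    ∃ w : Matrix (Fin n) (Fin n) A, IsUnit w ∧
      ∀ χ : A →ₐ[ℂ] ℂ, (∀ x ∈ J, χ x = 0) → w.map χ = u.map χ := by
  obtain ⟨b', hb'⟩ := hb.exists_right_inv
  set ω : Ell A ℤ := zt 1 - const b with hω
  let C : Matrix (Fin n) (Fin n) A →ₐ[ℂ] Matrix (Fin n) (Fin n) (Ell A ℤ) := const.mapMatrix
  have hCc : Continuous C := continuous_id.matrix_map continuous_const'
  set V := VJ n J with hV
  let 𝓔 : Submonoid (Matrix (Fin n) (Fin n) (Ell A ℤ)) := Submonoid.closure (exp '' (V : Set (Matrix (Fin n) (Fin n) (Ell A ℤ))))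
  have hinv : ∀ e ∈ 𝓔, ∃ e' ∈ 𝓔, e * e' = 1 ∧ e' * e = 1 := by
    intro e he
    induction he using Submonoid.closure_induction with
    | mem x hx =>
      obtain ⟨l, hl, rfl⟩ := hx
      exact ⟨exp (-l), Submonoid.subset_closure ⟨-l, V.neg_mem hl, rfl⟩, exp_mul_neg_self l,
        exp_neg_mul_self l⟩
    | one => exact ⟨1, 𝓔.one_mem, by simp, by simp⟩
    | mul x y _ _ hx hy =>
      obtain ⟨x', hx', h1, h2⟩ := hx
      obtain ⟨y', hy', h3, h4⟩ := hy
      refine ⟨y' * x', 𝓔.mul_mem hy' hx', ?_, ?_⟩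
      · rw [mul_assoc, ← mul_assoc y, h3, one_mul, h1]
      · rw [mul_assoc, ← mul_assoc x', h2, one_mul, h4]
  have h1V : ∀ e ∈ 𝓔, e - 1 ∈ V := by
    intro e he
    induction he using Submonoid.closure_induction with
    | mem x hx =>
      obtain ⟨l, hl, rfl⟩ := hx
      exact exp_sub_one_mem _ (isClosed_VJ J) (VJ_mul_left J) hl
    | one => simp
    | mul x y _ _ hx hy =>
      rw [mul_sub_one_eq]
      exact V.add_mem (VJ_mul_right _ _ _ hx) hy
  have hTcl : ∀ e ∈ 𝓔, e ∈ (TJ n J b).topologicalClosure := by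
    intro e he
    refine (Submonoid.closure_le.2 ?_) he
    rintro _ ⟨l, hl, rfl⟩
    exact exp_mem_closure_TJ J hb' hl
  let E0 : Ell A ℤ →L[ℂ] Ell A ℤ := (⟨jp.toLinearMap, continuous_jp⟩ : Ell A ℕ →L[ℂ] Ell A ℤ).comp Pp
  have hfac := near_one_factor V (isClosed_VJ J) (VJ_mul_left J) (VJ_mul_right J) (matL n E0)
    (fun v hv i j => jpPp_mem (hv i j))
  let Rel : Matrix (Fin n) (Fin n) A → Matrix (Fin n) (Fin n) A → Prop :=
    fun x y => ∃ e ∈ 𝓔, ∃ h : Matrix (Fin n) (Fin n) (Ell A ℤ), C y = C x * e + ω • h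
  have hRel : Rel u v := by
    obtain ⟨γ, hγ⟩ := huv
    have key : ∀ s t : unitInterval, Rel (γ s) (γ t) := by
      have hsymm : Std.Symm (fun s t => Rel (γ s) (γ t)) := by
        constructor
        rintro s t ⟨e, he, h, hh⟩
        obtain ⟨e', he', h1, h2⟩ := hinv e he
        refine ⟨e', he', -(h * e'), ?_⟩
        exact mod_symm hh h1
      have htrans : IsTrans unitInterval (fun s t => Rel (γ s) (γ t)) := by
        constructor
        rintro s t r ⟨e, he, h, hh⟩ ⟨e', he', h', hh'⟩
        refine ⟨e * e', 𝓔.mul_mem he he', h * e' + h', ?_⟩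
        exact mod_trans hh hh'
      refine PreconnectedSpace.induction₂ _ (fun s => ?_) htrans
      obtain ⟨x, y, hxy⟩ := exists_inv_mod b (γ s).det fun χ hχ => by
        have h1 := (hγ s).2 χ hχ
        have h2 := AlgHom.map_det χ (γ s)
        rw [AlgHom.mapMatrix_apply] at h2
        rwa [h2]
      let M' : Matrix (Fin n) (Fin n) (Ell A ℤ) := x • (C (γ s)).adjugate
      have hM' : C (γ s) * M' = 1 - ω • (y • (1 : Matrix (Fin n) (Fin n) (Ell A ℤ))) := by
        have h2 : (C (γ s)).det = const (γ s).det :=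
          (AlgHom.map_det (const (A := A) (M := ℤ)) (γ s)).symm
        exact adj_mod _ _ _ _ (by rw [h2]; exact hxy)
      have hcont : Tendsto (fun t => M' * C (γ t - γ s)) (𝓝 s) (𝓝 0) := by
        have : Continuous fun t => M' * C (γ t - γ s) :=
          continuous_const.mul (hCc.comp (γ.continuous.sub continuous_const))
        have h0 := this.tendsto s
        simpa using h0
      filter_upwards [hcont.eventually hfac] with t ht
      have hd : C (γ t - γ s) ∈ V := fun i j => const_mem_NJ (by
        have := J.sub_mem ((hγ t).1 i j) ((hγ s).1 i j)
        simpa using this)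
      obtain ⟨m', hm', hm⟩ := ht (VJ_mul_left J _ _ hd)
      have hEm : matL n E0 m' ∈ V := fun i j => jpPp_mem (hm' i j)
      refine ⟨1 + M' * C (γ t - γ s), ?_, y • C (γ t - γ s), ?_⟩
      · rw [hm]
        exact 𝓔.mul_mem (Submonoid.subset_closure ⟨_, V.sub_mem hm' hEm, rfl⟩)
          (Submonoid.subset_closure ⟨_, hEm, rfl⟩)
      · rw [map_sub]; exact mod_step _ _ _ _ _ hM'
    have := key 0 1
    rwa [γ.source, γ.target] at this
  obtain ⟨e, he, h, hvu⟩ := hRel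
  obtain ⟨e', he', hee', he'e⟩ := hinv e he
  obtain ⟨q, hqT, m', hm', hq⟩ : ∃ q ∈ TJ n J b, ∃ m' ∈ V,
      q = e * (exp (m' - matL n E0 m') * exp (matL n E0 m')) := by
    have hcont : Tendsto (fun q => e' * (q - e)) (𝓝 e) (𝓝 0) := by
      have : Continuous fun q => e' * (q - e) := by fun_prop
      have h0 := this.tendsto e
      simpa using h0
    obtain ⟨q, hq, hqT⟩ := mem_closure_iff_nhds.1 (hTcl e he) _ (hcont.eventually hfac)
    have hqe : q - e ∈ V := by
      have : q - e = (q - 1) - (e - 1) := by abel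
      rw [this]; exact V.sub_mem hqT.1 (h1V e he)
    obtain ⟨m', hm', hm⟩ := hq (VJ_mul_left J _ _ hqe)
    refine ⟨q, hqT, m', hm', ?_⟩
    exact ring_step hee' hm
  obtain ⟨-, r, hr, hrχ, k, hqr⟩ := hqT
  let mp : Matrix (Fin n) (Fin n) (Ell A ℕ) := m'.map Pp
  let mn : Matrix (Fin n) (Fin n) (Ell A ℕ) := (zt 1 : Ell A ℕ) • m'.map Pn
  have hmp : (exp mp).map jp = exp (matL n E0 m') := by
    rw [map_exp_mat _ continuous_jp]; rfl
  have hmn : (exp mn).map jm = exp (m' - matL n E0 m') := by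
    rw [map_exp_mat _ continuous_jm]
    congr 1
    ext1 i j
    have := decomp (m' i j)
    have h2 : (matL n E0 m') i j = jp (Pp (m' i j)) := rfl
    have h3 : (mn.map jm) i j = zt (-1) * jm (Pn (m' i j)) := by
      simp [mn, jm_zt]
    rw [Matrix.sub_apply, h2, h3]
    linear_combination -this
  have hmpinv : (exp mp).map jp * (exp (-mp)).map jp = 1 := by
    have h1 : exp mp * exp (-mp) = 1 := exp_mul_neg_self mp
    have h2 := congrArg (fun X => X.map (jp (A := A))) h1
    rw [← Matrix.map_mul]; refine h2.trans ?_; simp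
  obtain ⟨g, hg⟩ : ∃ g : Matrix (Fin n) (Fin n) (Ell A ℤ), (u * r).map const * (exp (-mp)).map jp - v.map const * (exp mn).map jm
      = ω • g := by
    have h1 : q = e * ((exp mn).map jm * (exp mp).map jp) := by rw [hmp, hmn]; exact hq
    have h2 := mod_final (hvu : v.map const = u.map const * e + ω • h) h1 hmpinv hqr
    have h3 : ((u * r).map const : Matrix (Fin n) (Fin n) (Ell A ℤ)) = C u * r.map const :=
      Matrix.map_mul
    rw [h3]
    exact ⟨_, h2⟩
  let F : Matrix (Fin n) (Fin n) (Ell A ℕ) :=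
    (u * r).map const * exp (-mp) - (zt 1 - const b : Ell A ℕ) • g.map Pp
  let G : Matrix (Fin n) (Fin n) (Ell A ℕ) :=
    v.map const * exp mn + (1 - zt 1 * const b : Ell A ℕ) • g.map Pn
  have hFG : ∀ i j, jp (F i j) = jm (G i j) := by
    intro i j
    have hF : F.map jp = (u * r).map const * (exp (-mp)).map jp - ω • (g.map Pp).map jp := by
      have e1 : ((u * r).map const : Matrix (Fin n) (Fin n) (Ell A ℕ)).map jp = (u * r).map const := by
        ext i j; exact jp_const _
      have e2 := map_sub_smul (jp (A := A)).toRingHom ((u * r).map const) (exp (-mp)) (g.map Pp) (zt 1 - const b)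
      have e3 : (jp (A := A)).toRingHom (zt 1 - const b) = ω := by
        simp [jp_const, jp_zt, hω]
      rw [e3] at e2
      rw [← e1]; exact e2
    have hG : G.map jm = v.map const * (exp mn).map jm +
        (1 - zt (-1) * const b : Ell A ℤ) • (g.map Pn).map jm := by
      have e1 : (v.map const : Matrix (Fin n) (Fin n) (Ell A ℕ)).map jm = v.map const := by
        ext i j; exact jm_const _
      have e2 := map_add_smul (jm (A := A)).toRingHom (v.map const) (exp mn) (g.map Pn) (1 - zt 1 * const b)
      have e3 : (jm (A := A)).toRingHom (1 - zt 1 * const b) = 1 - zt (-1) * const b := by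
        simp [jm_const, jm_zt]
      rw [e3] at e2
      rw [← e1]; exact e2
    have h1 := congrFun (congrFun hg i) j
    have h2 := congrFun (congrFun hF i) j
    have h3 := congrFun (congrFun hG i) j
    have h4 := decomp (g i j)
    have h5 : (zt 1 * zt (-1) : Ell A ℤ) = 1 := by rw [← zt_add, add_neg_cancel, zt_zero]
    simp only [Matrix.sub_apply, Matrix.add_apply, Matrix.smul_apply, Matrix.map_apply (f := jp),
      Matrix.map_apply (f := jm), Matrix.map_apply (f := Pp), Matrix.map_apply (f := Pn),
      smul_eq_mul] at h1 h2 h3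
    rw [h2, h3]
    linear_combination h1 + ω * h4 + jm (Pn (g i j)) * h5
  choose w hwF hwG using fun i j => jp_eq_jm (hFG i j)
  have hwF' : F = (Matrix.of w).map const := by ext i j; exact hwF i j
  have hwG' : G = (Matrix.of w).map const := by ext i j; exact hwG i j
  have hconst : ∀ (χ : A →ₐ[ℂ] ℂ) (z : ℂ) (hz : ‖z‖ ≤ 1) (M : Matrix (Fin n) (Fin n) A),
      (M.map const).map (ev χ z hz) = M.map χ := by
    intro χ z hz M; ext i j; exact ev_const (hz := hz) ..
  have hdexp : ∀ m : Matrix (Fin n) (Fin n) ℂ, (exp m).det ≠ 0 := fun m => by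
    have : IsUnit (exp m) := ⟨⟨_, exp (-m), exp_mul_neg_self _, exp_neg_mul_self _⟩, rfl⟩
    exact ((Matrix.isUnit_iff_isUnit_det _).1 this).ne_zero
  have hcase1 : ∀ (χ : A →ₐ[ℂ] ℂ) (hz : ‖χ b‖ ≤ 1), (Matrix.of w).map χ =
      u.map χ * r.map χ * exp (-mp.map (ev χ (χ b) hz)) := by
    intro χ hz
    have h1 := congrArg (fun M => M.map (ev χ (χ b) hz)) hwF'
    simp only [hconst] at h1
    have h2 : F.map (ev χ (χ b) hz) = ((u * r).map const * exp (-mp)).map (ev χ (χ b) hz) := by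
      ext i j
      simp [F, ev_const, ev_zt]
    rw [← h1, h2, Matrix.map_mul, hconst, Matrix.map_mul, map_exp_mat _ (continuous_ev ..)]
    congr 2
    ext i j; simp
  have hcase2 : ∀ (χ : A →ₐ[ℂ] ℂ) (h0 : χ b ≠ 0) (hz : ‖(χ b)⁻¹‖ ≤ 1), (Matrix.of w).map χ =
      v.map χ * exp (mn.map (ev χ (χ b)⁻¹ hz)) := by
    intro χ h0 hz
    have h1 := congrArg (fun M => M.map (ev χ (χ b)⁻¹ hz)) hwG'
    simp only [hconst] at h1
    have h2 : G.map (ev χ (χ b)⁻¹ hz) = (v.map const * exp mn).map (ev χ (χ b)⁻¹ hz) := by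
      ext i j
      simp [G, ev_const, ev_zt, h0]
    rw [← h1, h2, Matrix.map_mul, hconst, map_exp_mat _ (continuous_ev ..)]
  refine ⟨Matrix.of w, mat_isUnit_of_ch fun χ => ?_, fun χ hχ => ?_⟩
  · rcases le_total ‖χ b‖ 1 with hz | hz
    · rw [hcase1 χ hz, Matrix.det_mul, Matrix.det_mul]
      exact mul_ne_zero (mul_ne_zero (hu χ hz) (mat_ch_ne_zero hr χ)) (hdexp _)
    · have h0 : χ b ≠ 0 := ch_ne_zero hb χ
      have hz' : ‖(χ b)⁻¹‖ ≤ 1 := by rw [norm_inv]; exact inv_le_one_of_one_le₀ hz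
      rw [hcase2 χ h0 hz', Matrix.det_mul]
      exact mul_ne_zero (hv χ hz) (hdexp _)
  · rcases le_total ‖χ b‖ 1 with hz | hz
    · rw [hcase1 χ hz, hrχ χ hχ]
      have : mp.map (ev χ (χ b) hz) = 0 := by
        ext i j; exact ev_Pp χ _ hz hχ (hm' i j)
      rw [this, neg_zero, NormedSpace.exp_zero, mul_one, mul_one]
    · have h0 : χ b ≠ 0 := ch_ne_zero hb χ
      have hz' : ‖(χ b)⁻¹‖ ≤ 1 := by rw [norm_inv]; exact inv_le_one_of_one_le₀ hz
      rw [hcase2 χ h0 hz']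
      have : mn.map (ev χ (χ b)⁻¹ hz') = 0 := by
        ext i j
        have := ev_Pn χ _ hz' hχ (hm' i j)
        simp [mn, this]
      rw [this, NormedSpace.exp_zero, mul_one]
      ext i j
      have := hχ _ (huv.target_mem.1 i j)
      rw [map_sub, sub_eq_zero] at this
      exact this

end Ell

end CartanMain

section LocSec

universe u

open NormedSpace Topology Filter Ell

variable {A : Type u} [NormedCommRing A] [NormedAlgebra ℂ A] [CompleteSpace A]

lemma ch_norm_le (χ : A →ₐ[ℂ] ℂ) (x : A) : ‖χ x‖ ≤ ‖x‖ * ‖(1 : A)‖ :=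
  AlgHom.norm_apply_le_self_mul_norm_one χ x

theorem exists_loc (c : A) :
    ∃ (S : Type u) (_ : NormedCommRing S) (_ : NormedAlgebra ℂ S) (_ : CompleteSpace S)
      (ψ : A →ₐ[ℂ] S), Continuous ψ ∧ DenseRange ψ ∧ (∀ χ : S →ₐ[ℂ] ℂ, ‖χ (ψ c)‖ ≤ 1) ∧
      ∀ χ : A →ₐ[ℂ] ℂ, ‖χ c‖ ≤ 1 → ∃ χ' : S →ₐ[ℂ] ℂ, χ'.comp ψ = χ := by
  let I : Ideal (Ell A ℕ) := (Ideal.span {zt 1 - const c}).closure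
  have hI : IsClosed (I : Set (Ell A ℕ)) := by
    simp only [I, Ideal.coe_closure]; exact isClosed_closure
  have hmem : zt 1 - const c ∈ I := subset_closure (Ideal.mem_span_singleton_self _)
  let π : Ell A ℕ →ₐ[ℂ] Ell A ℕ ⧸ I := Ideal.Quotient.mkₐ ℂ I
  have hπ : Continuous π := by
    refine AddMonoidHomClass.continuous_of_bound π 1 fun x => ?_
    rw [one_mul]
    exact Submodule.Quotient.norm_mk_le I x
  let ψ : A →ₐ[ℂ] Ell A ℕ ⧸ I := π.comp const
  have hz : π (zt 1) = ψ c := by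
    have : π (zt 1 - const c) = 0 := Ideal.Quotient.eq_zero_iff_mem.2 hmem
    rw [map_sub, sub_eq_zero] at this
    exact this
  have hzpow : ∀ k : ℕ, (zt k : Ell A ℕ) = zt 1 ^ k := by
    intro k
    induction k with
    | zero => rw [zt_zero, pow_zero]
    | succ k ih => rw [zt_add, ih, pow_succ]
  refine ⟨Ell A ℕ ⧸ I, inferInstance, inferInstance, inferInstance, ψ,
    hπ.comp continuous_const', ?_, ?_, ?_⟩
  · intro x
    obtain ⟨f, rfl⟩ := Ideal.Quotient.mkₐ_surjective ℂ I x
    let T : Subalgebra ℂ (Ell A ℕ ⧸ I) := ψ.range.topologicalClosure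
    have hT : ∀ f, π f ∈ T := by
      intro f
      refine Ell.ind (p := fun f => π f ∈ T) ?_ ?_ ?_ f
      · exact (Subalgebra.isClosed_topologicalClosure _).preimage hπ
      · intro m a
        rw [mono_eq, map_mul, hzpow, map_pow, hz]
        exact T.mul_mem (subset_closure ⟨a, rfl⟩) (T.pow_mem (subset_closure ⟨c, rfl⟩) _)
      · intro f g hf hg
        rw [map_add]; exact T.add_mem hf hg
    exact hT f
  · intro χ
    rw [← hz]
    refine norm_le_one_of_pow_bounded (χ.comp π) (zt 1) ‖(1 : A)‖ fun k => ?_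
    rw [← hzpow, norm_zt]
  · intro χ hχ
    have hk : ∀ f ∈ I, ev χ (χ c) hχ f = 0 := by
      intro f hf
      have hcl : IsClosed {f | ev χ (χ c) hχ f = 0} :=
        isClosed_eq (continuous_ev ..) continuous_const
      refine (hcl.closure_subset_iff.2 ?_) hf
      intro g hg
      obtain ⟨y, rfl⟩ := Ideal.mem_span_singleton'.1 hg
      simp [ev_zt, ev_const]
    refine ⟨Ideal.Quotient.liftₐ I (ev χ (χ c) hχ) hk, ?_⟩
    ext a
    exact ev_const (hz := hχ) ..

lemma norm_ch_exp (a : A) (r : ℝ) (χ : A →ₐ[ℂ] ℂ) :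
    ‖χ (exp (a - algebraMap ℂ A r))‖ = Real.exp ((χ a).re - r) := by
  let _ : NormedAlgebra ℚ A := NormedAlgebra.restrictScalars ℚ ℂ A
  rw [NormedSpace.map_exp χ (ch_continuous χ), ← Complex.exp_eq_exp_ℂ, Complex.norm_exp]
  simp

theorem cartan_slab {n : ℕ} (J : Ideal A) (a : A) (r r' : ℝ) (hrr : r ≤ r')
    (u v : Matrix (Fin n) (Fin n) A)
    (huv : JoinedIn {M : Matrix (Fin n) (Fin n) A | (∀ i j, M i j - u i j ∈ J) ∧
      ∀ χ : A →ₐ[ℂ] ℂ, (χ a).re = r → (M.map χ).det ≠ 0} u v)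
    (hu : ∀ χ : A →ₐ[ℂ] ℂ, (χ a).re ≤ r → (u.map χ).det ≠ 0)
    (hv : ∀ χ : A →ₐ[ℂ] ℂ, r ≤ (χ a).re → (χ a).re ≤ r' → (v.map χ).det ≠ 0) :
    ∃ ε > 0, ∀ δ > 0, ∃ w : Matrix (Fin n) (Fin n) A,
      (∀ χ : A →ₐ[ℂ] ℂ, (χ a).re ≤ r' → ∀ m : Matrix (Fin n) (Fin n) ℂ,
        (∀ i j, ‖m i j - χ (w i j)‖ < ε) → m.det ≠ 0) ∧
      (∀ χ : A →ₐ[ℂ] ℂ, (χ a).re ≤ r' → (∀ x ∈ J, χ x = 0) →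
        ∀ i j, ‖χ (w i j) - χ (u i j)‖ < δ) := by
  obtain ⟨S, _, _, _, ψ, hψ, hdense, hle, hfac⟩ := exists_loc (exp (a - algebraMap ℂ A r'))
  have hle' : ∀ χ : S →ₐ[ℂ] ℂ, (χ (ψ a)).re ≤ r' := by
    intro χ
    have h1 := hle χ
    have h2 := norm_ch_exp a r' (χ.comp ψ)
    simp only [AlgHom.comp_apply] at h2
    rw [h2] at h1
    have := Real.exp_le_one_iff.1 h1
    linarith
  have hfac' : ∀ χ : A →ₐ[ℂ] ℂ, (χ a).re ≤ r' → ∃ χ' : S →ₐ[ℂ] ℂ, χ'.comp ψ = χ := by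
    intro χ hχ
    refine hfac χ ?_
    rw [norm_ch_exp]
    exact Real.exp_le_one_iff.2 (by linarith)
  let b : S := ψ (exp (a - algebraMap ℂ A r))
  have hb : IsUnit b := by
    have : IsUnit (exp (a - algebraMap ℂ A r)) :=
      ⟨⟨_, exp (-(a - algebraMap ℂ A r)), exp_mul_neg_self _, exp_neg_mul_self _⟩, rfl⟩
    exact this.map ψ
  have hbn : ∀ χ : S →ₐ[ℂ] ℂ, ‖χ b‖ = Real.exp ((χ (ψ a)).re - r) := fun χ =>
    norm_ch_exp a r (χ.comp ψ)
  have hmm : ∀ (χ : S →ₐ[ℂ] ℂ) (M : Matrix (Fin n) (Fin n) A),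
      (M.map ψ).map χ = M.map (χ.comp ψ) := fun χ M => by ext i j; rfl
  obtain ⟨w', hw', hwJ⟩ := Ell.cartan b hb (J.map ψ) (u.map ψ) (v.map ψ) (by
    obtain ⟨γ, hγ⟩ := huv
    refine ⟨γ.map (f := fun M : Matrix (Fin n) (Fin n) A => M.map ψ)
      (continuous_id.matrix_map hψ), fun t => ⟨fun i j => ?_, fun χ hχ => ?_⟩⟩
    · have h := Ideal.mem_map_of_mem ψ ((hγ t).1 i j)
      rw [map_sub] at h
      exact h
    · rw [hbn, Real.exp_eq_one_iff] at hχ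
      have := (hγ t).2 (χ.comp ψ) (by simpa [sub_eq_zero] using hχ)
      rw [← hmm] at this
      exact this)
    (fun χ hχ => by
      rw [hbn, Real.exp_le_one_iff] at hχ
      rw [hmm]; exact hu _ (by simpa using hχ))
    (fun χ hχ => by
      rw [hbn, Real.one_le_exp_iff] at hχ
      rw [hmm]; exact hv _ (by simpa using hχ) (hle' χ))
  obtain ⟨ε, hε, hεw⟩ := unif_inv_ch (K := Set.univ) isClosed_univ w'
    (fun χ _ => mat_ch_ne_zero hw' χ)
  refine ⟨ε / 2, half_pos hε, fun δ hδ => ?_⟩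
  set η := min (ε / 2) δ with hη
  have hη0 : 0 < η := lt_min (half_pos hε) hδ
  have happ : ∀ i j, ∃ x : A, ‖w' i j - ψ x‖ < η / (‖(1 : S)‖ + 1) := fun i j => by
    have := hdense.exists_dist_lt (w' i j) (ε := η / (‖(1 : S)‖ + 1)) (by positivity)
    simpa [dist_eq_norm] using this
  choose w hw using happ
  have hclose : ∀ χ : S →ₐ[ℂ] ℂ, ∀ i j, ‖χ (w' i j) - χ (ψ (w i j))‖ < η := by
    intro χ i j
    rw [← map_sub]
    have h1 := ch_norm_le χ (w' i j - ψ (w i j))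
    have h2 := hw i j
    rw [lt_div_iff₀ (by positivity)] at h2
    have := norm_nonneg (w' i j - ψ (w i j))
    nlinarith
  refine ⟨Matrix.of w, fun χ hχ m hm => ?_, fun χ hχ hJ i j => ?_⟩
  · obtain ⟨χ', rfl⟩ := hfac' χ hχ
    refine hεw χ' trivial m fun i j => ?_
    have h1 := hm i j
    have h2 := hclose χ' i j
    have h3 : η ≤ ε / 2 := min_le_left _ _
    have h4 : m i j - χ' (w' i j) = (m i j - χ' (ψ (w i j))) - (χ' (w' i j) - χ' (ψ (w i j))) := by
      ring
    rw [h4]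
    refine (norm_sub_le _ _).trans_lt ?_
    change ‖m i j - χ' (ψ (w i j))‖ < ε / 2 at h1
    linarith
  · obtain ⟨χ', rfl⟩ := hfac' χ hχ
    have h1 := hwJ χ' (fun x hx => by
      have : J.map ψ ≤ RingHom.ker χ' := Ideal.map_le_iff_le_comap.2 fun y hy => hJ y hy
      exact this hx)
    have h2 := congrFun (congrFun h1 i) j
    change χ' (w' i j) = χ' (ψ (u i j)) at h2
    change ‖χ' (ψ (w i j)) - χ' (ψ (u i j))‖ < δ
    rw [← h2, norm_sub_rev]
    exact (hclose χ' i j).trans_le (min_le_right _ _)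

end LocSec

noncomputable section AlgSec

universe u

open Topology Filter

local notation "II" => unitInterval

lemma ch_factor {D R : Type*} [CommRing D] [Algebra ℂ D] [CommRing R] [Algebra ℂ R]
    (e : D →ₐ[ℂ] R) (he : Function.Surjective e) (Ψ : D →ₐ[ℂ] ℂ) (h : ∀ x, e x = 0 → Ψ x = 0) :
    ∃ χ : R →ₐ[ℂ] ℂ, ∀ x, χ (e x) = Ψ x := by
  refine ⟨(Ideal.Quotient.liftₐ (RingHom.ker e) Ψ h).comp
    (Ideal.quotientKerAlgEquivOfSurjective he).symm.toAlgHom, fun x => ?_⟩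
  have : (Ideal.quotientKerAlgEquivOfSurjective he).symm (e x) = Ideal.Quotient.mk _ x := by
    rw [AlgEquiv.symm_apply_eq]; rfl
  change Ideal.Quotient.liftₐ (RingHom.ker e) Ψ h
    ((Ideal.quotientKerAlgEquivOfSurjective he).symm (e x)) = Ψ x
  rw [this]; rfl

lemma ch_CX {X : Type*} [TopologicalSpace X] [CompactSpace X] [T2Space X] (Ψ : C(X, ℂ) →ₐ[ℂ] ℂ) :
    ∃ x, ∀ f, Ψ f = f x := by
  obtain ⟨x, hx⟩ := (WeakDual.CharacterSpace.continuousMapEval_bijective (X := X) (𝕜 := ℂ)).2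
    (WeakDual.CharacterSpace.equivAlgHom.symm Ψ)
  refine ⟨x, fun f => ?_⟩
  have := congrArg (fun φ : WeakDual.characterSpace ℂ C(X, ℂ) => φ f) hx
  exact this.symm

lemma urysohn_C {X : Type*} [TopologicalSpace X] [CompactSpace X] [T2Space X] (x : X) (U : Set X)
    (hU : IsOpen U) (hx : x ∈ U) : ∃ g : C(X, ℂ), g x = 1 ∧ (∀ y, y ∉ U → g y = 0) ∧
      ∀ y, ‖g y‖ ≤ 1 := by
  obtain ⟨f, hf0, hf1, hf⟩ := exists_continuous_zero_one_of_isClosed (s := Uᶜ) (t := {x})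
    hU.isClosed_compl isClosed_singleton (by simpa using hx)
  refine ⟨⟨fun y => (f y : ℂ), by fun_prop⟩, ?_, fun y hy => ?_, fun y => ?_⟩
  · simpa using hf1 rfl
  · simpa using hf0 hy
  · simp only [ContinuousMap.coe_mk, Complex.norm_real, Real.norm_eq_abs]
    rw [abs_of_nonneg (hf y).1]; exact (hf y).2

lemma eq_of_C {X : Type*} [TopologicalSpace X] [CompactSpace X] [T2Space X] {x y : X}
    (h : ∀ g : C(X, ℂ), g x = g y) : x = y := by
  by_contra hne
  obtain ⟨g, h1, h2, _⟩ := urysohn_C x {y}ᶜ isOpen_compl_singleton hne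
  have := h g
  rw [h1, h2 y (by simp)] at this
  exact one_ne_zero this

variable {A : Type u} [NormedCommRing A] [NormedAlgebra ℂ A] [CompleteSpace A]
  {B : Type u} [NormedCommRing B] [NormedAlgebra ℂ B] [CompleteSpace B]

/-- continuous and bijective on characters -/
def CB {A : Type*} [NormedCommRing A] [NormedAlgebra ℂ A]
    {B : Type*} [NormedCommRing B] [NormedAlgebra ℂ B] (φ : A →ₐ[ℂ] B) : Prop :=
  Continuous φ ∧ Function.Bijective fun χ : B →ₐ[ℂ] ℂ => χ.comp φ

/-- surjective on characters -/
def CS {A : Type*} [NormedCommRing A] [NormedAlgebra ℂ A]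
    {B : Type*} [NormedCommRing B] [NormedAlgebra ℂ B] (φ : A →ₐ[ℂ] B) : Prop :=
  Continuous φ ∧ Function.Surjective fun χ : B →ₐ[ℂ] ℂ => χ.comp φ

lemma CB.cs {φ : A →ₐ[ℂ] B} (h : CB φ) : CS φ := ⟨h.1, h.2.2⟩

lemma CS.exists {φ : A →ₐ[ℂ] B} (h : CS φ) (χ : A →ₐ[ℂ] ℂ) : ∃ χ' : B →ₐ[ℂ] ℂ, ∀ x, χ' (φ x) = χ x := by
  obtain ⟨χ', h'⟩ := h.2 χ
  exact ⟨χ', fun x => congrArg (fun f : A →ₐ[ℂ] ℂ => f x) h'⟩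

lemma CB_id : CB (AlgHom.id ℂ A) := ⟨continuous_id, Function.bijective_id⟩

lemma isUnit_mat_of_CS {n : ℕ} {φ : A →ₐ[ℂ] B} (h : CS φ) {M : Matrix (Fin n) (Fin n) A}
    (hM : IsUnit (M.map φ)) : IsUnit M := by
  refine mat_isUnit_of_ch fun χ => ?_
  obtain ⟨χ', h'⟩ := h.exists χ
  have := mat_ch_ne_zero hM χ'
  have e : (M.map φ).map χ' = M.map χ := by ext i j; exact h' _
  rwa [e] at this

/-! ### functions on a compact space -/

section CK

variable {K : Type*} [TopologicalSpace K] [CompactSpace K] [T2Space K]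

/-- evaluation -/
def evK (κ : K) : C(K, A) →ₐ[ℂ] A := ContinuousMap.evalAlgHom ℂ A κ

@[simp] lemma evK_apply (κ : K) (f : C(K, A)) : evK κ f = f κ := rfl

lemma continuous_evK (κ : K) : Continuous (evK (A := A) κ) := continuous_eval_const κ

/-- constants -/
def constK (K : Type*) [TopologicalSpace K] : A →ₐ[ℂ] C(K, A) where
  toFun a := ContinuousMap.const K a
  map_one' := rfl
  map_mul' _ _ := rfl
  map_zero' := rfl
  map_add' _ _ := rfl
  commutes' _ := rfl

@[simp] lemma constK_apply (a : A) (κ : K) : constK K a κ = a := rfl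

/-- scalar functions -/
def scalK (K : Type*) [TopologicalSpace K] (A : Type*) [NormedCommRing A] [NormedAlgebra ℂ A] :
    C(K, ℂ) →ₐ[ℂ] C(K, A) :=
  AlgHom.compLeftContinuous ℂ (Algebra.ofId ℂ A) (by exact continuous_algebraMap ℂ A)

@[simp] lemma scalK_apply (g : C(K, ℂ)) (κ : K) : scalK K A g κ = algebraMap ℂ A (g κ) := rfl

lemma ch_CK (Ψ : C(K, A) →ₐ[ℂ] ℂ) : ∃ (κ : K) (χ : A →ₐ[ℂ] ℂ), ∀ f, Ψ f = χ (f κ) := by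
  obtain ⟨κ, hκ⟩ := ch_CX (Ψ.comp (scalK K A))
  obtain ⟨χ, hχ⟩ := ch_factor (evK (A := A) κ) (fun a => ⟨constK K a, rfl⟩) Ψ (by
    intro f hf
    by_contra h0
    have hpos : 0 < ‖Ψ f‖ := norm_pos_iff.2 h0
    set ε := ‖Ψ f‖ / (2 * (‖(1 : C(K, A))‖ + 1)) with hε
    have hε0 : 0 < ε := by positivity
    obtain ⟨g, g1, g2, g3⟩ := urysohn_C κ {y | ‖f y‖ < ε} (isOpen_lt (by fun_prop) continuous_const)
      (by have : f κ = 0 := hf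
          simp [this, hε0])
    have h1 : Ψ (scalK K A g * f) = Ψ f := by
      rw [map_mul]
      have := hκ g
      rw [g1] at this
      rw [AlgHom.comp_apply] at this
      rw [this, one_mul]
    have h2 : ‖scalK K A g * f‖ ≤ ε := by
      refine (ContinuousMap.norm_le _ hε0.le).2 fun y => ?_
      have : (scalK K A g * f) y = g y • f y := by
        rw [ContinuousMap.mul_apply, scalK_apply, Algebra.smul_def]
      rw [this, norm_smul]
      by_cases hy : ‖f y‖ < ε
      · have := g3 y
        have := norm_nonneg (f y)
        nlinarith
      · rw [g2 y hy]; simp [hε0.le]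
    have h3 := ch_norm_le Ψ (scalK K A g * f)
    rw [h1] at h3
    have h4 : ε * (2 * (‖(1 : C(K, A))‖ + 1)) = ‖Ψ f‖ := by rw [hε]; field_simp
    have h5 := norm_nonneg (1 : C(K, A))
    nlinarith)
  exact ⟨κ, χ, fun f => (hχ f).symm⟩

/-- the induced map on functions -/
def mapK (K : Type*) [TopologicalSpace K] (φ : A →ₐ[ℂ] B) (hφ : Continuous φ) : C(K, A) →ₐ[ℂ] C(K, B) :=
  AlgHom.compLeftContinuous ℂ φ hφ

@[simp] lemma mapK_apply (φ : A →ₐ[ℂ] B) (hφ : Continuous φ) (f : C(K, A)) (κ : K) :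
    mapK K φ hφ f κ = φ (f κ) := rfl

lemma CB.mapK {φ : A →ₐ[ℂ] B} (h : CB φ) : CB (mapK K φ h.1) := by
  refine ⟨ContinuousMap.continuous_postcomp ⟨φ, h.1⟩, ?_, ?_⟩
  · intro Ψ₁ Ψ₂ h12
    have h12' : ∀ f : C(K, A), Ψ₁ (_root_.mapK K φ h.1 f) = Ψ₂ (_root_.mapK K φ h.1 f) := fun f =>
      congrArg (fun Ψ : C(K, A) →ₐ[ℂ] ℂ => Ψ f) h12
    obtain ⟨κ₁, χ₁, h1⟩ := ch_CK Ψ₁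
    obtain ⟨κ₂, χ₂, h2⟩ := ch_CK Ψ₂
    have e1 : κ₁ = κ₂ := eq_of_C fun g => by
      have := h12' (scalK K A g)
      rw [h1, h2] at this
      simpa using this
    have e2 : χ₁ = χ₂ := h.2.1 (by
      ext a
      have := h12' (constK K a)
      rw [h1, h2] at this
      simpa using this)
    ext f
    rw [h1, h2, e1, e2]
  · intro Ψ
    obtain ⟨κ, χ, h1⟩ := ch_CK Ψ
    obtain ⟨χ', h2⟩ := h.cs.exists χ
    refine ⟨χ'.comp (evK κ), ?_⟩
    ext f
    simp [h1, h2]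

end CK

/-! ### mapping cylinders -/

section DDsec

variable {A0 : Type u} [NormedCommRing A0] [NormedAlgebra ℂ A0] [CompleteSpace A0]
  {A1 : Type u} [NormedCommRing A1] [NormedAlgebra ℂ A1] [CompleteSpace A1]

/-- double mapping cylinder, as a subalgebra -/
def DDs (φ0 : A0 →ₐ[ℂ] B) (φ1 : A1 →ₐ[ℂ] B) : Subalgebra ℂ (C(II, B) × A0 × A1) where
  carrier := {x | x.1 0 = φ0 x.2.1 ∧ x.1 1 = φ1 x.2.2}
  mul_mem' := by
    rintro x y ⟨h1, h2⟩ ⟨h3, h4⟩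
    exact ⟨by simp [h1, h3], by simp [h2, h4]⟩
  add_mem' := by
    rintro x y ⟨h1, h2⟩ ⟨h3, h4⟩
    exact ⟨by simp [h1, h3], by simp [h2, h4]⟩
  algebraMap_mem' := by
    intro r
    exact ⟨(φ0.commutes r).symm, (φ1.commutes r).symm⟩

/-- double mapping cylinder -/
def DD (φ0 : A0 →ₐ[ℂ] B) (φ1 : A1 →ₐ[ℂ] B) : Type u := ↥(DDs φ0 φ1)

instance (φ0 : A0 →ₐ[ℂ] B) (φ1 : A1 →ₐ[ℂ] B) : NormedCommRing (DD φ0 φ1) :=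
  inferInstanceAs (NormedCommRing ↥(DDs φ0 φ1))

instance (φ0 : A0 →ₐ[ℂ] B) (φ1 : A1 →ₐ[ℂ] B) : NormedAlgebra ℂ (DD φ0 φ1) :=
  inferInstanceAs (NormedAlgebra ℂ ↥(DDs φ0 φ1))

variable {φ0 : A0 →ₐ[ℂ] B} {φ1 : A1 →ₐ[ℂ] B}

lemma isClosed_DD (h0 : Continuous φ0) (h1 : Continuous φ1) :
    IsClosed (DDs φ0 φ1 : Set (C(II, B) × A0 × A1)) := by
  refine IsClosed.inter (isClosed_eq ?_ ?_) (isClosed_eq ?_ ?_)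
  · exact (continuous_evK (0 : II)).comp continuous_fst
  · exact h0.comp (continuous_fst.comp continuous_snd)
  · exact (continuous_evK (1 : II)).comp continuous_fst
  · exact h1.comp (continuous_snd.comp continuous_snd)

lemma complete_DD (h0 : Continuous φ0) (h1 : Continuous φ1) : CompleteSpace (DD φ0 φ1) :=
  (isClosed_DD h0 h1).completeSpace_coe

/-- underlying triple -/
def DD.val : DD φ0 φ1 →ₐ[ℂ] C(II, B) × A0 × A1 where
  toFun x := x.1
  map_one' := rfl
  map_mul' _ _ := rfl
  map_zero' := rfl
  map_add' _ _ := rfl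
  commutes' _ := rfl

lemma DD.continuous_val : Continuous (DD.val (φ0 := φ0) (φ1 := φ1)) :=
  continuous_subtype_val (p := fun x => x ∈ DDs φ0 φ1)

/-- evaluation of the path -/
def DD.ev (φ0 : A0 →ₐ[ℂ] B) (φ1 : A1 →ₐ[ℂ] B) (t : II) : DD φ0 φ1 →ₐ[ℂ] B :=
  (evK t).comp ((AlgHom.fst ℂ _ _).comp DD.val)

/-- left end -/
def DD.left (φ0 : A0 →ₐ[ℂ] B) (φ1 : A1 →ₐ[ℂ] B) : DD φ0 φ1 →ₐ[ℂ] A0 :=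
  (AlgHom.fst ℂ _ _).comp ((AlgHom.snd ℂ _ _).comp DD.val)

/-- right end -/
def DD.right (φ0 : A0 →ₐ[ℂ] B) (φ1 : A1 →ₐ[ℂ] B) : DD φ0 φ1 →ₐ[ℂ] A1 :=
  (AlgHom.snd ℂ _ _).comp ((AlgHom.snd ℂ _ _).comp DD.val)

/-- lifting into the cylinder -/
def DD.lift {R : Type*} [Ring R] [Algebra ℂ R] (f : R →ₐ[ℂ] C(II, B)) (f0 : R →ₐ[ℂ] A0)
    (f1 : R →ₐ[ℂ] A1) (h0 : ∀ r, f r 0 = φ0 (f0 r)) (h1 : ∀ r, f r 1 = φ1 (f1 r)) :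
    R →ₐ[ℂ] DD φ0 φ1 where
  toFun r := ⟨(f r, f0 r, f1 r), h0 r, h1 r⟩
  map_one' := Subtype.ext (Prod.ext (map_one f) (Prod.ext (map_one f0) (map_one f1)))
  map_mul' x y := Subtype.ext (Prod.ext (map_mul f x y) (Prod.ext (map_mul f0 x y) (map_mul f1 x y)))
  map_zero' := Subtype.ext (Prod.ext (map_zero f) (Prod.ext (map_zero f0) (map_zero f1)))
  map_add' x y := Subtype.ext (Prod.ext (map_add f x y) (Prod.ext (map_add f0 x y) (map_add f1 x y)))
  commutes' r := Subtype.ext (Prod.ext (f.commutes r) (Prod.ext (f0.commutes r) (f1.commutes r)))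

lemma DD.ev_apply (t : II) (x : DD φ0 φ1) : DD.ev φ0 φ1 t x = x.1.1 t := rfl
lemma DD.left_apply (x : DD φ0 φ1) : DD.left φ0 φ1 x = x.1.2.1 := rfl
lemma DD.right_apply (x : DD φ0 φ1) : DD.right φ0 φ1 x = x.1.2.2 := rfl
lemma DD.ev_zero (x : DD φ0 φ1) : DD.ev φ0 φ1 0 x = φ0 (DD.left φ0 φ1 x) := x.2.1
lemma DD.ev_one (x : DD φ0 φ1) : DD.ev φ0 φ1 1 x = φ1 (DD.right φ0 φ1 x) := x.2.2

lemma DD.continuous_ev (t : II) : Continuous (DD.ev φ0 φ1 t) :=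
  (continuous_evK t).comp (continuous_fst.comp DD.continuous_val)
lemma DD.continuous_left : Continuous (DD.left φ0 φ1) :=
  continuous_fst.comp (continuous_snd.comp DD.continuous_val)
lemma DD.continuous_right : Continuous (DD.right φ0 φ1) :=
  continuous_snd.comp (continuous_snd.comp DD.continuous_val)

lemma DD.ext' {x y : DD φ0 φ1} (h : ∀ t, DD.ev φ0 φ1 t x = DD.ev φ0 φ1 t y)
    (h0 : DD.left φ0 φ1 x = DD.left φ0 φ1 y) (h1 : DD.right φ0 φ1 x = DD.right φ0 φ1 y) : x = y :=
  Subtype.ext (Prod.ext (ContinuousMap.ext h) (Prod.ext h0 h1))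

/-- scalar functions -/
def DD.scal (φ0 : A0 →ₐ[ℂ] B) (φ1 : A1 →ₐ[ℂ] B) : C(II, ℂ) →ₐ[ℂ] DD φ0 φ1 :=
  DD.lift (scalK II B) ((Algebra.ofId ℂ A0).comp (evK (0 : II)))
    ((Algebra.ofId ℂ A1).comp (evK (1 : II))) (fun g => (φ0.commutes (g 0)).symm)
    (fun g => (φ1.commutes (g 1)).symm)

/-- the constructor -/
def DD.mk (F : C(II, B)) (x : A0) (y : A1) (h0 : F 0 = φ0 x) (h1 : F 1 = φ1 y) : DD φ0 φ1 :=
  ⟨(F, x, y), h0, h1⟩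

lemma DD.norm_le (x : DD φ0 φ1) {C : ℝ} (hC : 0 ≤ C) (h : ∀ t, ‖DD.ev φ0 φ1 t x‖ ≤ C)
    (h0 : ‖DD.left φ0 φ1 x‖ ≤ C) (h1 : ‖DD.right φ0 φ1 x‖ ≤ C) : ‖x‖ ≤ C := by
  change ‖x.1‖ ≤ C
  rw [Prod.norm_def, Prod.norm_def]
  exact max_le ((ContinuousMap.norm_le _ hC).2 h) (max_le h0 h1)

theorem ch_DD (h0 : CS φ0) (h1 : CS φ1) (Ψ : DD φ0 φ1 →ₐ[ℂ] ℂ) :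
    ∃ (t : II) (χ : B →ₐ[ℂ] ℂ), (∀ g : C(II, ℂ), Ψ (DD.scal φ0 φ1 g) = g t) ∧
      ∀ x, Ψ x = χ (DD.ev φ0 φ1 t x) := by
  have := complete_DD h0.1 h1.1
  obtain ⟨t, ht⟩ := ch_CX (Ψ.comp (DD.scal φ0 φ1))
  have key : ∀ x : DD φ0 φ1, DD.ev φ0 φ1 t x = 0 → (t = 0 → DD.left φ0 φ1 x = 0) →
      (t = 1 → DD.right φ0 φ1 x = 0) → Ψ x = 0 := by
    intro x hx hl hr
    by_contra hne
    have hpos : 0 < ‖Ψ x‖ := norm_pos_iff.2 hne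
    set ε := ‖Ψ x‖ / (2 * (‖(1 : DD φ0 φ1)‖ + 1)) with hε
    have hε0 : 0 < ε := by positivity
    obtain ⟨g, g1, g2, g3⟩ := urysohn_C t ({y | ‖DD.ev φ0 φ1 y x‖ < ε} ∩ {y | t ≠ 0 → y ≠ 0} ∩
      {y | t ≠ 1 → y ≠ 1}) (by
        refine IsOpen.inter (IsOpen.inter ?_ ?_) ?_
        · refine isOpen_lt ?_ continuous_const
          exact continuous_norm.comp x.1.1.continuous
        · by_cases h : t = 0
          · simp [h]
          · simp only [ne_eq, h, not_false_eq_true, forall_const]; exact isOpen_compl_singleton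
        · by_cases h : t = 1
          · simp [h]
          · simp only [ne_eq, h, not_false_eq_true, forall_const]; exact isOpen_compl_singleton)
      ⟨⟨by simp [hx, hε0], fun h => h⟩, fun h => h⟩
    have e1 : Ψ (DD.scal φ0 φ1 g * x) = Ψ x := by
      rw [map_mul]
      have := ht g
      rw [g1] at this
      rw [AlgHom.comp_apply] at this
      rw [this, one_mul]
    have e2 : ‖DD.scal φ0 φ1 g * x‖ ≤ ε := by
      refine DD.norm_le _ hε0.le (fun y => ?_) ?_ ?_
      · have : DD.ev φ0 φ1 y (DD.scal φ0 φ1 g * x) = g y • DD.ev φ0 φ1 y x := by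
          rw [map_mul, Algebra.smul_def]; rfl
        rw [this, norm_smul]
        by_cases hy : ‖DD.ev φ0 φ1 y x‖ < ε
        · have := g3 y
          have := norm_nonneg (DD.ev φ0 φ1 y x)
          nlinarith
        · rw [g2 y (fun h => hy h.1.1)]; simp [hε0.le]
      · have : DD.left φ0 φ1 (DD.scal φ0 φ1 g * x) = g 0 • DD.left φ0 φ1 x := by
          rw [map_mul, Algebra.smul_def]; rfl
        rw [this]
        by_cases h : t = 0
        · rw [hl h]; simp [hε0.le]
        · rw [g2 0 (fun h' => h'.1.2 h rfl)]; simp [hε0.le]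
      · have : DD.right φ0 φ1 (DD.scal φ0 φ1 g * x) = g 1 • DD.right φ0 φ1 x := by
          rw [map_mul, Algebra.smul_def]; rfl
        rw [this]
        by_cases h : t = 1
        · rw [hr h]; simp [hε0.le]
        · rw [g2 1 (fun h' => h'.2 h rfl)]; simp [hε0.le]
    have h3 := ch_norm_le Ψ (DD.scal φ0 φ1 g * x)
    rw [e1] at h3
    have h4 : ε * (2 * (‖(1 : DD φ0 φ1)‖ + 1)) = ‖Ψ x‖ := by rw [hε]; field_simp
    have h5 := norm_nonneg (1 : DD φ0 φ1)
    nlinarith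
  refine ⟨t, ?_⟩
  suffices ∃ χ : B →ₐ[ℂ] ℂ, ∀ x, Ψ x = χ (DD.ev φ0 φ1 t x) by
    obtain ⟨χ, hχ⟩ := this
    exact ⟨χ, ht, hχ⟩
  by_cases t0 : t = 0
  · have hs : Function.Surjective (DD.left φ0 φ1) := fun a => by
      refine ⟨DD.mk ⟨fun s : II => (1 - (s : ℝ) : ℂ) • φ0 a, by fun_prop⟩ a 0 ?_ ?_, rfl⟩
      · simp
      · simp
    obtain ⟨χ, hχ⟩ := ch_factor (DD.left φ0 φ1) hs Ψ (by
      intro x hx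
      refine key x ?_ (fun _ => hx) (fun h => ?_)
      · rw [t0, DD.ev_zero, hx, map_zero]
      · rw [t0] at h; exact absurd h zero_ne_one)
    obtain ⟨χ', h'⟩ := h0.exists χ
    refine ⟨χ', fun x => ?_⟩
    rw [t0, DD.ev_zero, h', hχ]
  by_cases t1 : t = 1
  · have hs : Function.Surjective (DD.right φ0 φ1) := fun a => by
      refine ⟨DD.mk ⟨fun s : II => ((s : ℝ) : ℂ) • φ1 a, by fun_prop⟩ 0 a ?_ ?_, rfl⟩
      · simp
      · simp
    obtain ⟨χ, hχ⟩ := ch_factor (DD.right φ0 φ1) hs Ψ (by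
      intro x hx
      refine key x ?_ (fun h => ?_) (fun _ => hx)
      · rw [t1, DD.ev_one, hx, map_zero]
      · rw [t1] at h; exact absurd h.symm zero_ne_one)
    obtain ⟨χ', h'⟩ := h1.exists χ
    refine ⟨χ', fun x => ?_⟩
    rw [t1, DD.ev_one, h', hχ]
  · obtain ⟨g, g1, g2, g3⟩ := urysohn_C t ({0}ᶜ ∩ {1}ᶜ)
      (isOpen_compl_singleton.inter isOpen_compl_singleton) ⟨t0, t1⟩
    have hs : Function.Surjective (DD.ev φ0 φ1 t) := fun a => by
      refine ⟨DD.mk ⟨fun s : II => g s • a, by fun_prop⟩ 0 0 ?_ ?_, ?_⟩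
      · simp [g2 0]
      · simp [g2 1]
      · change g t • a = a
        rw [g1, one_smul]
    obtain ⟨χ, hχ⟩ := ch_factor (DD.ev φ0 φ1 t) hs Ψ (by
      intro x hx
      exact key x hx (fun h => absurd h t0) (fun h => absurd h t1))
    exact ⟨χ, fun x => (hχ x).symm⟩

/-- the map `C(I,A) → 𝒟(φ,φ)` -/
def DD.diag (φ : A →ₐ[ℂ] B) (hφ : Continuous φ) : C(II, A) →ₐ[ℂ] DD φ φ :=
  DD.lift (mapK II φ hφ) (evK (0 : II)) (evK (1 : II)) (fun _ => rfl) (fun _ => rfl)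

lemma DD.continuous_diag (φ : A →ₐ[ℂ] B) (hφ : Continuous φ) : Continuous (DD.diag φ hφ) := by
  refine Continuous.subtype_mk (p := fun x => x ∈ DDs φ φ) ?_ _
  exact Continuous.prodMk (ContinuousMap.continuous_postcomp ⟨φ, hφ⟩)
    ((continuous_evK 0).prodMk (continuous_evK 1))

lemma DD.ev_diag (φ : A →ₐ[ℂ] B) (hφ : Continuous φ) (G : C(II, A)) (t : II) :
    DD.ev φ φ t (DD.diag φ hφ G) = φ (G t) := rfl
lemma DD.left_diag (φ : A →ₐ[ℂ] B) (hφ : Continuous φ) (G : C(II, A)) :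
    DD.left φ φ (DD.diag φ hφ G) = G 0 := rfl
lemma DD.right_diag (φ : A →ₐ[ℂ] B) (hφ : Continuous φ) (G : C(II, A)) :
    DD.right φ φ (DD.diag φ hφ G) = G 1 := rfl

lemma DD.diag_scal (φ : A →ₐ[ℂ] B) (hφ : Continuous φ) (g : C(II, ℂ)) :
    DD.diag φ hφ (scalK II A g) = DD.scal φ φ g :=
  DD.ext' (fun t => φ.commutes _) rfl rfl

lemma CB.diag {φ : A →ₐ[ℂ] B} (h : CB φ) : CB (DD.diag φ h.1) := by
  refine ⟨DD.continuous_diag φ h.1, ?_, ?_⟩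
  · intro Ψ₁ Ψ₂ h12
    have h12' : ∀ f : C(II, A), Ψ₁ (DD.diag φ h.1 f) = Ψ₂ (DD.diag φ h.1 f) := fun f =>
      congrArg (fun Ψ : C(II, A) →ₐ[ℂ] ℂ => Ψ f) h12
    obtain ⟨κ₁, χ₁, s1, h1⟩ := ch_DD h.cs h.cs Ψ₁
    obtain ⟨κ₂, χ₂, s2, h2⟩ := ch_DD h.cs h.cs Ψ₂
    have e1 : κ₁ = κ₂ := eq_of_C fun g => by
      rw [← s1, ← s2, ← DD.diag_scal φ h.1, h12']
    have e2 : χ₁ = χ₂ := h.2.1 (by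
      ext a
      have := h12' (constK II a)
      rw [h1, h2] at this
      simpa [DD.ev_diag] using this)
    ext f
    rw [h1, h2, e1, e2]
  · intro Ψ
    obtain ⟨κ, χ, h1⟩ := ch_CK Ψ
    obtain ⟨χ', h2⟩ := h.cs.exists χ
    refine ⟨χ'.comp (DD.ev φ φ κ), ?_⟩
    ext f
    simp [h1, h2, DD.ev_diag]

end DDsec

end AlgSec

noncomputable section SliceSec

universe u

open Topology Filter

local notation "II" => unitInterval

lemma slab_nhds {X : Type*} [TopologicalSpace X] [CompactSpace X] (f : X → ℝ) (hf : Continuous f)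
    (τ : ℝ) (U : Set X) (hU : IsOpen U) (h : ∀ x, f x = τ → x ∈ U) :
    ∃ δ > 0, ∀ x, |f x - τ| < δ → x ∈ U := by
  rcases (Uᶜ).eq_empty_or_nonempty with he | hne
  · exact ⟨1, one_pos, fun x _ => by
      by_contra hx
      have : x ∈ Uᶜ := hx
      rw [he] at this; exact this⟩
  · obtain ⟨x0, hx0, hmin⟩ := hU.isClosed_compl.isCompact.exists_isMinOn hne
      (f := fun x => |f x - τ|) (by fun_prop)
    refine ⟨|f x0 - τ|, abs_pos.2 (sub_ne_zero.2 fun h' => hx0 (h x0 h')), fun x hx => ?_⟩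
    by_contra hxU
    have := hmin hxU
    simp only [Set.mem_setOf_eq] at this
    exact absurd hx (not_lt.2 this)

variable {A : Type u} [NormedCommRing A] [NormedAlgebra ℂ A] [CompleteSpace A]
  {B : Type u} [NormedCommRing B] [NormedAlgebra ℂ B] [CompleteSpace B]

lemma seg_joined {D : Type*} [NormedCommRing D] [NormedAlgebra ℂ D] [CompleteSpace D] {n : ℕ}
    (J : Ideal D) (K : Set (D →ₐ[ℂ] ℂ)) (N M M' : Matrix (Fin n) (Fin n) D)
    (hM : ∀ i j, M i j - N i j ∈ J) (hM' : ∀ i j, M' i j - N i j ∈ J)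
    (hc : ∀ χ ∈ K, ∃ c : Matrix (Fin n) (Fin n) ℂ, ∃ ε : ℝ,
      (∀ m : Matrix (Fin n) (Fin n) ℂ, (∀ i j, ‖m i j - c i j‖ < ε) → m.det ≠ 0) ∧
      (∀ i j, ‖χ (M i j) - c i j‖ < ε) ∧ ∀ i j, ‖χ (M' i j) - c i j‖ < ε) :
    JoinedIn {M : Matrix (Fin n) (Fin n) D | (∀ i j, M i j - N i j ∈ J) ∧
      ∀ χ ∈ K, (M.map χ).det ≠ 0} M M' := by
  refine JoinedIn.of_segment_subset ?_
  rintro _ ⟨a, b, ha, hb, hab, rfl⟩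
  have hex : ∀ i j, (a • M + b • M') i j = algebraMap ℂ D a * M i j + algebraMap ℂ D b * M' i j := by
    intro i j
    rw [Matrix.add_apply, Matrix.smul_apply, Matrix.smul_apply, ← Algebra.smul_def,
      ← Algebra.smul_def]
    simp
  refine ⟨fun i j => ?_, fun χ hχ => ?_⟩
  · rw [hex]
    have e : algebraMap ℂ D a * M i j + algebraMap ℂ D b * M' i j - N i j =
        algebraMap ℂ D a * (M i j - N i j) + algebraMap ℂ D b * (M' i j - N i j) := by
      have : algebraMap ℂ D a + algebraMap ℂ D b = 1 := by
        rw [← map_add, ← Complex.ofReal_add, hab]; simp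
      linear_combination (N i j) * this
    rw [e]
    exact J.add_mem (J.mul_mem_left _ (hM i j)) (J.mul_mem_left _ (hM' i j))
  · obtain ⟨c, ε, h1, h2, h3⟩ := hc χ hχ
    refine h1 _ fun i j => ?_
    rw [Matrix.map_apply, hex, map_add, map_mul, map_mul, AlgHom.commutes, AlgHom.commutes]
    have := (convex_ball (c i j) ε) (x := χ (M i j)) (by simpa [dist_eq_norm] using h2 i j)
      (y := χ (M' i j)) (by simpa [dist_eq_norm] using h3 i j) ha hb hab
    simpa [dist_eq_norm] using this

/-- the modified element -/
def gD {φ : A →ₐ[ℂ] B} (y : DD (AlgHom.id ℂ B) φ) (h : II) (x : A) : DD (AlgHom.id ℂ B) φ :=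
  DD.mk ⟨fun t : II => (DD.val y).1 (t * h) + ((t : ℝ) : ℂ) • (φ x - (DD.val y).1 h), by fun_prop⟩
    (DD.left _ _ y) x (by
      have : (DD.val y).1 0 = DD.left _ _ y := y.2.1
      simpa using this) (by simp)

lemma gD_ev {φ : A →ₐ[ℂ] B} (y : DD (AlgHom.id ℂ B) φ) (h : II) (x : A) (t : II) :
    DD.ev _ _ t (gD y h x) = DD.ev _ _ (t * h) y + ((t : ℝ) : ℂ) • (φ x - DD.ev _ _ h y) := rfl

lemma gD_left {φ : A →ₐ[ℂ] B} (y : DD (AlgHom.id ℂ B) φ) (h : II) (x : A) :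
    DD.left _ _ (gD y h x) = DD.left _ _ y := rfl

lemma gD_right {φ : A →ₐ[ℂ] B} (y : DD (AlgHom.id ℂ B) φ) (h : II) (x : A) :
    DD.right _ _ (gD y h x) = x := rfl

lemma gD_one {φ : A →ₐ[ℂ] B} (y : DD (AlgHom.id ℂ B) φ) : gD y 1 (DD.right _ _ y) = y := by
  refine DD.ext' (fun t => ?_) rfl rfl
  rw [gD_ev, DD.ev_one]; simp

lemma ev_unif {φ : A →ₐ[ℂ] B} (y : DD (AlgHom.id ℂ B) φ) (h : II) {η : ℝ} (hη : 0 < η) :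
    ∀ᶠ h' in 𝓝 h, ∀ t : II, ‖DD.ev _ _ (t * h') y - DD.ev _ _ (t * h) y‖ < η := by
  have hu := CompactSpace.uniformContinuous_of_continuous (DD.val y).1.continuous
  obtain ⟨δ, hδ, hd⟩ := Metric.uniformContinuous_iff.1 hu η hη
  filter_upwards [Metric.ball_mem_nhds h hδ] with h' hh' t
  have : dist (t * h') (t * h) < δ := by
    refine lt_of_le_of_lt ?_ hh'
    rw [Subtype.dist_eq, Subtype.dist_eq, Real.dist_eq, Real.dist_eq]
    simp only [Set.Icc.coe_mul]
    rw [← mul_sub, abs_mul, abs_of_nonneg t.2.1]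
    exact mul_le_of_le_one_left (abs_nonneg _) t.2.2
  have := hd this
  rwa [dist_eq_norm] at this

lemma norm_t_le (t : II) : ‖((t : ℝ) : ℂ)‖ ≤ 1 := by
  rw [Complex.norm_real, Real.norm_eq_abs, abs_of_nonneg t.2.1]; exact t.2.2

/-- slice density -/
def SliceDense (φ : A →ₐ[ℂ] B) (a : A) : Prop :=
  ∀ (f : B) (τ ε : ℝ), 0 < ε → ∃ a' : A, ∀ χ : B →ₐ[ℂ] ℂ, (χ (φ a)).re = τ →
    ‖χ f - χ (φ a')‖ < ε

set_option maxHeartbeats 1000000 in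
theorem slice_path {φ : A →ₐ[ℂ] B} (hφ : CS φ) (a : A) (hd : SliceDense φ a) {n : ℕ}
    (α : DD (AlgHom.id ℂ B) φ) (hα : ∀ t, DD.ev _ _ t α = φ a)
    (r : ℝ) (y : Matrix (Fin n) (Fin n) (DD (AlgHom.id ℂ B) φ))
    (hy : ∀ Ψ : DD (AlgHom.id ℂ B) φ →ₐ[ℂ] ℂ, (Ψ α).re = r → (y.map Ψ).det ≠ 0)
    (u : Matrix (Fin n) (Fin n) A) (εv : ℝ)
    (hv : ∀ χ : B →ₐ[ℂ] ℂ, ∀ m : Matrix (Fin n) (Fin n) ℂ,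
      (∀ i j, ‖m i j - χ (DD.left _ _ (y i j))‖ < εv) → m.det ≠ 0) (hεv : 0 < εv)
    (hu : ∀ χ : B →ₐ[ℂ] ℂ, (χ (φ a)).re = r → ∀ i j,
      ‖χ (φ (u i j)) - χ (DD.left _ _ (y i j))‖ < εv) :
    JoinedIn {M : Matrix (Fin n) (Fin n) (DD (AlgHom.id ℂ B) φ) |
      (∀ i j, M i j - y i j ∈ RingHom.ker (DD.left (AlgHom.id ℂ B) φ)) ∧
      ∀ Ψ ∈ {Ψ : DD (AlgHom.id ℂ B) φ →ₐ[ℂ] ℂ | (Ψ α).re = r}, (M.map Ψ).det ≠ 0} y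
      (Matrix.of fun i j => gD (y i j) 0 (u i j)) := by
  have hcomp : CompleteSpace (DD (AlgHom.id ℂ B) φ) := complete_DD continuous_id hφ.1
  have hch := ch_DD (φ0 := AlgHom.id ℂ B) (φ1 := φ) CB_id.cs hφ
  set W := {M : Matrix (Fin n) (Fin n) (DD (AlgHom.id ℂ B) φ) |
      (∀ i j, M i j - y i j ∈ RingHom.ker (DD.left (AlgHom.id ℂ B) φ)) ∧
      ∀ Ψ ∈ {Ψ : DD (AlgHom.id ℂ B) φ →ₐ[ℂ] ℂ | (Ψ α).re = r}, (M.map Ψ).det ≠ 0} with hW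
  obtain ⟨ε0, hε0, hinv⟩ := unif_inv_ch
    (K := {Ψ : DD (AlgHom.id ℂ B) φ →ₐ[ℂ] ℂ | (Ψ α).re = r})
    (isClosed_eq (Complex.continuous_re.comp (ch_continuous_eval α)) continuous_const) y
    (fun Ψ hΨ => hy Ψ hΨ)
  set ε := min ε0 εv with hε
  have hεp : 0 < ε := lt_min hε0 hεv
  have hinv' : ∀ χ : B →ₐ[ℂ] ℂ, (χ (φ a)).re = r → ∀ (t : II) (m : Matrix (Fin n) (Fin n) ℂ),
      (∀ i j, ‖m i j - χ (DD.ev _ _ t (y i j))‖ < ε) → m.det ≠ 0 := by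
    intro χ hχ t m hm
    refine hinv (χ.comp (DD.ev _ _ t)) (by simp [hα, hχ]) m fun i j => ?_
    exact (hm i j).trans_le (min_le_left _ _)
  let NN : II → Set (Matrix (Fin n) (Fin n) A) := fun h => {x | ∀ χ : B →ₐ[ℂ] ℂ,
    (χ (φ a)).re = r → ∀ i j, ‖χ (φ (x i j)) - χ (DD.ev _ _ h (y i j))‖ < ε / 2}
  have hNN : ∀ h, (NN h).Nonempty := by
    intro h
    choose x hx using fun i j => hd (DD.ev _ _ h (y i j)) r (ε / 2) (half_pos hεp)
    exact ⟨Matrix.of x, fun χ hχ i j => by rw [norm_sub_rev]; exact hx i j χ hχ⟩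
  let g : II → Matrix (Fin n) (Fin n) A → Matrix (Fin n) (Fin n) (DD (AlgHom.id ℂ B) φ) :=
    fun h x => Matrix.of fun i j => gD (y i j) h (x i j)
  have hgJ : ∀ h x i j, g h x i j - y i j ∈ RingHom.ker (DD.left (AlgHom.id ℂ B) φ) := by
    intro h x i j
    rw [RingHom.mem_ker, map_sub, sub_eq_zero]
    exact gD_left (y i j) h (x i j)
  have key : ∀ h h' : II, ∀ x ∈ NN h, ∀ x' ∈ NN h', JoinedIn W (g h x) (g h' x') := by
    have hsymm : Std.Symm (fun h h' : II => ∀ x ∈ NN h, ∀ x' ∈ NN h',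
        JoinedIn W (g h x) (g h' x')) := ⟨fun h h' H x hx x' hx' => (H x' hx' x hx).symm⟩
    refine PreconnectedSpace.induction₂ (fun h h' : II => ∀ x ∈ NN h, ∀ x' ∈ NN h',
        JoinedIn W (g h x) (g h' x')) (fun h => ?_) ⟨fun h h' h'' H H' x hx x'' hx'' => ?_⟩
    · set η := ε / 2 / (‖(1 : B)‖ + 1) with hη
      have hηp : 0 < η := by positivity
      have hev : ∀ᶠ h' in 𝓝 h, ∀ i j, ∀ t : II,
          ‖DD.ev _ _ (t * h') (y i j) - DD.ev _ _ (t * h) (y i j)‖ < η :=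
        Filter.eventually_all.2 fun i => Filter.eventually_all.2 fun j => ev_unif _ _ hηp
      filter_upwards [hev] with h' hh' x hx x' hx'
      refine seg_joined _ _ y _ _ (hgJ h x) (hgJ h' x') fun Ψ hΨ => ?_
      obtain ⟨t, χ, -, hΨχ⟩ := hch Ψ
      have hχ : (χ (φ a)).re = r := by
        have : (Ψ α).re = r := hΨ
        rwa [hΨχ, hα] at this
      refine ⟨Matrix.of fun i j => χ (DD.ev _ _ (t * h) (y i j)), ε, hinv' χ hχ (t * h), ?_, ?_⟩
      · intro i j
        rw [hΨχ]
        change ‖χ (DD.ev _ _ t (gD (y i j) h (x i j))) - χ (DD.ev _ _ (t * h) (y i j))‖ < ε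
        rw [gD_ev, map_add, add_sub_cancel_left, map_smul, smul_eq_mul, norm_mul, map_sub]
        have h1 := hx χ hχ i j
        have h2 := norm_t_le t
        have h3 := norm_nonneg (χ (φ (x i j)) - χ (DD.ev _ _ h (y i j)))
        nlinarith
      · intro i j
        rw [hΨχ]
        change ‖χ (DD.ev _ _ t (gD (y i j) h' (x' i j))) - χ (DD.ev _ _ (t * h) (y i j))‖ < ε
        rw [gD_ev, map_add, map_smul, smul_eq_mul, map_sub]
        have h1 := hx' χ hχ i j
        have h2 := norm_t_le t
        have h3 := norm_nonneg (χ (φ (x' i j)) - χ (DD.ev _ _ h' (y i j)))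
        have h4 := ch_norm_le χ (DD.ev _ _ (t * h') (y i j) - DD.ev _ _ (t * h) (y i j))
        have h5 := hh' i j t
        rw [hη, lt_div_iff₀ (by positivity)] at h5
        have h6 := norm_nonneg (DD.ev (AlgHom.id ℂ B) φ (t * h') (y i j) - DD.ev _ _ (t * h) (y i j))
        rw [map_sub] at h4
        have e : χ (DD.ev _ _ (t * h') (y i j)) + ((t : ℝ) : ℂ) * (χ (φ (x' i j)) -
          χ (DD.ev _ _ h' (y i j))) - χ (DD.ev _ _ (t * h) (y i j)) =
          (χ (DD.ev _ _ (t * h') (y i j)) - χ (DD.ev _ _ (t * h) (y i j))) +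
          ((t : ℝ) : ℂ) * (χ (φ (x' i j)) - χ (DD.ev _ _ h' (y i j))) := by ring
        rw [e]
        refine (norm_add_le _ _).trans_lt ?_
        rw [norm_mul]
        nlinarith
    · obtain ⟨x', hx'⟩ := hNN h'
      exact (H x hx x' hx').trans (H' x' hx' x'' hx'')
  obtain ⟨x0, hx0⟩ := hNN 0
  have e1 : g 1 (y.map (DD.right _ _)) = y := by
    ext1 i j
    exact gD_one _
  have j1 := key 1 0 (y.map (DD.right _ _)) (fun χ hχ i j => by
    rw [DD.ev_one, Matrix.map_apply, sub_self, norm_zero]; exact half_pos hεp) x0 hx0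
  rw [e1] at j1
  refine j1.trans ?_
  refine seg_joined _ _ y _ _ (hgJ 0 x0) (hgJ 0 u) fun Ψ hΨ => ?_
  obtain ⟨t, χ, -, hΨχ⟩ := hch Ψ
  have hχ : (χ (φ a)).re = r := by
    have : (Ψ α).re = r := hΨ
    rwa [hΨχ, hα] at this
  have hev0 : ∀ i j, DD.ev (AlgHom.id ℂ B) φ 0 (y i j) = DD.left _ _ (y i j) := fun i j =>
    DD.ev_zero _
  have aux : ∀ z : Matrix (Fin n) (Fin n) A, (∀ i j,
      ‖χ (φ (z i j)) - χ (DD.left _ _ (y i j))‖ < εv) → ∀ i j,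
      ‖Ψ (g 0 z i j) - χ (DD.left _ _ (y i j))‖ < εv := by
    intro z hz i j
    rw [hΨχ]
    change ‖χ (DD.ev _ _ t (gD (y i j) 0 (z i j))) - χ (DD.left _ _ (y i j))‖ < εv
    rw [gD_ev, map_add, mul_zero, hev0, add_sub_cancel_left, map_smul, smul_eq_mul, norm_mul, map_sub]
    have h1 := hz i j
    have h2 := norm_t_le t
    have h3 := norm_nonneg (χ (φ (z i j)) - χ (DD.left _ _ (y i j)))
    nlinarith
  refine ⟨Matrix.of fun i j => χ (DD.left _ _ (y i j)), εv, hv χ, aux x0 fun i j => ?_,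
    aux u fun i j => hu χ hχ i j⟩
  have := hx0 χ hχ i j
  rw [hev0] at this
  refine this.trans_le ?_
  have : ε ≤ εv := min_le_right _ _
  linarith

end SliceSec

noncomputable section SliceThm

universe u

open Topology Filter

local notation "II" => unitInterval

variable {A : Type u} [NormedCommRing A] [NormedAlgebra ℂ A] [CompleteSpace A]
  {B : Type u} [NormedCommRing B] [NormedAlgebra ℂ B] [CompleteSpace B]

/-- the linear section of the left end map -/
def sD (φ : A →ₐ[ℂ] B) (f : B) : DD (AlgHom.id ℂ B) φ :=
  DD.mk ⟨fun t : II => (1 - (t : ℝ) : ℂ) • f, by fun_prop⟩ f 0 (by simp) (by simp)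

lemma sD_ev (φ : A →ₐ[ℂ] B) (f : B) (t : II) :
    DD.ev _ _ t (sD φ f) = (1 - (t : ℝ) : ℂ) • f := rfl

lemma sD_left (φ : A →ₐ[ℂ] B) (f : B) : DD.left _ _ (sD φ f) = f := rfl

lemma norm_one_sub_t_le (t : II) : ‖(1 - (t : ℝ) : ℂ)‖ ≤ 1 := by
  have : (1 - (t : ℝ) : ℂ) = ((1 - (t : ℝ) : ℝ) : ℂ) := by push_cast; rfl
  rw [this, Complex.norm_real, Real.norm_eq_abs, abs_of_nonneg (by linarith [t.2.2])]
  linarith [t.2.1]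

set_option maxHeartbeats 1000000 in
theorem slice_thm {φ : A →ₐ[ℂ] B} (hφ : CS φ) (a : A) (hd : SliceDense φ a) {n : ℕ}
    (v : Matrix (Fin n) (Fin n) B) (hv : IsUnit v) :
    ∃ u : Matrix (Fin n) (Fin n) A, IsUnit u ∧
      JoinedIn {M : Matrix (Fin n) (Fin n) B | IsUnit M} v (u.map φ) := by
  have hcomp : CompleteSpace (DD (AlgHom.id ℂ B) φ) := complete_DD continuous_id hφ.1
  have hch := ch_DD (φ0 := AlgHom.id ℂ B) (φ1 := φ) CB_id.cs hφ
  let α : DD (AlgHom.id ℂ B) φ := DD.mk (ContinuousMap.const II (φ a)) (φ a) a rfl rfl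
  have hα : ∀ t, DD.ev _ _ t α = φ a := fun t => rfl
  let p := DD.left (AlgHom.id ℂ B) φ
  have hp : ∀ y, DD.ev (AlgHom.id ℂ B) φ 0 y = p y := fun y => DD.ev_zero y
  let Q : ℝ → Prop := fun r => ∃ y : Matrix (Fin n) (Fin n) (DD (AlgHom.id ℂ B) φ),
    (∀ i j, p (y i j) = v i j) ∧
    ∀ Ψ : DD (AlgHom.id ℂ B) φ →ₐ[ℂ] ℂ, (Ψ α).re ≤ r → (y.map Ψ).det ≠ 0
  have hQmono : ∀ r r', r ≤ r' → Q r' → Q r := by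
    rintro r r' h ⟨y, h1, h2⟩
    exact ⟨y, h1, fun Ψ hΨ => h2 Ψ (hΨ.trans h)⟩
  obtain ⟨εv, hεv, hvinv⟩ := unif_inv_ch (K := Set.univ) isClosed_univ v
    (fun χ _ => mat_ch_ne_zero hv χ)
  have hloc : ∀ τ : ℝ, ∃ δ > 0, ∀ r r', |r - τ| < δ → |r' - τ| < δ → r ≤ r' → Q r → Q r' := by
    intro τ
    choose u hu using fun i j => hd (v i j) τ εv hεv
    obtain ⟨δ, hδ, hslab⟩ := slab_nhds (fun χ : B →ₐ[ℂ] ℂ => (χ (φ a)).re)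
      (Complex.continuous_re.comp (ch_continuous_eval _)) τ
      {χ | ∀ i j, ‖χ (φ (u i j)) - χ (v i j)‖ < εv} (by
        have : {χ : B →ₐ[ℂ] ℂ | ∀ i j, ‖χ (φ (u i j)) - χ (v i j)‖ < εv} =
          ⋂ i, ⋂ j, {χ : B →ₐ[ℂ] ℂ | ‖χ (φ (u i j)) - χ (v i j)‖ < εv} := by
            ext χ; simp
        rw [this]
        refine isOpen_iInter_of_finite fun i => isOpen_iInter_of_finite fun j => ?_
        exact isOpen_lt (((ch_continuous_eval _).sub (ch_continuous_eval _)).norm) continuous_const)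
      (fun χ hχ i j => by rw [norm_sub_rev]; exact hu i j χ hχ)
    refine ⟨δ, hδ, ?_⟩
    rintro r r' hr hr' hrr ⟨y, hyp, hy⟩
    have hyp' : ∀ i j, DD.left (AlgHom.id ℂ B) φ (y i j) = v i j := hyp
    have hpath := slice_path hφ a hd α hα r y (fun Ψ hΨ => hy Ψ hΨ.le) (Matrix.of u) εv
      (fun χ m hm => hvinv χ trivial m fun i j => by
        have := hm i j
        rwa [hyp'] at this) hεv
      (fun χ hχ i j => by
        rw [hyp']
        exact hslab χ (by
          change |(χ (φ a)).re - τ| < δ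
          rw [hχ]; exact hr) i j)
    obtain ⟨ε, hε, H⟩ := cartan_slab (RingHom.ker (DD.left (AlgHom.id ℂ B) φ)) α r r' hrr y
      (Matrix.of fun i j => gD (y i j) 0 (u i j)) hpath hy (by
        intro Ψ h1 h2
        obtain ⟨t, χ, -, hΨχ⟩ := hch Ψ
        rw [hΨχ, hα] at h1 h2
        refine hvinv χ trivial _ fun i j => ?_
        rw [Matrix.map_apply, hΨχ]
        change ‖χ (DD.ev _ _ t (gD (y i j) 0 (u i j))) - _‖ < _
        rw [gD_ev, mul_zero, hp, hyp, map_add, add_sub_cancel_left, map_smul, smul_eq_mul,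
          norm_mul, map_sub]
        have h3 := hslab χ (by
          change |(χ (φ a)).re - τ| < δ
          rw [abs_lt] at hr hr' ⊢
          constructor <;> linarith) i j
        have h4 := norm_t_le t
        have h5 := norm_nonneg (χ (φ (u i j)) - χ (v i j))
        nlinarith)
    obtain ⟨w, hw1, hw2⟩ := H ε hε
    refine ⟨Matrix.of fun i j => w i j - sD φ (p (w i j) - v i j), fun i j => ?_, fun Ψ hΨ => ?_⟩
    · change p (w i j - sD φ (p (w i j) - v i j)) = v i j
      rw [map_sub]
      change p (w i j) - (p (w i j) - v i j) = v i j
      ring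
    · refine hw1 Ψ hΨ _ fun i j => ?_
      change ‖Ψ (w i j - sD φ (p (w i j) - v i j)) - Ψ (w i j)‖ < ε
      obtain ⟨t, χ, -, hΨχ⟩ := hch Ψ
      rw [map_sub, sub_sub_cancel_left, norm_neg, hΨχ, sD_ev, map_smul, smul_eq_mul, norm_mul]
      have h1 := hw2 (χ.comp (DD.ev _ _ 0)) (by
        rw [hΨχ, hα] at hΨ
        simpa [hα] using hΨ) (fun x hx => by
          rw [AlgHom.comp_apply, hp]
          have : p x = 0 := hx
          rw [this, map_zero]) i j
      rw [AlgHom.comp_apply, AlgHom.comp_apply, hp, hp, hyp] at h1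
      rw [map_sub]
      have h2 := norm_one_sub_t_le t
      have h3 := norm_nonneg (χ (p (w i j)) - χ (v i j))
      nlinarith
  have hall : ∀ r r' : ℝ, Q r ↔ Q r' := by
    have hsymm : Std.Symm (fun r r' : ℝ => Q r ↔ Q r') := ⟨fun r r' h => h.symm⟩
    refine PreconnectedSpace.induction₂ (fun r r' : ℝ => Q r ↔ Q r') (fun τ => ?_)
      ⟨fun r r' r'' h h' => h.trans h'⟩
    obtain ⟨δ, hδ, H⟩ := hloc τ
    filter_upwards [Metric.ball_mem_nhds τ hδ] with r hr
    have hr' : |r - τ| < δ := hr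
    have h0 : |τ - τ| < δ := by simpa using hδ
    rcases le_total τ r with h | h
    · exact ⟨H τ r h0 hr' h, hQmono _ _ h⟩
    · exact ⟨hQmono _ _ h, H r τ hr' h0 h⟩
  have hbd : ∀ Ψ : DD (AlgHom.id ℂ B) φ →ₐ[ℂ] ℂ, |(Ψ α).re| ≤ ‖α‖ * ‖(1 : DD (AlgHom.id ℂ B) φ)‖ :=
    fun Ψ => (Complex.abs_re_le_norm _).trans (ch_norm_le Ψ α)
  set R := ‖α‖ * ‖(1 : DD (AlgHom.id ℂ B) φ)‖
  have hQ0 : Q (-R - 1) := by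
    refine ⟨Matrix.of fun i j => sD φ (v i j), fun i j => rfl, fun Ψ hΨ => ?_⟩
    have := (abs_le.1 (hbd Ψ)).1
    linarith
  obtain ⟨y, hyp, hy⟩ := (hall _ R).1 hQ0
  have hyu : IsUnit y := mat_isUnit_of_ch fun Ψ => hy Ψ ((le_abs_self _).trans (hbd Ψ))
  have hyt : ∀ t, IsUnit (y.map (DD.ev (AlgHom.id ℂ B) φ t)) := fun t =>
    hyu.map (DD.ev (AlgHom.id ℂ B) φ t).mapMatrix
  refine ⟨y.map (DD.right _ _), hyu.map (DD.right (AlgHom.id ℂ B) φ).mapMatrix, ?_⟩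
  refine ⟨⟨⟨fun t => y.map (DD.ev (AlgHom.id ℂ B) φ t), ?_⟩, ?_, ?_⟩, fun t => hyt t⟩
  · exact continuous_matrix fun i j => (DD.val (y i j)).1.continuous
  · ext i j
    exact (hp _).trans (hyp i j)
  · ext i j
    exact DD.ev_one _

end SliceThm

noncomputable section RealPart

universe u

open Topology Filter

local notation "II" => unitInterval

variable {A : Type u} [NormedCommRing A] [NormedAlgebra ℂ A] [CompleteSpace A]

/-- The Gelfand transform on the space of characters. -/
def gelX (A : Type u) [NormedCommRing A] [NormedAlgebra ℂ A] [CompleteSpace A] :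
    A →ₐ[ℂ] C(A →ₐ[ℂ] ℂ, ℂ) where
  toFun x := ⟨fun χ => χ x, ch_continuous_eval x⟩
  map_one' := by ext χ; simp
  map_mul' x y := by ext χ; simp
  map_zero' := by ext χ; simp
  map_add' x y := by ext χ; simp
  commutes' r := by ext χ; simp

@[simp] lemma gelX_apply (x : A) (χ : A →ₐ[ℂ] ℂ) : gelX A x χ = χ x := rfl

lemma continuous_gelX : Continuous (gelX A) :=
  AddMonoidHomClass.continuous_of_bound (gelX A) ‖(1 : A)‖ fun a => by
    rw [mul_comm]
    exact (ContinuousMap.norm_le _ (by positivity)).2 fun χ => ch_norm_le χ a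

/-- Functions which on every slice are uniform limits of Gelfand transforms. -/
def BBs (a : A) : Subalgebra ℂ C(A →ₐ[ℂ] ℂ, ℂ) where
  carrier := {f | ∀ (τ ε : ℝ), 0 < ε → ∃ a' : A, ∀ χ : A →ₐ[ℂ] ℂ, (χ a).re = τ → ‖f χ - χ a'‖ < ε}
  mul_mem' := by
    intro f g hf hg τ ε hε
    have hC : 0 < ‖f‖ + ‖g‖ + 1 := by positivity
    set η := min 1 (ε / (‖f‖ + ‖g‖ + 1)) with hη
    have hη0 : 0 < η := by positivity
    obtain ⟨b, hb⟩ := hf τ η hη0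
    obtain ⟨c, hc⟩ := hg τ η hη0
    refine ⟨b * c, fun χ hχ => ?_⟩
    have h1 := hb χ hχ
    have h2 := hc χ hχ
    have e : (f * g) χ - χ (b * c) = f χ * (g χ - χ c) + (g χ - (g χ - χ c)) * (f χ - χ b) := by
      rw [map_mul, ContinuousMap.mul_apply]; ring
    rw [e]
    have hf' := f.norm_coe_le_norm χ
    have hg' := g.norm_coe_le_norm χ
    have hη1 : η ≤ 1 := min_le_left _ _
    calc ‖f χ * (g χ - χ c) + (g χ - (g χ - χ c)) * (f χ - χ b)‖
        ≤ ‖f χ‖ * ‖g χ - χ c‖ + (‖g χ‖ + ‖g χ - χ c‖) * ‖f χ - χ b‖ := by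
          refine (norm_add_le _ _).trans ?_
          rw [norm_mul, norm_mul]
          gcongr
          exact norm_sub_le _ _
      _ ≤ ‖f‖ * η + (‖g‖ + 1) * ‖f χ - χ b‖ := by gcongr; exact h2.le.trans hη1
      _ < ‖f‖ * η + (‖g‖ + 1) * η := by gcongr
      _ = (‖f‖ + ‖g‖ + 1) * η := by ring
      _ ≤ (‖f‖ + ‖g‖ + 1) * (ε / (‖f‖ + ‖g‖ + 1)) := by gcongr; exact min_le_right _ _
      _ = ε := by field_simp
  add_mem' := by
    intro f g hf hg τ ε hε
    obtain ⟨b, hb⟩ := hf τ (ε / 2) (by positivity)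
    obtain ⟨c, hc⟩ := hg τ (ε / 2) (by positivity)
    refine ⟨b + c, fun χ hχ => ?_⟩
    have e : (f + g) χ - χ (b + c) = (f χ - χ b) + (g χ - χ c) := by
      rw [map_add, ContinuousMap.add_apply]; ring
    rw [e]
    have := norm_add_le (f χ - χ b) (g χ - χ c)
    linarith [hb χ hχ, hc χ hχ]
  algebraMap_mem' := by
    intro r τ ε hε
    exact ⟨algebraMap ℂ A r, fun χ hχ => by simpa using hε⟩

def BB (a : A) : Type u := ↥(BBs a)

instance (a : A) : NormedCommRing (BB a) := inferInstanceAs (NormedCommRing ↥(BBs a))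
instance (a : A) : NormedAlgebra ℂ (BB a) := inferInstanceAs (NormedAlgebra ℂ ↥(BBs a))

lemma isClosed_BBs (a : A) : IsClosed (BBs a : Set C(A →ₐ[ℂ] ℂ, ℂ)) := by
  refine isClosed_of_closure_subset fun f hf τ ε hε => ?_
  obtain ⟨g, hg, hfg⟩ := Metric.mem_closure_iff.1 hf (ε / 2) (by positivity)
  obtain ⟨a', ha'⟩ := hg τ (ε / 2) (by positivity)
  refine ⟨a', fun χ hχ => ?_⟩
  have h1 := ha' χ hχ
  have h2 : ‖f χ - g χ‖ ≤ ‖f - g‖ := (f - g).norm_coe_le_norm χ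
  rw [dist_eq_norm] at hfg
  have := norm_sub_le_norm_sub_add_norm_sub (f χ) (g χ) (χ a')
  linarith

instance (a : A) : CompleteSpace (BB a) := (isClosed_BBs a).completeSpace_coe

def BB.val (a : A) : BB a →ₐ[ℂ] C(A →ₐ[ℂ] ℂ, ℂ) where
  toFun x := x.1
  map_one' := rfl
  map_mul' _ _ := rfl
  map_zero' := rfl
  map_add' _ _ := rfl
  commutes' _ := rfl

lemma BB.norm_val (a : A) (x : BB a) : ‖BB.val a x‖ = ‖x‖ := rfl

def BB.lift {R : Type*} [Ring R] [Algebra ℂ R] (a : A) (f : R →ₐ[ℂ] C(A →ₐ[ℂ] ℂ, ℂ)) (h : ∀ x, f x ∈ BBs a) :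
    R →ₐ[ℂ] BB a where
  toFun x := ⟨f x, h x⟩
  map_one' := Subtype.ext (map_one f)
  map_mul' x y := Subtype.ext (map_mul f x y)
  map_zero' := Subtype.ext (map_zero f)
  map_add' x y := Subtype.ext (map_add f x y)
  commutes' r := Subtype.ext (f.commutes r)

lemma BB.val_lift {R : Type*} [Ring R] [Algebra ℂ R] (a : A) (f : R →ₐ[ℂ] C(A →ₐ[ℂ] ℂ, ℂ))
    (h : ∀ x, f x ∈ BBs a) (x : R) : BB.val a (BB.lift a f h x) = f x := rfl

def BB.gel (a : A) : A →ₐ[ℂ] BB a :=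
  BB.lift a (gelX A) fun x τ ε hε => ⟨x, fun χ _ => by simpa using hε⟩

lemma BB.continuous_gel (a : A) : Continuous (BB.gel a) :=
  continuous_gelX.subtype_mk _

/-- Evaluation at a character. -/
def BB.ev (a : A) (χ : A →ₐ[ℂ] ℂ) : BB a →ₐ[ℂ] ℂ := (ContinuousMap.evalAlgHom ℂ ℂ χ).comp (BB.val a)

lemma BB.ev_apply (a : A) (χ : A →ₐ[ℂ] ℂ) (f : BB a) : BB.ev a χ f = BB.val a f χ := rfl

lemma BB.ev_gel (a : A) (χ : A →ₐ[ℂ] ℂ) (x : A) : BB.ev a χ (BB.gel a x) = χ x := rfl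

/-- functions of the real part -/
def BB.fn (a : A) (R : ℝ) (hR : ∀ χ : A →ₐ[ℂ] ℂ, (χ a).re ∈ Set.Icc (-R) R) : C(Set.Icc (-R) R, ℂ) →ₐ[ℂ] BB a :=
  BB.lift a (ContinuousMap.compRightAlgHom ℂ ℂ
    (⟨fun χ => ⟨(χ a).re, hR χ⟩, (Complex.continuous_re.comp (ch_continuous_eval a)).subtype_mk _⟩ :
      C(A →ₐ[ℂ] ℂ, Set.Icc (-R) R))) fun h τ ε hε => by
    by_cases hτ : τ ∈ Set.Icc (-R) R
    · refine ⟨algebraMap ℂ A (h ⟨τ, hτ⟩), fun χ hχ => ?_⟩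
      subst hχ
      simpa using hε
    · exact ⟨0, fun χ hχ => absurd (hχ ▸ hR χ) hτ⟩

lemma BB.ev_fn (a : A) (R : ℝ) (hR : ∀ χ : A →ₐ[ℂ] ℂ, (χ a).re ∈ Set.Icc (-R) R) (h : C(Set.Icc (-R) R, ℂ))
    (χ : A →ₐ[ℂ] ℂ) : BB.val a (BB.fn a R hR h) χ = h ⟨(χ a).re, hR χ⟩ := rfl

lemma BB.norm_le (a : A) (x : BB a) {C : ℝ} (hC : 0 ≤ C) (h : ∀ χ, ‖BB.val a x χ‖ ≤ C) : ‖x‖ ≤ C := by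
  rw [← BB.norm_val]
  exact (ContinuousMap.norm_le _ hC).2 h

lemma BB.re_le (a : A) (w : BB a) (h : ∀ χ, (BB.val a w χ).re = 0) (Ψ : BB a →ₐ[ℂ] ℂ) : (Ψ w).re ≤ 0 := by
  have h1 : ‖Ψ (NormedSpace.exp w)‖ ≤ 1 := by
    refine norm_le_one_of_pow_bounded Ψ _ 1 fun k => BB.norm_le a _ zero_le_one fun χ => ?_
    have := norm_ch_exp w 0 (BB.ev a χ)
    rw [← BB.ev_apply, map_pow, norm_pow]
    simp only [Complex.ofReal_zero, map_zero, sub_zero, BB.ev_apply] at this ⊢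
    rw [this, h χ, Real.exp_zero, one_pow]
  have h2 := norm_ch_exp w 0 Ψ
  simp only [Complex.ofReal_zero, map_zero, sub_zero] at h2
  rw [h2] at h1
  exact Real.exp_le_one_iff.1 h1

lemma exists_re_bound (a : A) : ∃ R : ℝ, 0 ≤ R ∧ ∀ χ : A →ₐ[ℂ] ℂ, (χ a).re ∈ Set.Icc (-R) R :=
  ⟨‖a‖ * ‖(1:A)‖, by positivity, fun χ => abs_le.1 ((Complex.abs_re_le_norm _).trans (ch_norm_le χ a))⟩

theorem BB.ch (a : A) (Ψ : BB a →ₐ[ℂ] ℂ) (f : BB a) : Ψ f = BB.val a f (Ψ.comp (BB.gel a)) := by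
  set χ := Ψ.comp (BB.gel a) with hχ
  obtain ⟨R, hR0, hR⟩ := exists_re_bound a
  obtain ⟨τ, hτ⟩ := ch_CX (Ψ.comp (BB.fn a R hR))
  have hre : (χ a).re = τ := by
    let b : BB a := BB.fn a R hR ⟨fun x => ((x : ℝ) : ℂ), by fun_prop⟩
    have hb : Ψ b = ((τ : ℝ) : ℂ) := hτ _
    have h0 : ∀ χ, (BB.val a (BB.gel a a - b) χ).re = 0 := by
      intro χ
      have : BB.val a (BB.gel a a - b) χ = χ a - ((χ a).re : ℂ) := rfl
      rw [this]; simp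
    have h1 := BB.re_le a (BB.gel a a - b) h0 Ψ
    have h2 := BB.re_le a (-(BB.gel a a - b)) (fun χ => by
      rw [map_neg, ContinuousMap.neg_apply, Complex.neg_re, h0 χ, neg_zero]) Ψ
    have h3 : Ψ (BB.gel a a) = χ a := rfl
    rw [map_neg, Complex.neg_re] at h2
    rw [map_sub, Complex.sub_re, hb, h3, Complex.ofReal_re] at h1 h2
    linarith
  refine eq_of_forall_dist_le fun ε hε => ?_
  obtain ⟨a', ha'⟩ := f.2 τ (ε / 2) (by positivity)
  have hfa : ∀ χ : A →ₐ[ℂ] ℂ, (χ a).re = τ → ‖BB.val a f χ - χ a'‖ < ε / 2 := ha'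
  obtain ⟨δ, hδ, hslab⟩ := slab_nhds (fun χ : A →ₐ[ℂ] ℂ => (χ a).re)
    (Complex.continuous_re.comp (ch_continuous_eval a)) τ {χ | ‖BB.val a f χ - χ a'‖ < ε / 2}
    (isOpen_lt (((BB.val a f).continuous.sub (ch_continuous_eval a')).norm) continuous_const) hfa
  obtain ⟨h, h1, h0, hle⟩ := urysohn_C τ {x : Set.Icc (-R) R | |(x : ℝ) - τ| < δ}
    (isOpen_lt (by fun_prop) continuous_const) (by simpa using hδ)
  have hnorm : ‖BB.fn a R hR h * (f - BB.gel a a')‖ ≤ ε / 2 := by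
    refine BB.norm_le a _ (by positivity) fun χ => ?_
    have e : BB.val a (BB.fn a R hR h * (f - BB.gel a a')) χ =
      h ⟨(χ a).re, hR χ⟩ * (BB.val a f χ - χ a') := rfl
    rw [e, norm_mul]
    by_cases hc : |(χ a).re - τ| < δ
    · have := hslab χ hc
      simp only [Set.mem_setOf_eq] at this
      have h3 := hle ⟨(χ a).re, hR χ⟩
      calc _ ≤ 1 * (ε / 2) := by gcongr
        _ = ε / 2 := one_mul _
    · rw [h0 _ hc]; simp; positivity
  have h4 := ch_norm_le Ψ (BB.fn a R hR h * (f - BB.gel a a'))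
  have h5 : Ψ (BB.fn a R hR h) = 1 := by rw [← h1]; exact hτ h
  have h6 : Ψ (BB.gel a a') = χ a' := rfl
  have h7 : ‖(1 : BB a)‖ ≤ 1 := BB.norm_le a _ zero_le_one fun χ => by rw [map_one]; simp
  rw [map_mul, h5, one_mul, map_sub, h6] at h4
  have h8 := hfa χ hre
  rw [dist_eq_norm]
  have h9 := norm_sub_le_norm_sub_add_norm_sub (Ψ f) (χ a') (BB.val a f χ)
  rw [norm_sub_rev (χ a')] at h9
  have h10 : ‖BB.fn a R hR h * (f - BB.gel a a')‖ * ‖(1 : BB a)‖ ≤ ε / 2 * 1 := by gcongr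
  linarith

lemma BB.cb (a : A) : CB (BB.gel a) := by
  refine ⟨BB.continuous_gel a, fun Ψ Ψ' h => ?_, fun χ => ⟨BB.ev a χ, AlgHom.ext fun x => rfl⟩⟩
  ext f
  rw [BB.ch, BB.ch]
  exact congrArg _ h

lemma BB.sliceDense (a : A) : SliceDense (BB.gel a) a := by
  intro f τ ε hε
  obtain ⟨a', ha'⟩ := f.2 τ ε hε
  refine ⟨a', fun Ψ hΨ => ?_⟩
  rw [BB.ch a Ψ f]
  exact ha' (Ψ.comp (BB.gel a)) hΨ

lemma BB.re (a : A) : ∃ h : BB a, ∀ Ψ : BB a →ₐ[ℂ] ℂ, Ψ h = ((Ψ (BB.gel a a)).re : ℂ) := by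
  obtain ⟨R, hR0, hR⟩ := exists_re_bound a
  refine ⟨BB.fn a R hR ⟨fun x => ((x : ℝ) : ℂ), by fun_prop⟩, fun Ψ => ?_⟩
  rw [BB.ch]
  rfl

end RealPart

noncomputable section GoodSec

universe u

open Topology Filter

local notation "II" => unitInterval

/-- joined inside the invertible matrices -/
def JU {R : Type*} [Ring R] [TopologicalSpace R] {n : ℕ} (M N : Matrix (Fin n) (Fin n) R) : Prop :=
  JoinedIn {M : Matrix (Fin n) (Fin n) R | IsUnit M} M N

lemma JU.map {R S : Type*} [Ring R] [TopologicalSpace R] [Ring S] [TopologicalSpace S] [Algebra ℂ R]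
    [Algebra ℂ S] {n : ℕ}
    {M N : Matrix (Fin n) (Fin n) R} (h : JU M N) (φ : R →ₐ[ℂ] S) (hφ : Continuous φ) :
    JU (M.map φ) (N.map φ) := by
  refine (JoinedIn.map h (f := fun M : Matrix (Fin n) (Fin n) R => M.map φ)
    (continuous_id.matrix_map hφ)).mono ?_
  rintro _ ⟨M, hM, rfl⟩
  exact φ.mapMatrix.toRingHom.isUnit_map hM

lemma isUnit_map_alg {R S : Type*} [Ring R] [Ring S] [Algebra ℂ R] [Algebra ℂ S] {n : ℕ}
    {M : Matrix (Fin n) (Fin n) R} (h : IsUnit M) (φ : R →ₐ[ℂ] S) : IsUnit (M.map φ) :=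
  φ.mapMatrix.toRingHom.isUnit_map h

variable {A : Type u} [NormedCommRing A] [NormedAlgebra ℂ A] [CompleteSpace A]
  {B : Type u} [NormedCommRing B] [NormedAlgebra ℂ B] [CompleteSpace B]
  {A0 : Type u} [NormedCommRing A0] [NormedAlgebra ℂ A0] [CompleteSpace A0]
  {A1 : Type u} [NormedCommRing A1] [NormedAlgebra ℂ A1] [CompleteSpace A1]

lemma seg_JU {n : ℕ} (M M' : Matrix (Fin n) (Fin n) A)
    (hc : ∀ χ : A →ₐ[ℂ] ℂ, ∃ c : Matrix (Fin n) (Fin n) ℂ, ∃ ε : ℝ,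
      (∀ m : Matrix (Fin n) (Fin n) ℂ, (∀ i j, ‖m i j - c i j‖ < ε) → m.det ≠ 0) ∧
      (∀ i j, ‖χ (M i j) - c i j‖ < ε) ∧ ∀ i j, ‖χ (M' i j) - c i j‖ < ε) : JU M M' := by
  refine (seg_joined ⊤ Set.univ 0 M M' (fun _ _ => trivial) (fun _ _ => trivial)
    (fun χ _ => hc χ)).mono ?_
  rintro N ⟨_, h⟩
  exact mat_isUnit_of_ch fun χ => h χ trivial

lemma ch_JU {n : ℕ} (M M' : Matrix (Fin n) (Fin n) A) (hM : IsUnit M)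
    (h : ∀ (χ : A →ₐ[ℂ] ℂ) i j, χ (M i j) = χ (M' i j)) : JU M M' := by
  obtain ⟨ε, hε, h1⟩ := unif_inv_ch (K := Set.univ) isClosed_univ M (fun χ _ => mat_ch_ne_zero hM χ)
  exact seg_JU M M' fun χ => ⟨M.map χ, ε, fun m hm => h1 χ trivial m hm, fun i j => by simpa using hε,
    fun i j => by simpa [h] using hε⟩

/-- matrix over `DD` from a path -/
def DD.mat {φ0 : A0 →ₐ[ℂ] B} {φ1 : A1 →ₐ[ℂ] B} {n : ℕ} (γ : II → Matrix (Fin n) (Fin n) B)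
    (hγ : Continuous γ) (u0 : Matrix (Fin n) (Fin n) A0) (u1 : Matrix (Fin n) (Fin n) A1)
    (h0 : γ 0 = u0.map φ0) (h1 : γ 1 = u1.map φ1) : Matrix (Fin n) (Fin n) (DD φ0 φ1) :=
  fun i j => DD.mk ⟨fun t => γ t i j, hγ.matrix_elem i j⟩ (u0 i j) (u1 i j)
    (by simp [h0]) (by simp [h1])

lemma DD.mat_ev {φ0 : A0 →ₐ[ℂ] B} {φ1 : A1 →ₐ[ℂ] B} {n : ℕ} (γ : II → Matrix (Fin n) (Fin n) B)
    (hγ : Continuous γ) (u0 : Matrix (Fin n) (Fin n) A0) (u1 : Matrix (Fin n) (Fin n) A1)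
    (h0 : γ 0 = u0.map φ0) (h1 : γ 1 = u1.map φ1) (t : II) :
    (DD.mat γ hγ u0 u1 h0 h1).map (DD.ev φ0 φ1 t) = γ t := rfl

lemma DD.mat_left {φ0 : A0 →ₐ[ℂ] B} {φ1 : A1 →ₐ[ℂ] B} {n : ℕ} (γ : II → Matrix (Fin n) (Fin n) B)
    (hγ : Continuous γ) (u0 : Matrix (Fin n) (Fin n) A0) (u1 : Matrix (Fin n) (Fin n) A1)
    (h0 : γ 0 = u0.map φ0) (h1 : γ 1 = u1.map φ1) :
    (DD.mat γ hγ u0 u1 h0 h1).map (DD.left φ0 φ1) = u0 := rfl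

lemma DD.mat_right {φ0 : A0 →ₐ[ℂ] B} {φ1 : A1 →ₐ[ℂ] B} {n : ℕ} (γ : II → Matrix (Fin n) (Fin n) B)
    (hγ : Continuous γ) (u0 : Matrix (Fin n) (Fin n) A0) (u1 : Matrix (Fin n) (Fin n) A1)
    (h0 : γ 0 = u0.map φ0) (h1 : γ 1 = u1.map φ1) :
    (DD.mat γ hγ u0 u1 h0 h1).map (DD.right φ0 φ1) = u1 := rfl

lemma DD.isUnit_of_ev {φ0 : A0 →ₐ[ℂ] B} {φ1 : A1 →ₐ[ℂ] B} {n : ℕ} (c0 : CS φ0) (c1 : CS φ1)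
    (M : Matrix (Fin n) (Fin n) (DD φ0 φ1)) (h : ∀ t, IsUnit (M.map (DD.ev φ0 φ1 t))) : IsUnit M := by
  have := complete_DD c0.1 c1.1
  refine mat_isUnit_of_ch fun Ψ => ?_
  obtain ⟨t, χ, -, h1⟩ := ch_DD c0 c1 Ψ
  have := mat_ch_ne_zero (h t) χ
  have e : M.map Ψ = (M.map (DD.ev φ0 φ1 t)).map χ := by ext i j; simp [h1]
  rw [e]; exact this

lemma sliceDense_diag {φ : A →ₐ[ℂ] B} (h : CS φ) (a : A) (hd : SliceDense φ a) :
    SliceDense (DD.diag φ h.1) (constK II a) := by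
  intro f τ ε hε
  have hT : ∃ G : C(II, A), ∀ t, G t ∈ {x : A | ∀ χ : B →ₐ[ℂ] ℂ, (χ (φ a)).re = τ →
      ‖χ (DD.ev φ φ t f) - χ (φ x)‖ < ε} := by
    refine exists_continuous_forall_mem_convex_of_local_const (fun t => ?_) (fun t => ?_)
    · intro x hx y hy p q hp hq hpq χ hχ
      have hb := (convex_ball (χ (DD.ev φ φ t f)) ε) (x := χ (φ x))
        (by rw [Metric.mem_ball, dist_comm, dist_eq_norm]; exact hx χ hχ) (y := χ (φ y))
        (by rw [Metric.mem_ball, dist_comm, dist_eq_norm]; exact hy χ hχ) hp hq hpq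
      rw [Metric.mem_ball, dist_comm, dist_eq_norm] at hb
      have e : ∀ (r : ℝ) (z : A), χ (φ (r • z)) = r • χ (φ z) := by
        intro r z
        rw [← Complex.coe_smul, map_smul, map_smul, Complex.coe_smul]
      rw [map_add, map_add, e, e]
      exact hb
    · obtain ⟨a', ha'⟩ := hd (DD.ev φ φ t f) τ (ε / 2) (by positivity)
      refine ⟨a', ?_⟩
      have hc : Continuous fun s : II => DD.ev φ φ s f := f.1.1.continuous
      have hpos : 0 < ε / (2 * (‖(1 : B)‖ + 1)) := by positivity
      filter_upwards [Metric.continuousAt_iff'.1 hc.continuousAt _ hpos] with s hs χ hχ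
      have h1 := ha' χ hχ
      have h2 := ch_norm_le χ (DD.ev φ φ s f - DD.ev φ φ t f)
      rw [dist_eq_norm] at hs
      have h3 : ‖DD.ev φ φ s f - DD.ev φ φ t f‖ * ‖(1 : B)‖ ≤ ε / 2 := by
        calc _ ≤ ε / (2 * (‖(1 : B)‖ + 1)) * (‖(1 : B)‖ + 1) := by gcongr; linarith
          _ = ε / 2 := by field_simp
      rw [map_sub] at h2
      have := norm_sub_le_norm_sub_add_norm_sub (χ (DD.ev φ φ s f)) (χ (DD.ev φ φ t f)) (χ (φ a'))
      linarith
  obtain ⟨G, hG⟩ := hT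
  refine ⟨G, fun Ψ hΨ => ?_⟩
  obtain ⟨t, χ, -, h1⟩ := ch_DD h h Ψ
  rw [h1, h1, DD.ev_diag]
  rw [h1, DD.ev_diag] at hΨ
  exact hG t χ hΨ

/-- Good morphisms -/
def Good (φ : A →ₐ[ℂ] B) : Prop :=
  CB φ ∧ (∀ (n : ℕ) (v : Matrix (Fin n) (Fin n) B), IsUnit v →
    ∃ u : Matrix (Fin n) (Fin n) A, IsUnit u ∧ JU v (u.map φ)) ∧
  (∀ (n : ℕ) (u0 u1 : Matrix (Fin n) (Fin n) A), IsUnit u0 → IsUnit u1 →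
    JU (u0.map φ) (u1.map φ) → JU u0 u1)

/-- π₀-injectivity from surjectivity for the mapping cylinder. -/
lemma inj_of_surj {φ : A →ₐ[ℂ] B} (h : CB φ) {n : ℕ} (hs : ∀ V : Matrix (Fin n) (Fin n) (DD φ φ), IsUnit V →
      ∃ U : Matrix (Fin n) (Fin n) C(II, A), IsUnit U ∧ JU V (U.map (DD.diag φ h.1)))
    (u0 u1 : Matrix (Fin n) (Fin n) A) (h0 : IsUnit u0) (h1 : IsUnit u1)
    (hj : JU (u0.map φ) (u1.map φ)) : JU u0 u1 := by
  obtain ⟨γ, hγ⟩ := hj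
  let V : Matrix (Fin n) (Fin n) (DD φ φ) := DD.mat γ γ.continuous u0 u1 γ.source γ.target
  have hV : IsUnit V := DD.isUnit_of_ev h.cs h.cs V fun t => hγ t
  obtain ⟨U, hU, hVU⟩ := hs V hV
  have e0 : JU u0 (U.map (evK (0 : II))) := hVU.map (DD.left φ φ) DD.continuous_left
  have e1 : JU u1 (U.map (evK (1 : II))) := hVU.map (DD.right φ φ) DD.continuous_right
  refine JoinedIn.trans e0 (JoinedIn.trans ?_ (JoinedIn.symm e1))
  refine ⟨⟨⟨fun t => U.map (evK t), continuous_matrix fun i j => (U i j).continuous⟩, rfl, rfl⟩, fun t => ?_⟩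
  exact isUnit_map_alg hU (evK t)

lemma BB.good (a : A) : Good (BB.gel a) := by
  refine ⟨BB.cb a, fun n v hv => slice_thm (BB.cb a).cs a (BB.sliceDense a) v hv,
    fun n u0 u1 h0 h1 hj => inj_of_surj (BB.cb a) (fun V hV => ?_) u0 u1 h0 h1 hj⟩
  have := complete_DD (BB.cb a).1 (BB.cb a).1
  exact slice_thm (BB.cb a).diag.cs (constK II a) (sliceDense_diag (BB.cb a).cs a (BB.sliceDense a)) V hV

lemma Good.comp {C : Type u} [NormedCommRing C] [NormedAlgebra ℂ C] [CompleteSpace C] {ψ : B →ₐ[ℂ] C}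
    {φ : A →ₐ[ℂ] B} (hψ : Good ψ) (hφ : Good φ) : Good (ψ.comp φ) := by
  refine ⟨⟨hψ.1.1.comp hφ.1.1, ?_⟩, fun n v hv => ?_, fun n u0 u1 h0 h1 hj => ?_⟩
  · exact hφ.1.2.comp hψ.1.2
  · obtain ⟨w, hw, hvw⟩ := hψ.2.1 n v hv
    obtain ⟨u, hu, hwu⟩ := hφ.2.1 n w hw
    exact ⟨u, hu, JoinedIn.trans hvw (hwu.map ψ hψ.1.1)⟩
  · exact hφ.2.2 n u0 u1 h0 h1 (hψ.2.2 n _ _ (isUnit_map_alg h0 φ) (isUnit_map_alg h1 φ) hj)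

lemma Good_id : Good (AlgHom.id ℂ A) :=
  ⟨CB_id, fun n v hv => ⟨v, hv, JoinedIn.refl hv⟩, fun n u0 u1 _ _ h => h⟩

end GoodSec

noncomputable section ExtSec

universe u

open Topology Filter

local notation "II" => unitInterval

variable {A : Type u} [NormedCommRing A] [NormedAlgebra ℂ A] [CompleteSpace A]
  {B : Type u} [NormedCommRing B] [NormedAlgebra ℂ B] [CompleteSpace B]

/-- Good extensions of `A`. -/
structure GExt (A : Type u) [NormedCommRing A] [NormedAlgebra ℂ A] [CompleteSpace A] where
  B : Type u
  i1 : NormedCommRing B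
  i2 : NormedAlgebra ℂ B
  i3 : CompleteSpace B
  φ : A →ₐ[ℂ] B
  good : Good φ

attribute [instance] GExt.i1 GExt.i2 GExt.i3

def GExt.Lft (E : GExt A) (f : C(A →ₐ[ℂ] ℂ, ℂ)) (b : E.B) : Prop :=
  ∀ Ψ : E.B →ₐ[ℂ] ℂ, Ψ b = f (Ψ.comp E.φ)

/-- The extension relation between good extensions. -/
def GExt.Le (E E' : GExt A) : Prop :=
  ∃ ψ : E.B →ₐ[ℂ] E'.B, Continuous ψ ∧ ∀ x, ψ (E.φ x) = E'.φ x

lemma GExt.Le.refl (E : GExt A) : E.Le E := ⟨AlgHom.id ℂ _, continuous_id, fun _ => rfl⟩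

lemma GExt.Le.trans {E E' E'' : GExt A} (h : E.Le E') (h' : E'.Le E'') : E.Le E'' := by
  obtain ⟨ψ, hc, hψ⟩ := h
  obtain ⟨ψ', hc', hψ'⟩ := h'
  exact ⟨ψ'.comp ψ, hc'.comp hc, fun x => by simp [hψ, hψ']⟩

lemma GExt.Lft.map {E E' : GExt A} {f : C(A →ₐ[ℂ] ℂ, ℂ)} {b : E.B} (h : E.Lft f b) (ψ : E.B →ₐ[ℂ] E'.B)
    (hψ : ∀ x, ψ (E.φ x) = E'.φ x) : E'.Lft f (ψ b) := by
  intro Ψ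
  have := h (Ψ.comp ψ)
  rw [AlgHom.comp_apply] at this
  rw [this]
  congr 1
  ext x
  simp [hψ]

def GExt.Li (E : GExt A) (f : C(A →ₐ[ℂ] ℂ, ℂ)) : Prop := ∃ b, E.Lft f b

lemma GExt.Li.mono {E E' : GExt A} {f : C(A →ₐ[ℂ] ℂ, ℂ)} (h : E.Li f) (hE : E.Le E') : E'.Li f := by
  obtain ⟨b, hb⟩ := h
  obtain ⟨ψ, hc, hψ⟩ := hE
  exact ⟨ψ b, hb.map ψ hψ⟩

def RR (f : C(A →ₐ[ℂ] ℂ, ℂ)) : Prop := ∀ E : GExt A, ∃ E', E.Le E' ∧ E'.Li f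

lemma RR.gel (x : A) : RR (gelX A x) := fun E => ⟨E, GExt.Le.refl E, E.φ x, fun Ψ => rfl⟩

lemma RR.mul {f g : C(A →ₐ[ℂ] ℂ, ℂ)} (hf : RR f) (hg : RR g) : RR (f * g) := by
  intro E
  obtain ⟨E', h1, h2⟩ := hf E
  obtain ⟨E'', h3, h4, h5⟩ := hg E'
  obtain ⟨c, hc⟩ := h2.mono h3
  exact ⟨E'', h1.trans h3, c * h4, fun Ψ => by rw [map_mul, hc, h5]; rfl⟩

lemma RR.add {f g : C(A →ₐ[ℂ] ℂ, ℂ)} (hf : RR f) (hg : RR g) : RR (f + g) := by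
  intro E
  obtain ⟨E', h1, h2⟩ := hf E
  obtain ⟨E'', h3, h4, h5⟩ := hg E'
  obtain ⟨c, hc⟩ := h2.mono h3
  exact ⟨E'', h1.trans h3, c + h4, fun Ψ => by rw [map_add, hc, h5]; rfl⟩

lemma RR.const (r : ℂ) : RR (algebraMap ℂ C(A →ₐ[ℂ] ℂ, ℂ) r) := by
  have := RR.gel (algebraMap ℂ A r)
  rwa [AlgHom.commutes] at this

lemma RR.star {f : C(A →ₐ[ℂ] ℂ, ℂ)} (hf : RR f) : RR (star f) := by
  intro E
  obtain ⟨E', h1, b, hb⟩ := hf E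
  obtain ⟨h, hh⟩ := BB.re b
  let E'' : GExt A := ⟨BB b, inferInstance, inferInstance, inferInstance, (BB.gel b).comp E'.φ,
    (BB.good b).comp E'.good⟩
  have hE : E'.Le E'' := ⟨BB.gel b, BB.continuous_gel b, fun x => rfl⟩
  have hl : E''.Lft f (BB.gel b b) := hb.map (E' := E'') (BB.gel b) fun x => rfl
  refine ⟨E'', h1.trans hE, (2 * h - BB.gel b b : BB b), fun (Ψ : BB b →ₐ[ℂ] ℂ) => ?_⟩
  have h2 : Ψ (BB.gel b b) = f (Ψ.comp E''.φ) := hl Ψ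
  have h3 : Ψ 2 = 2 := map_ofNat Ψ 2
  rw [map_sub, map_mul, hh, h2, h3, ContinuousMap.star_apply]
  apply Complex.ext
  · simp; ring
  · simp

def RRs (A : Type u) [NormedCommRing A] [NormedAlgebra ℂ A] [CompleteSpace A] :
    StarSubalgebra ℂ C(A →ₐ[ℂ] ℂ, ℂ) where
  carrier := {f | RR f}
  mul_mem' := RR.mul
  add_mem' := RR.add
  algebraMap_mem' := RR.const
  star_mem' := RR.star

lemma RR.dense (f : C(A →ₐ[ℂ] ℂ, ℂ)) (ε : ℝ) (hε : 0 < ε) : ∃ g, RR g ∧ ∀ χ, ‖g χ - f χ‖ < ε := by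
  have h := ContinuousMap.starSubalgebra_topologicalClosure_eq_top_of_separatesPoints (RRs A) (by
    intro χ χ' hne
    obtain ⟨x, hx⟩ : ∃ x, χ x ≠ χ' x := by
      by_contra hc
      push Not at hc
      exact hne (AlgHom.ext hc)
    exact ⟨gelX A x, ⟨gelX A x, RR.gel x, rfl⟩, hx⟩)
  have hf : f ∈ (RRs A).topologicalClosure := by rw [h]; trivial
  obtain ⟨g, hg, hd⟩ := Metric.mem_closure_iff.1 hf ε hε
  refine ⟨g, hg, fun χ => ?_⟩
  rw [dist_comm, dist_eq_norm] at hd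
  exact ((g - f).norm_coe_le_norm χ).trans_lt hd

lemma RR.mat {n : ℕ} (M : Matrix (Fin n) (Fin n) C(A →ₐ[ℂ] ℂ, ℂ)) (hM : ∀ i j, RR (M i j)) (E : GExt A) :
    ∃ E', E.Le E' ∧ ∃ b : Matrix (Fin n) (Fin n) E'.B, ∀ i j, E'.Lft (M i j) (b i j) := by
  have : ∀ s : Finset (Fin n × Fin n), ∃ E', E.Le E' ∧ ∀ p ∈ s, E'.Li (M p.1 p.2) := by
    intro s
    induction s using Finset.induction_on with
    | empty => exact ⟨E, GExt.Le.refl E, fun p hp => absurd hp (Finset.notMem_empty p)⟩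
    | insert p s hp ih =>
      obtain ⟨E', h1, h2⟩ := ih
      obtain ⟨E'', h3, h4⟩ := hM p.1 p.2 E'
      refine ⟨E'', h1.trans h3, fun q hq => ?_⟩
      rcases Finset.mem_insert.1 hq with rfl | hq
      · exact h4
      · exact (h2 q hq).mono h3
  obtain ⟨E', h1, h2⟩ := this Finset.univ
  choose b hb using fun i j => h2 (i, j) (Finset.mem_univ _)
  exact ⟨E', h1, b, hb⟩

lemma GExt.isUnit {E : GExt A} {n : ℕ} {M : Matrix (Fin n) (Fin n) C(A →ₐ[ℂ] ℂ, ℂ)}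
    {b : Matrix (Fin n) (Fin n) E.B} (h : ∀ i j, E.Lft (M i j) (b i j)) (hM : IsUnit M) : IsUnit b := by
  refine mat_isUnit_of_ch fun Ψ => ?_
  have := mat_ch_ne_zero hM (ContinuousMap.evalAlgHom ℂ ℂ (Ψ.comp E.φ))
  convert this using 2
  ext i j
  simpa using h i j Ψ

/-- the homeomorphism of character spaces -/
def CB.homeo {φ : A →ₐ[ℂ] B} (h : CB φ) : (B →ₐ[ℂ] ℂ) ≃ₜ (A →ₐ[ℂ] ℂ) :=
  Continuous.homeoOfEquivCompactToT2 (f := Equiv.ofBijective _ h.2)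
    (ch_continuous_of fun a => ch_continuous_eval (φ a))

lemma CB.homeo_apply {φ : A →ₐ[ℂ] B} (h : CB φ) (Ψ : B →ₐ[ℂ] ℂ) : h.homeo Ψ = Ψ.comp φ := rfl

/-- the map to functions on characters of the smaller algebra -/
def CB.th {φ : A →ₐ[ℂ] B} (h : CB φ) : B →ₐ[ℂ] C(A →ₐ[ℂ] ℂ, ℂ) :=
  (ContinuousMap.compRightAlgHom ℂ ℂ (h.homeo.symm : C(A →ₐ[ℂ] ℂ, B →ₐ[ℂ] ℂ))).comp (gelX B)

lemma CB.continuous_th {φ : A →ₐ[ℂ] B} (h : CB φ) : Continuous h.th :=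
  (ContinuousMap.continuous_precomp _).comp continuous_gelX

lemma CB.th_apply {φ : A →ₐ[ℂ] B} (h : CB φ) (b : B) (Ψ : B →ₐ[ℂ] ℂ) : h.th b (Ψ.comp φ) = Ψ b := by
  change h.homeo.symm (h.homeo Ψ) b = Ψ b
  rw [Homeomorph.symm_apply_apply]

lemma CB.th_phi {φ : A →ₐ[ℂ] B} (h : CB φ) (a : A) : h.th (φ a) = gelX A a := by
  ext χ
  obtain ⟨Ψ, rfl⟩ := h.2.2 χ
  rw [h.th_apply]
  rfl

theorem P0_surj {n : ℕ} (v : Matrix (Fin n) (Fin n) C(A →ₐ[ℂ] ℂ, ℂ)) (hv : IsUnit v) :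
    ∃ u : Matrix (Fin n) (Fin n) A, IsUnit u ∧ JU v (u.map (gelX A)) := by
  obtain ⟨ε, hε, h1⟩ := unif_inv_ch (K := Set.univ) isClosed_univ v (fun χ _ => mat_ch_ne_zero hv χ)
  choose M hM hMv using fun i j => RR.dense (v i j) ε hε
  have hseg : JU v M := seg_JU v M fun χ => ⟨v.map χ, ε, fun m hm => h1 χ trivial m hm,
    fun i j => by simpa using hε, fun i j => by
      obtain ⟨x, hx⟩ := ch_CX χ
      rw [Matrix.map_apply, hx, hx]
      exact hMv i j x⟩
  have hMu : IsUnit (Matrix.of M) := hseg.target_mem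
  obtain ⟨E, -, b, hb⟩ := RR.mat (Matrix.of M) hM ⟨A, inferInstance, inferInstance, inferInstance, AlgHom.id ℂ A, Good_id⟩
  have hbu := GExt.isUnit hb hMu
  obtain ⟨u, hu, hbu'⟩ := E.good.2.1 n b hbu
  refine ⟨u, hu, JoinedIn.trans hseg ?_⟩
  change JU (Matrix.of M) _
  have := JU.map hbu' E.good.1.th E.good.1.continuous_th
  have e1 : b.map E.good.1.th = Matrix.of M := by
    ext i j χ
    obtain ⟨Ψ, rfl⟩ := E.good.1.2.2 χ
    rw [Matrix.map_apply, E.good.1.th_apply, hb i j Ψ]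
  have e2 : (u.map E.φ).map E.good.1.th = u.map (gelX A) := by
    ext i j χ
    rw [Matrix.map_apply, Matrix.map_apply, Matrix.map_apply, CB.th_phi]
  rwa [e1, e2] at this

theorem P0_inj {n : ℕ} (u0 u1 : Matrix (Fin n) (Fin n) A) (h0 : IsUnit u0) (h1 : IsUnit u1)
    (hj : JU (u0.map (gelX A)) (u1.map (gelX A))) : JU u0 u1 := by
  obtain ⟨γ, hγ⟩ := hj
  have hγc : ∀ i j, Continuous fun t => γ t i j := fun i j => γ.continuous.matrix_elem i j
  obtain ⟨ε, hε, hun⟩ := unif_inv (X := II × (A →ₐ[ℂ] ℂ)) (n := n) isCompact_univ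
    (fun p => Matrix.of fun i j => γ p.1 i j p.2) (by
      refine (continuous_matrix fun i j => ?_).continuousOn
      exact ContinuousEval.continuous_eval.comp (((hγc i j).comp continuous_fst).prodMk continuous_snd))
    (fun p _ => by
      have := mat_ch_ne_zero (hγ p.1) (ContinuousMap.evalAlgHom ℂ ℂ p.2)
      exact this)
  let near : II → Matrix (Fin n) (Fin n) C(A →ₐ[ℂ] ℂ, ℂ) → Prop := fun t M =>
    (∀ i j, RR (M i j)) ∧ ∀ i j χ, ‖M i j χ - γ t i j χ‖ < ε / 2
  let T : Matrix (Fin n) (Fin n) C(A →ₐ[ℂ] ℂ, ℂ) → Matrix (Fin n) (Fin n) C(A →ₐ[ℂ] ℂ, ℂ) → Prop :=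
    fun M M' => ∀ E : GExt A, ∃ E', E.Le E' ∧ ∃ b b' : Matrix (Fin n) (Fin n) E'.B,
      (∀ i j, E'.Lft (M i j) (b i j)) ∧ (∀ i j, E'.Lft (M' i j) (b' i j)) ∧ JU b b'
  let P : II → II → Prop := fun s t => ∀ M M', near s M → near t M' → T M M'
  have hnear : ∀ t, ∃ M, near t M := by
    intro t
    choose M hM hMv using fun i j => RR.dense (γ t i j) (ε / 2) (by positivity)
    exact ⟨M, hM, hMv⟩
  have hsymm : Std.Symm P := ⟨fun s t h M M' hM hM' E => by
    obtain ⟨E', h1, b, b', h2, h3, h4⟩ := h M' M hM' hM E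
    exact ⟨E', h1, b', b, h3, h2, JoinedIn.symm h4⟩⟩
  have key : P 0 1 := by
    refine PreconnectedSpace.induction₂ P (fun s => ?_) ⟨fun r s t H H' M M'' hM hM'' E => ?_⟩ 0 1
    · have hev : ∀ᶠ t in 𝓝 s, ∀ i j, ‖γ t i j - γ s i j‖ < ε / 2 := by
        rw [Filter.eventually_all]; intro i
        rw [Filter.eventually_all]; intro j
        filter_upwards [Metric.continuousAt_iff'.1 (hγc i j).continuousAt (ε / 2) (by positivity)] with t ht
        rwa [dist_eq_norm] at ht
      filter_upwards [hev] with t ht M M' hM hM' E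
      obtain ⟨E', hE', b, hb⟩ := RR.mat M hM.1 E
      obtain ⟨E'', hE'', b', hb'⟩ := RR.mat M' hM'.1 E'
      obtain ⟨ψ, hψc, hψ⟩ := id hE''
      refine ⟨E'', hE'.trans hE'', b.map ψ, b', fun i j => (hb i j).map ψ hψ, hb', ?_⟩
      refine seg_JU _ _ fun Ψ => ⟨Matrix.of fun i j => γ s i j (Ψ.comp E''.φ), ε,
        fun m hm => hun (s, Ψ.comp E''.φ) trivial m hm, fun i j => ?_, fun i j => ?_⟩
      · have := (hb i j).map (E' := E'') ψ hψ Ψ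
        rw [Matrix.map_apply, this, Matrix.of_apply]
        have := hM.2 i j (Ψ.comp E''.φ)
        linarith
      · rw [hb' i j Ψ, Matrix.of_apply]
        have h1 := hM'.2 i j (Ψ.comp E''.φ)
        have h2 := ((γ t i j - γ s i j).norm_coe_le_norm (Ψ.comp E''.φ)).trans_lt (ht i j)
        rw [ContinuousMap.sub_apply] at h2
        have := norm_sub_le_norm_sub_add_norm_sub (M' i j (Ψ.comp E''.φ)) (γ t i j (Ψ.comp E''.φ))
          (γ s i j (Ψ.comp E''.φ))
        linarith
    · obtain ⟨M', hM'⟩ := hnear s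
      obtain ⟨E', h1, b, b', h2, h3, h4⟩ := H M M' hM hM' E
      obtain ⟨E'', h1', c', c'', h2', h3', h4'⟩ := H' M' M'' hM' hM'' E'
      obtain ⟨ψ, hψc, hψ⟩ := id h1'
      refine ⟨E'', h1.trans h1', b.map ψ, c'', fun i j => (h2 i j).map ψ hψ, h3', ?_⟩
      refine JoinedIn.trans (h4.map ψ hψc) (JoinedIn.trans ?_ h4')
      refine ch_JU _ _ (isUnit_map_alg h4.target_mem ψ) fun Ψ i j => ?_
      rw [Matrix.map_apply, (h3 i j).map (E' := E'') ψ hψ Ψ, h2' i j Ψ]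
  obtain ⟨E, -, b, b', h2, h3, h4⟩ := key (u0.map (gelX A)) (u1.map (gelX A))
    ⟨fun i j => RR.gel _, fun i j χ => by rw [γ.source]; simpa using hε⟩
    ⟨fun i j => RR.gel _, fun i j χ => by rw [γ.target]; simpa using hε⟩
    ⟨A, inferInstance, inferInstance, inferInstance, AlgHom.id ℂ A, Good_id⟩
  refine E.good.2.2 n u0 u1 h0 h1 ?_
  refine JoinedIn.trans (ch_JU _ b (isUnit_map_alg h0 E.φ) fun Ψ i j => ?_)
    (JoinedIn.trans h4 (JoinedIn.symm (ch_JU _ b' (isUnit_map_alg h1 E.φ) fun Ψ i j => ?_)))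
  · rw [h2 i j Ψ]; rfl
  · rw [h3 i j Ψ]; rfl

/-- π₀-surjectivity for every morphism bijective on characters. -/
theorem S_cor {φ : A →ₐ[ℂ] B} (h : CB φ) {n : ℕ} (v : Matrix (Fin n) (Fin n) B) (hv : IsUnit v) :
    ∃ u : Matrix (Fin n) (Fin n) A, IsUnit u ∧ JU v (u.map φ) := by
  obtain ⟨u, hu, hj⟩ := P0_surj (v.map h.th) (isUnit_map_alg hv _)
  refine ⟨u, hu, P0_inj v (u.map φ) hv (isUnit_map_alg hu φ) ?_⟩
  have := hj.map (ContinuousMap.compRightAlgHom ℂ ℂ (h.homeo : C(B →ₐ[ℂ] ℂ, A →ₐ[ℂ] ℂ)))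
    (ContinuousMap.continuous_precomp _)
  convert this using 1
  · ext i j Ψ
    exact (h.th_apply (v i j) Ψ).symm
  · ext i j Ψ
    rfl

end ExtSec

noncomputable section WCSec

universe u

open Topology Filter

local notation "II" => unitInterval

lemma continuous_matInv {R T : Type*} [NormedCommRing R] [CompleteSpace R] [TopologicalSpace T] {n : ℕ}
    {f : T → Matrix (Fin n) (Fin n) R} (hf : Continuous f) (hu : ∀ x, IsUnit (f x)) :
    Continuous fun x => (f x)⁻¹ := by
  simp only [Matrix.inv_def]
  refine Continuous.smul (f := fun x => Ring.inverse (f x).det) (g := fun x => (f x).adjugate) ?_ hf.matrix_adjugate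
  rw [continuous_iff_continuousAt]
  intro x
  have h := (Matrix.isUnit_iff_isUnit_det _).1 (hu x)
  have := NormedRing.inverse_continuousAt h.unit
  rw [IsUnit.unit_spec] at this
  exact ContinuousAt.comp (f := fun x => (f x).det) this hf.matrix_det.continuousAt

lemma homotopicWith_of {K Y : Type*} [TopologicalSpace K] [TopologicalSpace Y] (S : Set Y) (H : II × K → Y)
    (hc : Continuous H) (hS : ∀ p, H p ∈ S) (f g : C(K, Y)) (h0 : ∀ κ, H (0, κ) = f κ)
    (h1 : ∀ κ, H (1, κ) = g κ) : ContinuousMap.HomotopicWith f g (fun F => ∀ κ, F κ ∈ S) :=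
  ⟨{ toFun := H, continuous_toFun := hc, map_zero_left := h0, map_one_left := h1,
     prop' := fun t κ => hS _ }⟩

variable {A : Type u} [NormedCommRing A] [NormedAlgebra ℂ A] [CompleteSpace A]
  {B : Type u} [NormedCommRing B] [NormedAlgebra ℂ B] [CompleteSpace B]
  {A0 : Type u} [NormedCommRing A0] [NormedAlgebra ℂ A0] [CompleteSpace A0]
  {A1 : Type u} [NormedCommRing A1] [NormedAlgebra ℂ A1] [CompleteSpace A1]
  {K : Type u} [TopologicalSpace K] [CompactSpace K] [T2Space K]

lemma DD.continuous_of {T : Type*} [TopologicalSpace T] {φ0 : A0 →ₐ[ℂ] B} {φ1 : A1 →ₐ[ℂ] B}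
    {f : T → DD φ0 φ1} (h : Continuous fun p : T × II => DD.ev φ0 φ1 p.2 (f p.1))
    (h0 : Continuous fun ξ => DD.left φ0 φ1 (f ξ)) (h1 : Continuous fun ξ => DD.right φ0 φ1 (f ξ)) :
    Continuous f := by
  refine Topology.IsInducing.subtypeVal.continuous_iff.2 (Continuous.prodMk ?_ (h0.prodMk h1))
  exact ContinuousMap.continuous_of_continuous_uncurry _ h

lemma DD.continuous_ev2 {φ0 : A0 →ₐ[ℂ] B} {φ1 : A1 →ₐ[ℂ] B} :
    Continuous fun p : DD φ0 φ1 × II => DD.ev φ0 φ1 p.2 p.1 := by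
  have : Continuous fun p : C(II, B) × II => p.1 p.2 := ContinuousEval.continuous_eval
  exact this.comp (((continuous_fst.comp continuous_subtype_val).comp continuous_fst).prodMk continuous_snd)

/-- `C(K,A)` as a Banach algebra -/
def CKA (K : Type u) [TopologicalSpace K] [CompactSpace K] (A : Type u) [NormedCommRing A] : Type u := C(K, A)

instance : NormedCommRing (CKA K A) := inferInstanceAs (NormedCommRing C(K, A))
instance : NormedAlgebra ℂ (CKA K A) := inferInstanceAs (NormedAlgebra ℂ C(K, A))
instance : CompleteSpace (CKA K A) := inferInstanceAs (CompleteSpace C(K, A))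

def CKA.ev (κ : K) : CKA K A →ₐ[ℂ] A := evK κ

lemma CKA.continuous_ev2 : Continuous fun p : CKA K A × K => CKA.ev p.2 p.1 :=
  (ContinuousEval.continuous_eval : Continuous fun p : C(K, A) × K => p.1 p.2)

def CKA.mk (f : K → A) (hf : Continuous f) : CKA K A := (⟨f, hf⟩ : C(K, A))

lemma CKA.ev_mk (f : K → A) (hf : Continuous f) (κ : K) : CKA.ev κ (CKA.mk f hf) = f κ := rfl

lemma CKA.ext {f g : CKA K A} (h : ∀ κ, CKA.ev κ f = CKA.ev κ g) : f = g :=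
  ContinuousMap.ext (f := (f : C(K, A))) (g := (g : C(K, A))) h

lemma CKA.continuous_of {T : Type*} [TopologicalSpace T] {f : T → CKA K A}
    (h : Continuous fun p : T × K => CKA.ev p.2 (f p.1)) : Continuous f :=
  ContinuousMap.continuous_of_continuous_uncurry (fun x => (f x : C(K, A))) h

lemma CKA.continuous_ev (κ : K) : Continuous (CKA.ev (A := A) κ) := continuous_evK κ

def mapCK (K : Type u) [TopologicalSpace K] [CompactSpace K] (φ : A →ₐ[ℂ] B) (hφ : Continuous φ) :
    CKA K A →ₐ[ℂ] CKA K B := mapK K φ hφ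

lemma mapCK_ev (φ : A →ₐ[ℂ] B) (hφ : Continuous φ) (f : CKA K A) (κ : K) :
    CKA.ev κ (mapCK K φ hφ f) = φ (CKA.ev κ f) := rfl

lemma CB.mapCK {φ : A →ₐ[ℂ] B} (h : CB φ) : CB (mapCK K φ h.1) := CB.mapK (K := K) h

lemma isUnit_CKA {n : ℕ} (M : Matrix (Fin n) (Fin n) (CKA K A)) (h : ∀ κ, IsUnit (M.map (CKA.ev κ))) :
    IsUnit M := by
  refine mat_isUnit_of_ch fun Ψ => ?_
  obtain ⟨κ, χ, h1⟩ := ch_CK (K := K) (A := A) Ψ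
  have := mat_ch_ne_zero (h κ) χ
  have e : M.map Ψ = (M.map (CKA.ev κ)).map χ := by ext i j; exact h1 _
  rw [e]; exact this

section rho

variable (φ : A →ₐ[ℂ] B) (hφ : Continuous φ)

/-- auxiliary map: evaluation at `κ` -/
def rhoF (κ : K) (x : DD (mapCK K φ hφ) (mapCK K φ hφ)) : DD φ (AlgHom.id ℂ B) :=
  DD.mk ⟨fun t => CKA.ev κ (DD.ev (mapCK K φ hφ) (mapCK K φ hφ) t x),
      (CKA.continuous_ev κ).comp (DD.continuous_ev2.comp (continuous_const.prodMk continuous_id))⟩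
    (CKA.ev κ (DD.left (mapCK K φ hφ) (mapCK K φ hφ) x))
    (φ (CKA.ev κ (DD.right (mapCK K φ hφ) (mapCK K φ hφ) x)))
    (congrArg (CKA.ev κ) (DD.ev_zero x)) (congrArg (CKA.ev κ) (DD.ev_one x))

lemma rhoF_ev (κ : K) (x : DD (mapCK K φ hφ) (mapCK K φ hφ)) (t : II) :
    DD.ev φ (AlgHom.id ℂ B) t (rhoF φ hφ κ x) = CKA.ev κ (DD.ev (mapCK K φ hφ) (mapCK K φ hφ) t x) := rfl
lemma rhoF_left (κ : K) (x : DD (mapCK K φ hφ) (mapCK K φ hφ)) :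
    DD.left φ (AlgHom.id ℂ B) (rhoF φ hφ κ x) = CKA.ev κ (DD.left (mapCK K φ hφ) (mapCK K φ hφ) x) := rfl
lemma rhoF_right (κ : K) (x : DD (mapCK K φ hφ) (mapCK K φ hφ)) :
    DD.right φ (AlgHom.id ℂ B) (rhoF φ hφ κ x) = φ (CKA.ev κ (DD.right (mapCK K φ hφ) (mapCK K φ hφ) x)) := rfl

/-- evaluation at `κ` -/
def rhoK (κ : K) : DD (mapCK K φ hφ) (mapCK K φ hφ) →ₐ[ℂ] DD φ (AlgHom.id ℂ B) where
  toFun := rhoF φ hφ κ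
  map_one' := DD.ext' (fun t => by rw [rhoF_ev, map_one, map_one, map_one])
    (by rw [rhoF_left, map_one, map_one, map_one]) (by rw [rhoF_right, map_one, map_one, map_one, map_one])
  map_mul' x y := DD.ext' (fun t => by rw [rhoF_ev, map_mul, map_mul, map_mul]; rfl)
    (by rw [rhoF_left, map_mul, map_mul, map_mul]; rfl) (by rw [rhoF_right, map_mul, map_mul, map_mul, map_mul]; rfl)
  map_zero' := DD.ext' (fun t => by rw [rhoF_ev, map_zero, map_zero, map_zero])
    (by rw [rhoF_left, map_zero, map_zero, map_zero]) (by rw [rhoF_right, map_zero, map_zero, map_zero, map_zero])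
  map_add' x y := DD.ext' (fun t => by rw [rhoF_ev, map_add, map_add, map_add]; rfl)
    (by rw [rhoF_left, map_add, map_add, map_add]; rfl) (by rw [rhoF_right, map_add, map_add, map_add, map_add]; rfl)
  commutes' r := DD.ext' (fun t => by rw [rhoF_ev, AlgHom.commutes, AlgHom.commutes, AlgHom.commutes])
    (by rw [rhoF_left, AlgHom.commutes, AlgHom.commutes, AlgHom.commutes])
    (by rw [rhoF_right, AlgHom.commutes, AlgHom.commutes, AlgHom.commutes, AlgHom.commutes])

lemma rhoK_ev (κ : K) (x : DD (mapCK K φ hφ) (mapCK K φ hφ)) (t : II) :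
    DD.ev φ (AlgHom.id ℂ B) t (rhoK φ hφ κ x) = CKA.ev κ (DD.ev (mapCK K φ hφ) (mapCK K φ hφ) t x) := rfl
lemma rhoK_left (κ : K) (x : DD (mapCK K φ hφ) (mapCK K φ hφ)) :
    DD.left φ (AlgHom.id ℂ B) (rhoK φ hφ κ x) = CKA.ev κ (DD.left (mapCK K φ hφ) (mapCK K φ hφ) x) := rfl
lemma rhoK_right (κ : K) (x : DD (mapCK K φ hφ) (mapCK K φ hφ)) :
    DD.right φ (AlgHom.id ℂ B) (rhoK φ hφ κ x) = φ (CKA.ev κ (DD.right (mapCK K φ hφ) (mapCK K φ hφ) x)) := rfl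

end rho

lemma continuous_rhoK (φ : A →ₐ[ℂ] B) (hφ : Continuous φ) :
    Continuous fun p : DD (mapCK K φ hφ) (mapCK K φ hφ) × K => rhoK φ hφ p.2 p.1 := by
  refine DD.continuous_of ?_ ?_ ?_
  · simp only [rhoK_ev]
    exact CKA.continuous_ev2.comp ((DD.continuous_ev2.comp
      ((continuous_fst.comp continuous_fst).prodMk continuous_snd)).prodMk
        (continuous_snd.comp continuous_fst))
  · simp only [rhoK_left]
    exact CKA.continuous_ev2.comp ((DD.continuous_left.comp continuous_fst).prodMk continuous_snd)
  · simp only [rhoK_right]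
    exact hφ.comp (CKA.continuous_ev2.comp
      ((DD.continuous_right.comp continuous_fst).prodMk continuous_snd))

/-- path in `A` gives an element -/
def dlt (φ : A →ₐ[ℂ] B) (hφ : Continuous φ) : C(II, A) →ₐ[ℂ] DD φ (AlgHom.id ℂ B) :=
  DD.lift (mapK II φ hφ) (evK (0 : II)) (φ.comp (evK (1 : II))) (fun _ => rfl) (fun _ => rfl)

lemma continuous_dlt (φ : A →ₐ[ℂ] B) (hφ : Continuous φ) : Continuous (dlt φ hφ) := by
  refine Continuous.subtype_mk (p := fun x => x ∈ DDs φ (AlgHom.id ℂ B)) ?_ _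
  exact Continuous.prodMk (ContinuousMap.continuous_postcomp ⟨φ, hφ⟩)
    ((continuous_evK 0).prodMk (hφ.comp (continuous_evK 1)))

lemma continuous_constK : Continuous (constK (A := A) II) :=
  ContinuousMap.continuous_of_continuous_uncurry _ continuous_fst

lemma isUnit_CK {K : Type*} [TopologicalSpace K] [CompactSpace K] [T2Space K] {n : ℕ} (M : Matrix (Fin n) (Fin n) C(K, A)) (h : ∀ κ, IsUnit (M.map (evK κ))) : IsUnit M := by
  refine mat_isUnit_of_ch fun Ψ => ?_
  obtain ⟨κ, χ, h1⟩ := ch_CK Ψ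
  have := mat_ch_ne_zero (h κ) χ
  have e : M.map Ψ = (M.map (evK κ)).map χ := by ext i j; simp [h1]
  rw [e]; exact this

lemma mat_map_inv_mul {R S : Type*} [CommRing R] [CommRing S] [Algebra ℂ R] [Algebra ℂ S] {n : ℕ}
    (r : R →ₐ[ℂ] S) (M N : Matrix (Fin n) (Fin n) R) (hN : IsUnit N) (h : M.map r = N.map r) :
    (M * N⁻¹).map r = 1 := by
  rw [Matrix.map_mul, h, ← Matrix.map_mul, Matrix.mul_nonsing_inv _ ((Matrix.isUnit_iff_isUnit_det _).1 hN)]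
  exact Matrix.map_one _ (map_zero r) (map_one r)

lemma isUnit_matInv {R : Type*} [CommRing R] {n : ℕ} {M : Matrix (Fin n) (Fin n) R} (h : IsUnit M) :
    IsUnit M⁻¹ := (Matrix.isUnit_nonsing_inv_iff).2 h

end WCSec

noncomputable section WC2Sec

universe u

open Topology Filter

local notation "II" => unitInterval

variable {A : Type u} [NormedCommRing A] [NormedAlgebra ℂ A] [CompleteSpace A]
  {B : Type u} [NormedCommRing B] [NormedAlgebra ℂ B] [CompleteSpace B]
  {K : Type u} [TopologicalSpace K] [CompactSpace K] [T2Space K]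

theorem WC_core {φ : A →ₐ[ℂ] B} (h : CB φ) {n : ℕ}
    (g : C(K, Matrix (Fin n) (Fin n) (DD φ (AlgHom.id ℂ B))))
    (hg : ∀ κ, IsUnit (g κ)) (hg1 : ∀ κ, (g κ).map (DD.right φ (AlgHom.id ℂ B)) = 1) :
    ContinuousMap.HomotopicWith g (ContinuousMap.const K 1)
      (fun F => ∀ κ, F κ ∈ {M : Matrix (Fin n) (Fin n) (DD φ (AlgHom.id ℂ B)) | IsUnit M ∧ M.map (DD.right φ (AlgHom.id ℂ B)) = 1}) := by
  have c1 : CompleteSpace (DD φ (AlgHom.id ℂ B)) := complete_DD h.1 continuous_id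
  have hK : CB (mapCK K φ h.1) := h.mapCK
  have c2 : CompleteSpace (DD (mapCK K φ h.1) (mapCK K φ h.1)) := complete_DD hK.1 hK.1
  have hgc : ∀ i j, Continuous fun κ => g κ i j := fun i j => g.continuous.matrix_elem i j
  have hg1' : ∀ κ i j, DD.right φ (AlgHom.id ℂ B) (g κ i j) = (1 : Matrix (Fin n) (Fin n) B) i j := by
    intro κ i j; rw [← hg1 κ]; rfl
  let V : Matrix (Fin n) (Fin n) (DD (mapCK K φ h.1) (mapCK K φ h.1)) := fun i j =>
    DD.mk ⟨fun t => CKA.mk (fun κ => DD.ev φ (AlgHom.id ℂ B) t (g κ i j))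
        (DD.continuous_ev2.comp ((hgc i j).prodMk continuous_const)),
        CKA.continuous_of (DD.continuous_ev2.comp (((hgc i j).comp continuous_snd).prodMk continuous_fst))⟩
      (CKA.mk (fun κ => DD.left φ (AlgHom.id ℂ B) (g κ i j)) (DD.continuous_left.comp (hgc i j)))
      ((1 : Matrix (Fin n) (Fin n) (CKA K A)) i j)
      (CKA.ext fun κ => DD.ev_zero (g κ i j))
      (CKA.ext fun κ => by
        refine (DD.ev_one (g κ i j)).trans ?_
        rw [mapCK_ev]
        change DD.right φ (AlgHom.id ℂ B) (g κ i j) = φ (CKA.ev κ ((1 : Matrix (Fin n) (Fin n) (CKA K A)) i j))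
        rw [hg1']
        by_cases hij : i = j
        · subst hij; simp
        · simp [hij])
  have hVev : ∀ t, IsUnit (V.map (DD.ev _ _ t)) := fun t => isUnit_CKA _ fun κ =>
    isUnit_map_alg (hg κ) (DD.ev φ (AlgHom.id ℂ B) t)
  have hV : IsUnit V := DD.isUnit_of_ev hK.cs hK.cs V hVev
  obtain ⟨U, hU, γ, hγ⟩ := S_cor hK.diag V hV
  let ι : A →ₐ[ℂ] DD φ (AlgHom.id ℂ B) := (dlt φ h.1).comp (constK II)
  have hιc : Continuous ι := (continuous_dlt φ h.1).comp continuous_constK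
  let aa : II × K → Matrix (Fin n) (Fin n) A := fun p =>
    ((γ p.1).map (DD.right (mapCK K φ h.1) (mapCK K φ h.1))).map (CKA.ev p.2)
  have haac : Continuous aa := continuous_matrix fun i j =>
    CKA.continuous_ev2.comp ((DD.continuous_right.comp
      ((γ.continuous.matrix_elem i j).comp continuous_fst)).prodMk continuous_snd)
  have haau : ∀ p, IsUnit (aa p) := fun p => isUnit_map_alg (isUnit_map_alg (hγ p.1) _) _
  let a1 : K → Matrix (Fin n) (Fin n) A := fun κ => aa (1, κ)
  have ha1c : Continuous a1 := haac.comp (by fun_prop)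
  have hinv : Continuous fun κ => ((a1 κ).map ι)⁻¹ :=
    continuous_matInv (ha1c.matrix_map hιc) fun κ => isUnit_map_alg (haau _) ι
  let g1 : C(K, Matrix (Fin n) (Fin n) (DD φ (AlgHom.id ℂ B))) :=
    ⟨fun κ => (U.map (DD.diag (mapCK K φ h.1) hK.1)).map (rhoK φ h.1 κ) * ((a1 κ).map ι)⁻¹, by
      refine Continuous.mul (continuous_matrix fun i j => ?_) hinv
      exact (continuous_rhoK φ h.1).comp (continuous_const.prodMk continuous_id)⟩
  have H1 : ContinuousMap.HomotopicWith g g1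
      (fun F => ∀ κ, F κ ∈ {M : Matrix (Fin n) (Fin n) (DD φ (AlgHom.id ℂ B)) | IsUnit M ∧ M.map (DD.right φ (AlgHom.id ℂ B)) = 1}) := by
    refine homotopicWith_of _ (fun p : II × K => (γ p.1).map (rhoK φ h.1 p.2) * ((aa p).map ι)⁻¹) ?_ ?_ g g1 ?_ ?_
    · refine Continuous.mul (continuous_matrix fun i j => ?_)
        (continuous_matInv (haac.matrix_map hιc) fun p => isUnit_map_alg (haau p) ι)
      exact (continuous_rhoK φ h.1).comp
        (((γ.continuous.matrix_elem i j).comp continuous_fst).prodMk continuous_snd)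
    · intro p
      refine ⟨(isUnit_map_alg (hγ p.1) _).mul (isUnit_matInv (isUnit_map_alg (haau p) ι)), ?_⟩
      exact mat_map_inv_mul _ _ _ (isUnit_map_alg (haau p) ι) rfl
    · intro κ
      have e1 : aa (0, κ) = 1 := by
        change ((γ 0).map _).map _ = _
        rw [γ.source]
        change ((1 : Matrix (Fin n) (Fin n) (CKA K A))).map (CKA.ev κ) = 1
        exact Matrix.map_one _ (map_zero _) (map_one _)
      have e2 : (γ 0).map (rhoK φ h.1 κ) = g κ := by
        rw [γ.source]
        ext i j
        refine DD.ext' (fun t => rfl) rfl ?_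
        rw [hg1', Matrix.map_apply, rhoK_right]
        change φ (CKA.ev κ ((1 : Matrix (Fin n) (Fin n) (CKA K A)) i j)) = _
        by_cases hij : i = j
        · subst hij; simp
        · simp [hij]
      change (γ 0).map (rhoK φ h.1 κ) * ((aa (0, κ)).map ι)⁻¹ = g κ
      rw [e1, e2, Matrix.map_one _ (map_zero _) (map_one _), inv_one, mul_one]
    · intro κ
      change (γ 1).map (rhoK φ h.1 κ) * _ = _
      rw [γ.target]
      rfl
  refine H1.trans ?_
  let rp : II × II → II := fun p => unitInterval.symm (unitInterval.symm p.1 * unitInterval.symm p.2)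
  have hrpc : Continuous rp := by fun_prop
  have hrp0 : ∀ t, rp (0, t) = t := fun t => by simp [rp]
  have hrp1 : ∀ t, rp (1, t) = 1 := fun t => by simp [rp]
  have hrpr : ∀ t, rp (t, 1) = 1 := fun t => by simp [rp]
  let G : II × K → Matrix (Fin n) (Fin n) C(II, A) := fun p i j =>
    ⟨fun t => CKA.ev p.2 (U i j (rp (p.1, t))), by
      exact CKA.continuous_ev2.comp (((U i j).continuous.comp
        (hrpc.comp (by fun_prop))).prodMk continuous_const)⟩
  have hGc : Continuous G := continuous_matrix fun i j => by
    refine ContinuousMap.continuous_of_continuous_uncurry _ ?_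
    exact CKA.continuous_ev2.comp (((U i j).continuous.comp
        (hrpc.comp (by fun_prop : Continuous fun q : (II × K) × II => (q.1.1, q.2)))).prodMk (by fun_prop))
  have hGu : ∀ p, IsUnit (G p) := fun p => isUnit_CK _ fun t => by
    have := isUnit_map_alg (isUnit_map_alg hU (evK (rp (p.1, t)))) (CKA.ev p.2)
    exact this
  have ha1U : ∀ κ, a1 κ = (U.map (evK (1 : II))).map (CKA.ev κ) := fun κ => by
    change ((γ 1).map _).map _ = _
    rw [γ.target]; rfl
  refine homotopicWith_of _ (fun p : II × K => (G p).map (dlt φ h.1) * ((a1 p.2).map ι)⁻¹) ?_ ?_ g1 _ ?_ ?_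
  · exact (hGc.matrix_map (continuous_dlt φ h.1)).mul (hinv.comp continuous_snd)
  · intro p
    refine ⟨(isUnit_map_alg (hGu p) _).mul (isUnit_matInv (isUnit_map_alg (haau _) ι)), ?_⟩
    refine mat_map_inv_mul _ _ _ (isUnit_map_alg (haau _) ι) ?_
    rw [ha1U]
    ext i j
    change φ (CKA.ev p.2 (U i j (rp (p.1, 1)))) = φ (CKA.ev p.2 (U i j 1))
    rw [hrpr]
  · intro κ
    change (G (0, κ)).map (dlt φ h.1) * _ = (U.map (DD.diag (mapCK K φ h.1) hK.1)).map (rhoK φ h.1 κ) * ((a1 κ).map ι)⁻¹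
    congr 1
    ext i j
    refine DD.ext' (fun t => ?_) ?_ ?_
    · change φ (CKA.ev κ (U i j (rp (0, t)))) = φ (CKA.ev κ (U i j t))
      rw [hrp0]
    · change CKA.ev κ (U i j (rp (0, 0))) = CKA.ev κ (U i j 0)
      rw [hrp0]
    · change φ (CKA.ev κ (U i j (rp (0, 1)))) = φ (CKA.ev κ (U i j 1))
      rw [hrp0]
  · intro κ
    change (G (1, κ)).map (dlt φ h.1) * ((a1 κ).map ι)⁻¹ = 1
    have e : (G (1, κ)).map (dlt φ h.1) = (a1 κ).map ι := by
      rw [ha1U]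
      ext i j
      refine DD.ext' (fun t => ?_) ?_ ?_
      · change φ (CKA.ev κ (U i j (rp (1, t)))) = φ (CKA.ev κ (U i j 1))
        rw [hrp1]
      · change CKA.ev κ (U i j (rp (1, 0))) = CKA.ev κ (U i j 1)
        rw [hrp1]
      · change φ (CKA.ev κ (U i j (rp (1, 1)))) = φ (CKA.ev κ (U i j 1))
        rw [hrp1]
    rw [e]
    exact Matrix.mul_nonsing_inv _ ((Matrix.isUnit_iff_isUnit_det _).1 (isUnit_map_alg (haau _) ι))

end WC2Sec

noncomputable section WC3Sec

universe u

open Topology Filter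

local notation "II" => unitInterval

variable {A : Type u} [NormedCommRing A] [NormedAlgebra ℂ A] [CompleteSpace A]
  {B : Type u} [NormedCommRing B] [NormedAlgebra ℂ B] [CompleteSpace B]
  {K : Type u} [TopologicalSpace K] [CompactSpace K] [T2Space K]

/-- linear section of the right evaluation -/
def tauD (φ : A →ₐ[ℂ] B) (b : B) : DD φ (AlgHom.id ℂ B) :=
  DD.mk ⟨fun t => (t : ℝ) • b, by fun_prop⟩ 0 b (by simp) (by simp)

lemma tauD_ev (φ : A →ₐ[ℂ] B) (b : B) (t : II) : DD.ev _ _ t (tauD φ b) = (t : ℝ) • b := rfl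
lemma tauD_right (φ : A →ₐ[ℂ] B) (b : B) : DD.right _ _ (tauD φ b) = b := rfl
lemma tauD_left (φ : A →ₐ[ℂ] B) (b : B) : DD.left _ _ (tauD φ b) = 0 := rfl

lemma continuous_tauD (φ : A →ₐ[ℂ] B) : Continuous (tauD φ) := by
  refine DD.continuous_of ?_ ?_ ?_
  · simp only [tauD_ev]; fun_prop
  · simp only [tauD_left]; fun_prop
  · simp only [tauD_right]; fun_prop

theorem WC_thm {φ : A →ₐ[ℂ] B} (h : CB φ) {n : ℕ} (C : Set (Matrix (Fin n) (Fin n) B)) (hC : Convex ℝ C)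
    (hu : ∀ c ∈ C, IsUnit c) (hne : C.Nonempty)
    (f : C(K, Matrix (Fin n) (Fin n) (DD φ (AlgHom.id ℂ B))))
    (hf : ∀ κ, IsUnit (f κ) ∧ (f κ).map (DD.right φ (AlgHom.id ℂ B)) ∈ C) :
    ∃ e0 : Matrix (Fin n) (Fin n) (DD φ (AlgHom.id ℂ B)),
      (IsUnit e0 ∧ e0.map (DD.right φ (AlgHom.id ℂ B)) ∈ C) ∧
      ContinuousMap.HomotopicWith f (ContinuousMap.const K e0)
      (fun F => ∀ κ, F κ ∈ {M : Matrix (Fin n) (Fin n) (DD φ (AlgHom.id ℂ B)) |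
        IsUnit M ∧ M.map (DD.right φ (AlgHom.id ℂ B)) ∈ C}) := by
  have c1 : CompleteSpace (DD φ (AlgHom.id ℂ B)) := complete_DD h.1 continuous_id
  obtain ⟨c0, hc0⟩ := hne
  obtain ⟨u, hu0, hj⟩ := S_cor h c0 (hu c0 hc0)
  obtain ⟨γ, hγ⟩ := JoinedIn.symm hj
  let e0 : Matrix (Fin n) (Fin n) (DD φ (AlgHom.id ℂ B)) :=
    DD.mat γ γ.continuous u c0 γ.source (by rw [γ.target]; ext i j; rfl)
  have he0 : IsUnit e0 := DD.isUnit_of_ev h.cs CB_id.cs e0 fun t => hγ t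
  have he0r : e0.map (DD.right φ (AlgHom.id ℂ B)) = c0 := rfl
  refine ⟨e0, ⟨he0, he0r ▸ hc0⟩, ?_⟩
  let pf : K → Matrix (Fin n) (Fin n) B := fun κ => (f κ).map (DD.right φ (AlgHom.id ℂ B))
  have hpfc : Continuous pf := f.continuous.matrix_map DD.continuous_right
  have hpfu : ∀ κ, IsUnit (pf κ) := fun κ => hu _ (hf κ).2
  let m : K → Matrix (Fin n) (Fin n) B := fun κ => (pf κ)⁻¹ * c0 - 1
  have hmc : Continuous m := ((continuous_matInv hpfc hpfu).mul continuous_const).sub continuous_const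
  have hpm : ∀ κ (r : ℝ), pf κ * (1 + r • m κ) = (1 - r) • pf κ + r • c0 := by
    intro κ r
    have : pf κ * m κ = c0 - pf κ := by
      change pf κ * ((pf κ)⁻¹ * c0 - 1) = _
      rw [mul_sub, ← mul_assoc, Matrix.mul_nonsing_inv _ ((Matrix.isUnit_iff_isUnit_det _).1 (hpfu κ)),
        one_mul, mul_one]
    have e : pf κ * (r • m κ) = r • (c0 - pf κ) := by
      rw [← this]; exact Matrix.mul_smul _ _ _
    rw [mul_add, mul_one, e, smul_sub, sub_smul, one_smul]; abel
  have hin : ∀ κ (r : ℝ), 0 ≤ r → r ≤ 1 → pf κ * (1 + r • m κ) ∈ C := by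
    intro κ r h0 h1
    rw [hpm]
    exact hC (hf κ).2 hc0 (by linarith) h0 (by ring)
  let s : II × K → Matrix (Fin n) (Fin n) (DD φ (AlgHom.id ℂ B)) := fun p =>
    1 + ((p.1 : ℝ) • m p.2).map (tauD φ)
  have hsc : Continuous s := by
    refine continuous_const.add (Continuous.matrix_map ?_ (continuous_tauD φ))
    exact Continuous.smul (f := fun p : II × K => ((p.1 : ℝ))) (g := fun p : II × K => m p.2)
      (by fun_prop) (hmc.comp continuous_snd)
  have hsr : ∀ p, (s p).map (DD.right φ (AlgHom.id ℂ B)) = 1 + (p.1 : ℝ) • m p.2 := by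
    intro p
    change (1 + ((p.1 : ℝ) • m p.2).map (tauD φ)).map _ = _
    rw [Matrix.map_add _ (map_add _), Matrix.map_one _ (map_zero _) (map_one _)]
    rfl
  have hse : ∀ p t, (s p).map (DD.ev φ (AlgHom.id ℂ B) t) = 1 + ((t : ℝ) * (p.1 : ℝ)) • m p.2 := by
    intro p t
    change (1 + ((p.1 : ℝ) • m p.2).map (tauD φ)).map _ = _
    rw [Matrix.map_add _ (map_add _), Matrix.map_one _ (map_zero _) (map_one _), mul_smul]
    rfl
  have hsu : ∀ p, IsUnit (s p) := fun p => DD.isUnit_of_ev h.cs CB_id.cs _ fun t => by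
    rw [hse]
    have h1 := hu _ (hin p.2 ((t : ℝ) * (p.1 : ℝ)) (mul_nonneg t.2.1 p.1.2.1)
      (mul_le_one₀ t.2.2 p.1.2.1 p.1.2.2))
    rw [Matrix.isUnit_iff_isUnit_det, Matrix.det_mul] at h1
    rw [Matrix.isUnit_iff_isUnit_det]
    exact isUnit_of_mul_isUnit_right h1
  let f1 : C(K, Matrix (Fin n) (Fin n) (DD φ (AlgHom.id ℂ B))) :=
    ⟨fun κ => f κ * s (1, κ), f.continuous.mul (hsc.comp (by fun_prop))⟩
  have H1 : ContinuousMap.HomotopicWith f f1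
      (fun F => ∀ κ, F κ ∈ {M : Matrix (Fin n) (Fin n) (DD φ (AlgHom.id ℂ B)) |
        IsUnit M ∧ M.map (DD.right φ (AlgHom.id ℂ B)) ∈ C}) := by
    refine homotopicWith_of _ (fun p => f p.2 * s p) ((f.continuous.comp continuous_snd).mul hsc) ?_ f f1 ?_ ?_
    · intro p
      refine ⟨(hf p.2).1.mul (hsu p), ?_⟩
      rw [Matrix.map_mul, hsr]
      exact hin p.2 _ p.1.2.1 p.1.2.2
    · intro κ
      have : s (0, κ) = 1 := by
        change 1 + (((0 : II) : ℝ) • m κ).map (tauD φ) = 1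
        ext i j
        refine DD.ext' (fun t => ?_) ?_ ?_ <;> simp [tauD_ev, tauD_left, tauD_right]
      change f κ * s (0, κ) = f κ
      rw [this, mul_one]
    · intro κ; rfl
  refine H1.trans ?_
  have hf1r : ∀ κ, (f1 κ).map (DD.right φ (AlgHom.id ℂ B)) = c0 := by
    intro κ
    change (f κ * s (1, κ)).map _ = c0
    rw [Matrix.map_mul, hsr]
    change pf κ * (1 + ((1 : II) : ℝ) • m κ) = c0
    rw [hpm]; simp
  let g : C(K, Matrix (Fin n) (Fin n) (DD φ (AlgHom.id ℂ B))) :=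
    ⟨fun κ => f1 κ * e0⁻¹, f1.continuous.mul continuous_const⟩
  obtain ⟨H⟩ := WC_core h g (fun κ => ((hf κ).1.mul (hsu _)).mul (isUnit_matInv he0))
    (fun κ => mat_map_inv_mul _ _ _ he0 (hf1r κ))
  have hdet := (Matrix.isUnit_iff_isUnit_det _).1 he0
  refine homotopicWith_of _ (fun p => H p * e0) (H.continuous.mul continuous_const) ?_ f1 _ ?_ ?_
  · intro p
    have := H.prop p.1 p.2
    refine ⟨this.1.mul he0, ?_⟩
    rw [Matrix.map_mul, he0r]
    have h2 : (H p).map (DD.right φ (AlgHom.id ℂ B)) = 1 := this.2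
    rw [h2, one_mul]
    exact hc0
  · intro κ
    rw [H.apply_zero]
    change f1 κ * e0⁻¹ * e0 = f1 κ
    rw [mul_assoc, Matrix.nonsing_inv_mul _ hdet, mul_one]
  · intro κ
    rw [H.apply_one]
    simp

end WC3Sec

noncomputable section NerveSec
universe u
open Topology Filter
local notation "II" => unitInterval

/-- The simplex spanned by a finite set of indices. -/
def Smp {ι : Type u} (σ : Finset ι) : Set (ι → ℝ) :=
  {x | (∀ i, 0 ≤ x i) ∧ (∀ i, i ∉ σ → x i = 0) ∧ ∑ i ∈ σ, x i = 1}

/-- The boundary of a simplex. -/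
def SmpB {ι : Type u} (σ : Finset ι) : Set (ι → ℝ) :=
  {x | x ∈ Smp σ ∧ ∃ i ∈ σ, x i = 0}

variable {ι : Type u}

lemma smp_closed (σ : Finset ι) : IsClosed (Smp σ) := by
  have : Smp σ = (⋂ i, {x : ι → ℝ | 0 ≤ x i}) ∩ ((⋂ i, ⋂ (_ : i ∉ σ), {x : ι → ℝ | x i = 0}) ∩
      {x | ∑ i ∈ σ, x i = 1}) := by
    ext x; simp [Smp]
  rw [this]
  refine (isClosed_iInter fun i => isClosed_le (by fun_prop) (by fun_prop)).inter
    ((isClosed_iInter fun i => isClosed_iInter fun _ => isClosed_eq (by fun_prop) (by fun_prop)).inter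
      (isClosed_eq (by fun_prop) (by fun_prop)))

lemma smp_le_one {σ : Finset ι} {x : ι → ℝ} (h : x ∈ Smp σ) (i : ι) : x i ≤ 1 := by
  by_cases hi : i ∈ σ
  · rw [← h.2.2]; exact Finset.single_le_sum (fun j _ => h.1 j) hi
  · rw [h.2.1 i hi]; norm_num

lemma smp_compact (σ : Finset ι) : IsCompact (Smp σ) := by
  refine (isCompact_univ_pi (fun _ : ι => isCompact_Icc (a := (0:ℝ)) (b := 1))).of_isClosed_subset
    (smp_closed σ) ?_
  intro x hx i _
  exact ⟨hx.1 i, smp_le_one hx i⟩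

lemma smp_erase [DecidableEq ι] {σ : Finset ι} {x : ι → ℝ} (h : x ∈ Smp σ) {i : ι} (hi : i ∈ σ) (h0 : x i = 0) :
    x ∈ Smp (σ.erase i) := by
  refine ⟨h.1, fun j hj => ?_, ?_⟩
  · by_cases hji : j = i
    · rw [hji, h0]
    · exact h.2.1 j (fun hjs => hj (Finset.mem_erase.2 ⟨hji, hjs⟩))
  · have := Finset.add_sum_erase σ x hi
    rw [h0, zero_add] at this
    rw [this, h.2.2]

lemma smp_mono {σ τ : Finset ι} (hs : σ ⊆ τ) : Smp σ ⊆ Smp τ := by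
  intro x h
  refine ⟨h.1, fun i hi => h.2.1 i (fun hh => hi (hs hh)), ?_⟩
  rw [← h.2.2]
  exact (Finset.sum_subset hs (fun i _ hi => h.2.1 i hi)).symm

lemma smp_nonempty {σ : Finset ι} {x : ι → ℝ} (h : x ∈ Smp σ) : σ.Nonempty := by
  rw [Finset.nonempty_iff_ne_empty]
  rintro rfl
  have := h.2.2
  simp at this

lemma smpB_eq [DecidableEq ι] (σ : Finset ι) : SmpB σ = ⋃ i : σ, Smp (σ.erase i) := by
  ext x
  simp only [Set.mem_iUnion]
  constructor
  · rintro ⟨h, i, hi, h0⟩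
    exact ⟨⟨i, hi⟩, smp_erase h hi h0⟩
  · rintro ⟨⟨i, hi⟩, h⟩
    exact ⟨smp_mono (Finset.erase_subset _ _) h, i, hi, h.2.1 i (by simp)⟩

lemma smpB_closed (σ : Finset ι) : IsClosed (SmpB σ) := by
  classical
  rw [smpB_eq]
  exact isClosed_iUnion_of_finite fun i => smp_closed _

lemma smpB_compact (σ : Finset ι) : IsCompact (SmpB σ) :=
  (smp_compact σ).of_isClosed_subset (smpB_closed σ) (fun x h => h.1)

/-- min coordinate -/
def smin (σ : Finset ι) (hσ : σ.Nonempty) (x : ι → ℝ) : ℝ := σ.inf' hσ x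

lemma continuous_smin (σ : Finset ι) (hσ : σ.Nonempty) : Continuous (smin σ hσ) := by
  unfold smin
  exact Continuous.finset_inf'_apply hσ (fun i _ => continuous_apply i)

lemma smin_le {σ : Finset ι} (hσ : σ.Nonempty) (x : ι → ℝ) {i} (hi : i ∈ σ) : smin σ hσ x ≤ x i :=
  Finset.inf'_le _ hi

lemma smin_nonneg {σ : Finset ι} (hσ : σ.Nonempty) {x : ι → ℝ} (hx : x ∈ Smp σ) : 0 ≤ smin σ hσ x :=
  Finset.le_inf' _ _ (fun i _ => hx.1 i)

lemma smin_eq {σ : Finset ι} (hσ : σ.Nonempty) (x : ι → ℝ) : ∃ i ∈ σ, x i = smin σ hσ x := by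
  obtain ⟨i, hi, h⟩ := Finset.exists_mem_eq_inf' hσ x
  exact ⟨i, hi, h.symm⟩

open Classical in
/-- radial projection to the boundary -/
def sproj (σ : Finset ι) (hσ : σ.Nonempty) (x : ι → ℝ) : ι → ℝ := fun i =>
  if i ∈ σ then (x i - smin σ hσ x) / (1 - σ.card * smin σ hσ x) else 0

lemma sproj_mem {σ : Finset ι} (hσ : σ.Nonempty) {x : ι → ℝ} (hx : x ∈ Smp σ)
    (h : 2 * (σ.card * smin σ hσ x) ≤ 1) : sproj σ hσ x ∈ SmpB σ := by
  have hpos : 0 < 1 - σ.card * smin σ hσ x := by linarith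
  refine ⟨⟨fun i => ?_, fun i hi => ?_, ?_⟩, ?_⟩
  · unfold sproj
    split_ifs with hi
    · exact div_nonneg (sub_nonneg.2 (smin_le hσ x hi)) hpos.le
    · rfl
  · simp [sproj, hi]
  · unfold sproj
    rw [Finset.sum_congr rfl (fun i hi => if_pos hi), ← Finset.sum_div, Finset.sum_sub_distrib, hx.2.2]
    simp only [Finset.sum_const, nsmul_eq_mul]
    exact div_self hpos.ne'
  · obtain ⟨i, hi, hh⟩ := smin_eq hσ x
    exact ⟨i, hi, by simp [sproj, hi, hh]⟩

lemma smin_bdry {σ : Finset ι} (hσ : σ.Nonempty) {x : ι → ℝ} (hx : x ∈ SmpB σ) : smin σ hσ x = 0 := by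
  obtain ⟨h, i, hi, h0⟩ := hx
  exact le_antisymm (h0 ▸ smin_le hσ x hi) (smin_nonneg hσ h)

lemma sproj_bdry {σ : Finset ι} (hσ : σ.Nonempty) {x : ι → ℝ} (hx : x ∈ SmpB σ) : sproj σ hσ x = x := by
  funext i
  unfold sproj
  rw [smin_bdry hσ hx]
  split_ifs with hi
  · simp
  · exact (hx.1.2.1 i hi).symm

/-- Extension over one simplex. -/
lemma smp_ext {E : Type u} [TopologicalSpace E] (D : Set E)
    (σ : Finset ι) (hσ : σ.Nonempty)
    (hD : ∀ f : C(SmpB σ, E), (∀ k, f k ∈ D) → ∃ e0 ∈ D,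
      ContinuousMap.HomotopicWith f (ContinuousMap.const _ e0) (fun F => ∀ k, F k ∈ D))
    (g : (ι → ℝ) → E) (hg : ContinuousOn g (SmpB σ)) (hgD : ∀ x ∈ SmpB σ, g x ∈ D) :
    ∃ G : (ι → ℝ) → E, ContinuousOn G (Smp σ) ∧ (∀ x ∈ Smp σ, G x ∈ D) ∧ ∀ x ∈ SmpB σ, G x = g x := by
  classical
  obtain ⟨e0, he0, ⟨H⟩⟩ := hD ⟨_, continuousOn_iff_continuous_restrict.1 hg⟩ (fun k => hgD k k.2)
  have hHD : ∀ t k, H (t, k) ∈ D := fun t k => H.prop t k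
  let R : (ι → ℝ) → ℝ := fun x => 2 * (σ.card * smin σ hσ x)
  have hR : Continuous R := by
    have := continuous_smin σ hσ
    fun_prop
  have hR0 : ∀ x ∈ Smp σ, 0 ≤ R x := fun x hx => by
    have := smin_nonneg hσ hx
    positivity
  let G : (ι → ℝ) → E := fun x => if h : x ∈ Smp σ ∧ R x ≤ 1 then
    H (⟨R x, hR0 x h.1, h.2⟩, ⟨sproj σ hσ x, sproj_mem hσ h.1 h.2⟩) else e0
  have c1 : ContinuousOn G (Smp σ ∩ {x | R x ≤ 1}) := by
    rw [continuousOn_iff_continuous_restrict]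
    have : (Smp σ ∩ {x | R x ≤ 1}).domRestrict G = fun x : ↥(Smp σ ∩ {x | R x ≤ 1}) => H (⟨R x, hR0 x x.2.1, x.2.2⟩, ⟨sproj σ hσ x, sproj_mem hσ x.2.1 x.2.2⟩) := by
      funext x
      exact dif_pos x.2
    rw [this]
    refine H.continuous.comp (Continuous.prodMk ?_ ?_)
    · exact Continuous.subtype_mk (hR.comp continuous_subtype_val) _
    · refine Continuous.subtype_mk ?_ _
      refine continuous_pi fun i => ?_
      unfold sproj
      by_cases hi : i ∈ σ
      · simp only [hi, if_true]
        have hc := (continuous_smin σ hσ).comp (continuous_subtype_val (p := (· ∈ Smp σ ∩ {x | R x ≤ 1})))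
        refine Continuous.div ?_ ?_ ?_
        · exact ((continuous_apply i).comp continuous_subtype_val).sub hc
        · exact continuous_const.sub (continuous_const.mul hc)
        · intro x
          have : 2 * (σ.card * smin σ hσ x) ≤ 1 := x.2.2
          apply ne_of_gt
          linarith
      · simp only [hi, if_false]
        exact continuous_const
  have c2 : ContinuousOn G (Smp σ ∩ {x | 1 ≤ R x}) := by
    refine (continuousOn_const (c := e0)).congr ?_
    intro x hx
    by_cases h : x ∈ Smp σ ∧ R x ≤ 1
    · have h1 : R x = 1 := le_antisymm h.2 hx.2
      simp only [G, dif_pos h]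
      have : (⟨R x, hR0 x h.1, h.2⟩ : II) = 1 := Subtype.ext h1
      rw [this]
      exact H.apply_one _
    · simp only [G, dif_neg h]
  refine ⟨G, ?_, ?_, ?_⟩
  · have hu : Smp σ = (Smp σ ∩ {x | R x ≤ 1}) ∪ (Smp σ ∩ {x | 1 ≤ R x}) := by
      rw [← Set.inter_union_distrib_left]
      refine (Set.inter_eq_left.2 ?_).symm
      intro x _
      exact le_total (R x) 1
    rw [hu]
    exact c1.union_of_isClosed c2 ((smp_closed σ).inter (isClosed_le hR continuous_const))
      ((smp_closed σ).inter (isClosed_le continuous_const hR))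
  · intro x hx
    by_cases h : x ∈ Smp σ ∧ R x ≤ 1
    · simp only [G, dif_pos h]
      exact hHD _ _
    · simp only [G, dif_neg h]
      exact he0
  · intro x hx
    have hr : R x = 0 := by simp [R, smin_bdry hσ hx]
    have h : x ∈ Smp σ ∧ R x ≤ 1 := ⟨hx.1, by rw [hr]; norm_num⟩
    simp only [G, dif_pos h]
    have : (⟨R x, hR0 x h.1, h.2⟩ : II) = 0 := Subtype.ext hr
    rw [this, H.apply_zero]
    simp [sproj_bdry hσ hx]

lemma smp_step {E : Type u} [TopologicalSpace E] (N : Finset ι → Prop) (D : Finset ι → Set E)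
    (hNd : ∀ σ τ : Finset ι, τ ⊆ σ → τ.Nonempty → N σ → N τ)
    (hDm : ∀ σ τ : Finset ι, τ ⊆ σ → D τ ⊆ D σ)
    (hD : ∀ σ, N σ → ∀ f : C(SmpB σ, E), (∀ k, f k ∈ D σ) → ∃ e0 ∈ D σ,
      ContinuousMap.HomotopicWith f (ContinuousMap.const _ e0) (fun F => ∀ k, F k ∈ D σ))
    (n : ℕ) (g : (ι → ℝ) → E)
    (hg : ∀ σ, N σ → σ.card ≤ n → ContinuousOn g (Smp σ) ∧ ∀ x ∈ Smp σ, g x ∈ D σ) :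
    ∃ G : (ι → ℝ) → E, (∀ σ, N σ → σ.card ≤ n + 1 → ContinuousOn G (Smp σ) ∧ ∀ x ∈ Smp σ, G x ∈ D σ) ∧
      ∀ σ, σ.card ≤ n → ∀ x ∈ Smp σ, G x = g x := by
  classical
  have key : ∀ σ, ∃ F : (ι → ℝ) → E, N σ → σ.card = n + 1 → ContinuousOn F (Smp σ) ∧
      (∀ x ∈ Smp σ, F x ∈ D σ) ∧ ∀ x ∈ SmpB σ, F x = g x := by
    intro σ
    by_cases hs : N σ ∧ σ.card = n + 1
    · have hne : σ.Nonempty := Finset.card_pos.1 (by omega)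
      have hmem : ∀ i : σ, ∀ x ∈ Smp (σ.erase i), N (σ.erase i) := fun i x hx =>
        hNd σ _ (Finset.erase_subset _ _) (smp_nonempty hx) hs.1
      have hcard : ∀ i : σ, (σ.erase (i:ι)).card ≤ n := fun i => by
        rw [Finset.card_erase_of_mem i.2]; omega
      obtain ⟨F, h1, h2, h3⟩ := smp_ext (D σ) σ hne (hD σ hs.1) g (by
        rw [smpB_eq]
        refine (locallyFinite_of_finite _).continuousOn_iUnion (fun i => smp_closed _) ?_
        intro i
        by_cases hN : (Smp (σ.erase (i:ι))).Nonempty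
        · obtain ⟨x, hx⟩ := hN
          exact (hg _ (hmem i x hx) (hcard i)).1
        · rw [Set.not_nonempty_iff_eq_empty.1 hN]
          exact continuousOn_empty _) (by
        intro x hx
        rw [smpB_eq] at hx
        obtain ⟨i, hx⟩ := Set.mem_iUnion.1 hx
        exact hDm _ _ (Finset.erase_subset _ _) ((hg _ (hmem i x hx) (hcard i)).2 x hx))
      exact ⟨F, fun _ _ => ⟨h1, h2, h3⟩⟩
    · exact ⟨g, fun a b => absurd ⟨a, b⟩ hs⟩
  choose F hF using key
  have zero_of : ∀ σ τ : Finset ι, τ.card ≤ σ.card → σ ≠ τ → ∀ x ∈ Smp σ, x ∈ Smp τ → x ∈ SmpB σ := by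
    intro σ τ hc hne x hx hx'
    refine ⟨hx, ?_⟩
    by_contra hcon
    push Not at hcon
    apply hne
    refine Finset.eq_of_subset_of_card_le (fun i hi => ?_) hc
    by_contra hi'
    exact hcon i hi (hx'.2.1 i hi')
  let G : (ι → ℝ) → E := fun x => if h : ∃ σ, N σ ∧ σ.card = n + 1 ∧ x ∈ Smp σ then F h.choose x else g x
  have hGlow : ∀ σ, σ.card ≤ n → ∀ x ∈ Smp σ, G x = g x := by
    intro σ hσ x hx
    by_cases h : ∃ σ, N σ ∧ σ.card = n + 1 ∧ x ∈ Smp σ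
    · simp only [G, dif_pos h]
      obtain ⟨a, b, c⟩ := h.choose_spec
      refine (hF _ a b).2.2 x (zero_of _ σ (by omega) ?_ x c hx)
      intro he
      rw [he] at b
      omega
    · simp only [G, dif_neg h]
  have hGtop : ∀ σ, N σ → σ.card = n + 1 → ∀ x ∈ Smp σ, G x = F σ x := by
    intro σ hN hσ x hx
    have h : ∃ σ, N σ ∧ σ.card = n + 1 ∧ x ∈ Smp σ := ⟨σ, hN, hσ, hx⟩
    simp only [G, dif_pos h]
    obtain ⟨a, b, c⟩ := h.choose_spec
    by_cases he : h.choose = σ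
    · rw [he]
    · rw [(hF _ a b).2.2 x (zero_of _ σ (by omega) he x c hx),
        (hF _ hN hσ).2.2 x (zero_of σ _ (by omega) (Ne.symm he) x hx c)]
  refine ⟨G, ?_, hGlow⟩
  intro σ hN hσ
  rcases Nat.lt_or_ge n σ.card with h | h
  · have hc : σ.card = n + 1 := by omega
    refine ⟨(hF σ hN hc).1.congr (hGtop σ hN hc), fun x hx => ?_⟩
    rw [hGtop σ hN hc x hx]
    exact (hF σ hN hc).2.1 x hx
  · refine ⟨(hg σ hN h).1.congr (hGlow σ h), fun x hx => ?_⟩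
    rw [hGlow σ h x hx]
    exact (hg σ hN h).2 x hx

lemma smp_all {E : Type u} [TopologicalSpace E] [Nonempty E] (N : Finset ι → Prop) (D : Finset ι → Set E)
    (hNd : ∀ σ τ : Finset ι, τ ⊆ σ → τ.Nonempty → N σ → N τ)
    (hDm : ∀ σ τ : Finset ι, τ ⊆ σ → D τ ⊆ D σ)
    (hD : ∀ σ, N σ → ∀ f : C(SmpB σ, E), (∀ k, f k ∈ D σ) → ∃ e0 ∈ D σ,
      ContinuousMap.HomotopicWith f (ContinuousMap.const _ e0) (fun F => ∀ k, F k ∈ D σ)) :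
    ∃ G : (ι → ℝ) → E, ∀ σ, N σ → ContinuousOn G (Smp σ) ∧ ∀ x ∈ Smp σ, G x ∈ D σ := by
  classical
  let P : ℕ → ((ι → ℝ) → E) → Prop := fun n g =>
    ∀ σ, N σ → σ.card ≤ n → ContinuousOn g (Smp σ) ∧ ∀ x ∈ Smp σ, g x ∈ D σ
  have hemp : Smp (∅ : Finset ι) = ∅ := by
    ext x; simp [Smp]
  have step := fun n g (hg : P n g) => smp_step N D hNd hDm hD n g hg
  choose nx hnx1 hnx2 using step
  have hbase : P 0 (fun _ => Classical.arbitrary E) := by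
    intro σ _ hc
    have : σ = ∅ := Finset.card_eq_zero.1 (by omega)
    subst this
    rw [hemp]
    exact ⟨continuousOn_empty _, by simp⟩
  let S : ∀ n : ℕ, {g // P n g} := fun n => Nat.rec ⟨_, hbase⟩ (fun n s => ⟨nx n s.1 s.2, hnx1 n s.1 s.2⟩) n
  have hS : ∀ n σ, σ.card ≤ n → ∀ x ∈ Smp σ, (S (n+1)).1 x = (S n).1 x := fun n σ hσ x hx =>
    hnx2 n (S n).1 (S n).2 σ hσ x hx
  have hS' : ∀ n σ, ∀ x ∈ Smp σ, (S (σ.card + n)).1 x = (S σ.card).1 x := by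
    intro n σ x hx
    induction n with
    | zero => rfl
    | succ k ih => rw [← ih]; exact hS (σ.card + k) σ (Nat.le_add_right _ _) x hx
  let G : (ι → ℝ) → E := fun x => if h : ∃ σ, x ∈ Smp σ then (S h.choose.card).1 x else Classical.arbitrary E
  have hG : ∀ σ, ∀ x ∈ Smp σ, G x = (S σ.card).1 x := by
    intro σ x hx
    have h : ∃ σ, x ∈ Smp σ := ⟨σ, hx⟩
    simp only [G, dif_pos h]
    rw [← hS' σ.card h.choose x h.choose_spec, ← hS' h.choose.card σ x hx, add_comm]
  refine ⟨G, fun σ hN => ?_⟩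
  have := (S σ.card).2 σ hN le_rfl
  refine ⟨this.1.congr (hG σ), fun x hx => ?_⟩
  rw [hG σ x hx]
  exact this.2 x hx

theorem nerve_thm {V : Type u} [NormedAddCommGroup V] [NormedSpace ℝ V] (Z : Set V) (hZ : IsOpen Z)
    {E : Type u} [TopologicalSpace E] (p : E → V)
    (WC : ∀ C : Set V, Convex ℝ C → C.Nonempty → C ⊆ Z →
      ∀ (K : Type u) [TopologicalSpace K] [CompactSpace K] [T2Space K] (f : C(K, E)),
        (∀ k, p (f k) ∈ C) → ∃ e0, p e0 ∈ C ∧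
        ContinuousMap.HomotopicWith f (ContinuousMap.const _ e0) (fun F => ∀ k, p (F k) ∈ C)) :
    ∃ s : Z → E, Continuous s ∧ ∀ z : Z, segment ℝ (z : V) (p (s z)) ⊆ Z := by
  classical
  by_cases hne : Z.Nonempty
  swap
  · have : IsEmpty Z := ⟨fun z => hne ⟨z, z.2⟩⟩
    exact ⟨fun z => (this.false z).elim, continuous_of_const (fun z => (this.false z).elim), fun z => (this.false z).elim⟩
  have hE : Nonempty E := by
    obtain ⟨z, hz⟩ := hne
    obtain ⟨e0, -⟩ := WC {z} (convex_singleton z) ⟨z, rfl⟩ (by simpa using hz) PEmpty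
      ⟨fun x => x.elim, continuous_of_const (fun x => x.elim)⟩ (fun x => x.elim)
    exact ⟨e0⟩
  have hr : ∀ z : Z, ∃ r : ℝ, 0 < r ∧ Metric.ball (z : V) (3 * r) ⊆ Z := by
    intro z
    obtain ⟨r, hr, h⟩ := Metric.isOpen_iff.1 hZ z z.2
    exact ⟨r / 3, by positivity, by rwa [mul_div_cancel₀ r (by norm_num : (3:ℝ) ≠ 0)]⟩
  choose r hr0 hrZ using hr
  let CC : Finset Z → Set V := fun σ => convexHull ℝ (⋃ i ∈ σ, Metric.ball (i : V) (r i))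
  have CCm : ∀ σ τ : Finset Z, τ ⊆ σ → CC τ ⊆ CC σ := fun σ τ h =>
    convexHull_mono (Set.biUnion_subset_biUnion_left h)
  obtain ⟨g, hg⟩ := smp_all (ι := Z) (fun σ => σ.Nonempty ∧ CC σ ⊆ Z) (fun σ => p ⁻¹' CC σ)
    (fun σ τ h hn hN => ⟨hn, (CCm σ τ h).trans hN.2⟩)
    (fun σ τ h => Set.preimage_mono (CCm σ τ h))
    (by
      intro σ hN f hf
      have := isCompact_iff_compactSpace.1 (smpB_compact σ)
      obtain ⟨i, hi⟩ := hN.1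
      exact WC (CC σ) (convex_convexHull ℝ _)
        ⟨i, subset_convexHull ℝ _ (Set.mem_biUnion hi (Metric.mem_ball_self (hr0 i)))⟩ hN.2 _ f hf)
  obtain ⟨ρ, hρ⟩ := PartitionOfUnity.exists_isSubordinate (ι := Z) (X := Z) (s := Set.univ) isClosed_univ
    (fun i => (Subtype.val ⁻¹' Metric.ball (i : V) (r i) : Set Z))
    (fun i => Metric.isOpen_ball.preimage continuous_subtype_val)
    (fun z _ => Set.mem_iUnion.2 ⟨z, Metric.mem_ball_self (hr0 z)⟩)
  have hmem : ∀ z0 z : Z, ρ.fintsupport z ⊆ ρ.fintsupport z0 → (fun i => ρ i z) ∈ Smp (ρ.fintsupport z0) := by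
    intro z0 z hz
    have hh : ∀ i, i ∉ ρ.fintsupport z0 → ρ i z = 0 := by
      intro i hi
      by_contra hcon
      exact hi (hz ((ρ.mem_fintsupport_iff z i).2 (subset_closure hcon)))
    refine ⟨fun i => ρ.nonneg i z, hh, ?_⟩
    rw [← ρ.sum_eq_one (Set.mem_univ z)]
    refine (finsum_eq_sum_of_support_subset _ ?_).symm
    intro i hi
    by_contra hcon
    exact hi (hh i hcon)
  have hN : ∀ z : Z, (ρ.fintsupport z).Nonempty ∧
      ∃ i : Z, CC (ρ.fintsupport z) ⊆ Metric.ball (i : V) (3 * r i) ∧ (z : V) ∈ Metric.ball (i : V) (3 * r i) := by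
    intro z
    have hn := smp_nonempty (hmem z z (Finset.Subset.refl _))
    refine ⟨hn, ?_⟩
    have hball : ∀ i ∈ ρ.fintsupport z, dist (z : V) i < r i := fun i hi =>
      hρ i ((ρ.mem_fintsupport_iff z i).1 hi)
    obtain ⟨i, hi, hmax⟩ := Finset.exists_max_image (ρ.fintsupport z) r hn
    refine ⟨i, convexHull_min ?_ (convex_ball _ _), ?_⟩
    · intro x hx
      obtain ⟨j, hj, hx⟩ := Set.mem_iUnion₂.1 hx
      have h1 := hball j hj
      have h2 := hball i hi
      have h3 := hmax j hj
      rw [Metric.mem_ball] at hx ⊢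
      have h4 := dist_triangle x (j : V) i
      have h5 := dist_triangle_left (j : V) i z
      linarith
    · rw [Metric.mem_ball]
      have h2 := hball i hi
      have := hr0 i
      linarith
  refine ⟨fun z => g (fun i => ρ i z), ?_, ?_⟩
  · rw [continuous_iff_continuousAt]
    intro z0
    obtain ⟨hn, i, hi, -⟩ := hN z0
    have hc := (hg (ρ.fintsupport z0) ⟨hn, hi.trans (hrZ i)⟩).1 _ (hmem z0 z0 (Finset.Subset.refl _))
    refine hc.tendsto.comp ?_
    refine tendsto_nhdsWithin_iff.2 ⟨?_, ?_⟩
    · exact (continuous_pi fun i => (ρ i).continuous).tendsto z0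
    · filter_upwards [ρ.eventually_fintsupport_subset z0] with z hz
      exact hmem z0 z hz
  · intro z
    obtain ⟨hn, i, hi, hzi⟩ := hN z
    have h2 := (hg (ρ.fintsupport z) ⟨hn, hi.trans (hrZ i)⟩).2 _ (hmem z z (Finset.Subset.refl _))
    exact ((convex_ball (i : V) (3 * r i)).segment_subset hzi (hi h2)).trans (hrZ i)

end NerveSec

noncomputable section FinSec
universe u
open Topology Filter
local notation "II" => unitInterval

/-- Bundled map on invertible matrices. -/
def glC {R S : Type*} [Ring R] [TopologicalSpace R] [Ring S] [TopologicalSpace S] [Algebra ℂ R] [Algebra ℂ S]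
    (φ : R →ₐ[ℂ] S) (hφ : Continuous φ) (n : ℕ) : C(GLn R n, GLn S n) :=
  ⟨glMap φ.toRingHom n, continuous_glMap _ n hφ⟩

lemma glC_val {R S : Type*} [Ring R] [TopologicalSpace R] [Ring S] [TopologicalSpace S] [Algebra ℂ R] [Algebra ℂ S]
    (φ : R →ₐ[ℂ] S) (hφ : Continuous φ) (n : ℕ) (M : GLn R n) : (glC φ hφ n M).1 = M.1.map φ := rfl

variable {A : Type u} [NormedCommRing A] [NormedAlgebra ℂ A] [CompleteSpace A]
  {B : Type u} [NormedCommRing B] [NormedAlgebra ℂ B] [CompleteSpace B]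

lemma isOpen_GL (n : ℕ) : IsOpen {M : Matrix (Fin n) (Fin n) B | IsUnit M} := by
  have : {M : Matrix (Fin n) (Fin n) B | IsUnit M} = (fun M => M.det) ⁻¹' {b : B | IsUnit b} := by
    ext M; exact Matrix.isUnit_iff_isUnit_det M
  rw [this]
  exact Units.isOpen.preimage (continuous_id.matrix_det)

lemma homotopic_of {X Y : Type*} [TopologicalSpace X] [TopologicalSpace Y] (f g : C(X, Y)) (H : II × X → Y)
    (hc : Continuous H) (h0 : ∀ x, H (0, x) = f x) (h1 : ∀ x, H (1, x) = g x) : f.Homotopic g :=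
  ⟨⟨⟨H, hc⟩, h0, h1⟩⟩

lemma nerve_apply {φ : A →ₐ[ℂ] B} (h : CB φ) (n : ℕ) :
    ∃ s : GLn B n → GLn (DD φ (AlgHom.id ℂ B)) n, Continuous s ∧
      ∀ (z : GLn B n) (t : II), IsUnit (((1 - t : ℝ)) • (s z).1.map (DD.right φ (AlgHom.id ℂ B)) + (t : ℝ) • z.1) := by
  letI : NormedAddCommGroup (Matrix (Fin n) (Fin n) B) := Matrix.normedAddCommGroup
  letI : NormedSpace ℝ (Matrix (Fin n) (Fin n) B) := Matrix.normedSpace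
  obtain ⟨s, hs, hseg⟩ := nerve_thm (V := Matrix (Fin n) (Fin n) B) {M | IsUnit M} (isOpen_GL n)
    (E := GLn (DD φ (AlgHom.id ℂ B)) n) (fun e => e.1.map (DD.right φ (AlgHom.id ℂ B))) (by
      intro C hC hne hCZ K _ _ _ f hf
      obtain ⟨e0, he0, ⟨H⟩⟩ := WC_thm (K := K) h C hC hCZ hne
        ⟨fun k => (f k).1, continuous_subtype_val.comp f.continuous⟩ (fun k => ⟨(f k).2, hf k⟩)
      refine ⟨⟨e0, he0.1⟩, he0.2, ?_⟩
      refine homotopicWith_of (Y := GLn (DD φ (AlgHom.id ℂ B)) n) {e | e.1.map (DD.right φ (AlgHom.id ℂ B)) ∈ C}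
        (fun q => ⟨H q, (H.prop q.1 q.2).1⟩) (Continuous.subtype_mk H.continuous _) ?_ f _ ?_ ?_
      · intro q
        exact (H.prop q.1 q.2).2
      · intro k
        exact Subtype.ext (H.apply_zero k)
      · intro k
        exact Subtype.ext (H.apply_one k))
  refine ⟨s, hs, fun z t => ?_⟩
  refine hseg z ?_
  refine ⟨t, 1 - t, t.2.1, by linarith [t.2.2], by ring, ?_⟩
  rw [add_comm]

theorem section_thm {φ : A →ₐ[ℂ] B} (h : CB φ) (n : ℕ) :
    ∃ G : C(GLn B n, GLn A n), ((glC φ h.1 n).comp G).Homotopic (ContinuousMap.id _) := by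
  obtain ⟨s, hs, hseg⟩ := nerve_apply h n
  have hsv : Continuous fun z => (s z).1 := continuous_subtype_val.comp hs
  refine ⟨(glC (DD.left φ (AlgHom.id ℂ B)) DD.continuous_left n).comp ⟨s, hs⟩, ?_⟩
  let R : C(GLn B n, GLn B n) := (glC (DD.right φ (AlgHom.id ℂ B)) DD.continuous_right n).comp ⟨s, hs⟩
  have h1 : ((glC φ h.1 n).comp ((glC (DD.left φ (AlgHom.id ℂ B)) DD.continuous_left n).comp ⟨s, hs⟩)).Homotopic R := by
    refine homotopic_of _ _ (fun q => ⟨(s q.2).1.map (DD.ev φ (AlgHom.id ℂ B) q.1), isUnit_map_alg (s q.2).2 _⟩) ?_ ?_ ?_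
    · refine Continuous.subtype_mk ?_ _
      refine continuous_matrix fun i j => ?_
      refine DD.continuous_ev2.comp (Continuous.prodMk ?_ continuous_fst)
      exact (hsv.comp continuous_snd).matrix_elem i j
    · intro z
      refine Subtype.ext ?_
      ext i j
      exact DD.ev_zero _
    · intro z
      refine Subtype.ext ?_
      ext i j
      exact DD.ev_one _
  refine h1.trans ?_
  refine homotopic_of _ _ (fun q => ⟨_, hseg q.2 q.1⟩) ?_ ?_ ?_
  · refine Continuous.subtype_mk ?_ _
    refine continuous_matrix fun i j => ?_
    have c1 : Continuous fun q : II × GLn B n => DD.right φ (AlgHom.id ℂ B) ((s q.2).1 i j) :=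
      DD.continuous_right.comp ((hsv.comp continuous_snd).matrix_elem i j)
    have c2 : Continuous fun q : II × GLn B n => q.2.1 i j :=
      (continuous_subtype_val.comp continuous_snd).matrix_elem i j
    have c3 : Continuous fun q : II × GLn B n => (q.1 : ℝ) := continuous_subtype_val.comp continuous_fst
    exact ((continuous_const.sub c3).smul c1).add (c3.smul c2)
  · intro z
    refine Subtype.ext ?_
    simp [R, glC_val]
  · intro z
    refine Subtype.ext ?_
    simp

theorem equiv_thm {φ : A →ₐ[ℂ] B} (h : CB φ) (n : ℕ) :
    ∃ G : C(GLn B n, GLn A n), ((glC φ h.1 n).comp G).Homotopic (ContinuousMap.id _) ∧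
      (G.comp (glC φ h.1 n)).Homotopic (ContinuousMap.id _) := by
  obtain ⟨G, hG⟩ := section_thm h n
  refine ⟨G, hG, ?_⟩
  obtain ⟨H⟩ := hG
  have cD : CompleteSpace (DD φ φ) := complete_DD h.1 h.1
  obtain ⟨G2, hG2⟩ := section_thm (A := C(II, A)) (B := DD φ φ) h.diag n
  let Θf : GLn A n → Matrix (Fin n) (Fin n) (DD φ φ) := fun y =>
    DD.mat (fun t => (H (t, glC φ h.1 n y)).1)
      (continuous_subtype_val.comp (H.continuous.comp (Continuous.prodMk continuous_id continuous_const)))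
      (G (glC φ h.1 n y)).1 y.1 (by rw [H.apply_zero]; rfl) (by rw [H.apply_one]; rfl)
  have hΘu : ∀ y, IsUnit (Θf y) := fun y => DD.isUnit_of_ev h.cs h.cs _ fun t => (H (t, glC φ h.1 n y)).2
  have hΘc : Continuous Θf := by
    refine continuous_matrix fun i j => ?_
    refine DD.continuous_of ?_ ?_ ?_
    · have : Continuous fun q : GLn A n × II => (H (q.2, glC φ h.1 n q.1)).1 :=
        continuous_subtype_val.comp (H.continuous.comp (Continuous.prodMk continuous_snd ((glC φ h.1 n).continuous.comp continuous_fst)))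
      exact this.matrix_elem i j
    · have : Continuous fun y : GLn A n => (G (glC φ h.1 n y)).1 :=
        continuous_subtype_val.comp (G.continuous.comp (glC φ h.1 n).continuous)
      exact this.matrix_elem i j
    · exact (continuous_subtype_val (p := fun M : Matrix (Fin n) (Fin n) A => IsUnit M)).matrix_elem i j
  let Θ : C(GLn A n, GLn (DD φ φ) n) := ⟨fun y => ⟨Θf y, hΘu y⟩, Continuous.subtype_mk hΘc _⟩
  have hT : ((glC (DD.diag φ h.1) h.diag.1 n).comp (G2.comp Θ)).Homotopic Θ :=
    ContinuousMap.Homotopic.comp hG2 (ContinuousMap.Homotopic.refl Θ)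
  have hL := ContinuousMap.Homotopic.comp (ContinuousMap.Homotopic.refl (glC (DD.left φ φ) DD.continuous_left n)) hT
  have hR := ContinuousMap.Homotopic.comp (ContinuousMap.Homotopic.refl (glC (DD.right φ φ) DD.continuous_right n)) hT
  have hM : ((glC (DD.left φ φ) DD.continuous_left n).comp ((glC (DD.diag φ h.1) h.diag.1 n).comp (G2.comp Θ))).Homotopic
      ((glC (DD.right φ φ) DD.continuous_right n).comp ((glC (DD.diag φ h.1) h.diag.1 n).comp (G2.comp Θ))) := by
    refine homotopic_of _ _ (fun q => ⟨(G2 (Θ q.2)).1.map (evK q.1), isUnit_map_alg (G2 (Θ q.2)).2 _⟩) ?_ ?_ ?_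
    · refine Continuous.subtype_mk ?_ _
      refine continuous_matrix fun i j => ?_
      have c1 : Continuous fun q : II × GLn A n => (G2 (Θ q.2)).1 i j := by
        have : Continuous fun q : II × GLn A n => (G2 (Θ q.2)).1 :=
          continuous_subtype_val.comp ((G2.comp Θ).continuous.comp continuous_snd)
        exact this.matrix_elem i j
      exact ContinuousEval.continuous_eval.comp (c1.prodMk continuous_fst)
    · intro y; rfl
    · intro y; rfl
  have e1 : (glC (DD.left φ φ) DD.continuous_left n).comp Θ = G.comp (glC φ h.1 n) := rfl
  have e2 : (glC (DD.right φ φ) DD.continuous_right n).comp Θ = ContinuousMap.id _ := rfl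
  rw [e1] at hL
  rw [e2] at hR
  exact hL.symm.trans (hM.trans hR)

lemma CB_gelfand (A : Type u) [NormedCommRing A] [NormedAlgebra ℂ A] [CompleteSpace A] :
    CB (WeakDual.gelfandTransform ℂ A) := by
  refine ⟨gelfandTransform_continuous A, ?_, ?_⟩
  · intro χ1 χ2 hh
    obtain ⟨x1, h1⟩ := ch_CX χ1
    obtain ⟨x2, h2⟩ := ch_CX χ2
    have hx : x1 = x2 := by
      refine WeakDual.CharacterSpace.ext fun a => ?_
      have := DFunLike.congr_fun hh a
      have e : χ1 (WeakDual.gelfandTransform ℂ A a) = χ2 (WeakDual.gelfandTransform ℂ A a) := this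
      rw [h1, h2] at e
      exact e
    refine AlgHom.ext fun f => ?_
    rw [h1, h2, hx]
  · intro χ
    refine ⟨ContinuousMap.evalAlgHom ℂ ℂ (WeakDual.CharacterSpace.equivAlgHom.symm χ), ?_⟩
    refine AlgHom.ext fun a => ?_
    exact WeakDual.CharacterSpace.equivAlgHom_symm_coe χ ▸ rfl

end FinSec

/-- (Davie) For a unital commutative complex Banach algebra `A` and every `n ≥ 1`, the map
`GL_n(A) → GL_n(C(X_A))` induced by the Gelfand transform is a homotopy equivalence. -/
theorem davie_homotopyEquiv_of_gelfand (A : Type*)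
    [NormedCommRing A] [NormedAlgebra ℂ A] [CompleteSpace A] (n : ℕ) (hn : 1 ≤ n) :
    ∃ G : C(GLn C(WeakDual.characterSpace ℂ A, ℂ) n, GLn A n),
      ((⟨glMap (WeakDual.gelfandTransform ℂ A).toRingHom n,
          continuous_glMap _ n (gelfandTransform_continuous A)⟩ :
            C(GLn A n, GLn C(WeakDual.characterSpace ℂ A, ℂ) n)).comp G).Homotopic
        (ContinuousMap.id _) ∧
      (G.comp (⟨glMap (WeakDual.gelfandTransform ℂ A).toRingHom n,
          continuous_glMap _ n (gelfandTransform_continuous A)⟩ :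
            C(GLn A n, GLn C(WeakDual.characterSpace ℂ A, ℂ) n))).Homotopic
        (ContinuousMap.id _) := by
  exact equiv_thm (CB_gelfand A) n
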